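/- The only pairs (x, y) ∈ ℚ × ℚ satisfying y² = 4x⁷ − 11x⁶ + 14x⁵ − 7x⁴ − 2x³ + 6x² − 4x + 1 are (x, y) ∈ {(0, 1), (0, −1), (1, 1), (1, −1)}. -/

import Mathlib

namespace Q13

theorem coprime_sq {a b v : ℤ} (h : IsCoprime a b) (hv : a * b = v ^ 2) (ha : 0 < a) :
    ∃ c : ℤ, a = c ^ 2 := by
  obtain ⟨c, hc⟩ := Int.sq_of_isCoprime h hv
  rcases hc with hc | hc
  · exact ⟨c, hc⟩
  · exact ⟨c, by nlinarith [sq_nonneg c]⟩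

theorem coprime_sq' {a b v : ℤ} (h : IsCoprime a b) (hv : a * b = v ^ 2) (ha : 0 < b) :
    ∃ c : ℤ, b = c ^ 2 := coprime_sq h.symm (by rw [mul_comm]; exact hv) ha

/-- reduction to two squares -/
theorem part0 (x y : ℚ)
    (h : y ^ 2 = 4 * x ^ 7 - 11 * x ^ 6 + 14 * x ^ 5 - 7 * x ^ 4 - 2 * x ^ 3 + 6 * x ^ 2
      - 4 * x + 1) :
    ∃ u v : ℚ, u ^ 2 = x ^ 3 - x ^ 2 + 1 ∧
      v ^ 2 = 4 * x ^ 4 - 7 * x ^ 3 + 7 * x ^ 2 - 4 * x + 1 := by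
  set a : ℤ := x.num with ha
  obtain ⟨b, hb⟩ : ∃ b : ℤ, b = (x.den : ℤ) := ⟨_, rfl⟩
  have hbpos : 0 < b := by simp [hb, x.pos]
  have hbq : (b : ℚ) ≠ 0 := by exact_mod_cast hbpos.ne'
  have hx : x = a / b := by rw [ha, hb]; push_cast; exact (Rat.num_div_den x).symm
  have hcop : IsCoprime a b := by
    rw [hb]
    rw [Int.isCoprime_iff_gcd_eq_one]; exact x.reduced
  clear_value a
  set g : ℤ := a ^ 3 - a ^ 2 * b + b ^ 3 with hg
  set q : ℤ := 4 * a ^ 4 - 7 * a ^ 3 * b + 7 * a ^ 2 * b ^ 2 - 4 * a * b ^ 3 + b ^ 4 with hq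
  have hqpos : 0 < q := by
    have : 0 < a ^ 2 + b ^ 2 := by positivity
    have h2 : 64 * q = (16 * a ^ 2 - 14 * a * b + 4 * b ^ 2) ^ 2 +
      (124 * a ^ 2 * b ^ 2 - 144 * a * b ^ 3 + 48 * b ^ 4) := by rw [hq]; ring
    have h3 : 0 < 124 * a ^ 2 * b ^ 2 - 144 * a * b ^ 3 + 48 * b ^ 4 := by
      have : 124 * a ^ 2 * b ^ 2 - 144 * a * b ^ 3 + 48 * b ^ 4
        = b ^ 2 * (2 * (6 * b - 9 * a) ^ 2 -38 * a ^ 2 + 72 * a * b - 24 * b ^ 2) := by ring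
      have h4 : 124 * a ^ 2 * b ^ 2 - 144 * a * b ^ 3 + 48 * b ^ 4
        = b ^ 2 * (3 * (4 * b - 6 * a) ^ 2 + 16 * a ^ 2) := by ring
      rw [h4]
      have : 0 < 3 * (4 * b - 6 * a) ^ 2 + 16 * a ^ 2 := by
        by_contra hcon
        have h5 : a ^ 2 = 0 := by nlinarith [sq_nonneg (4 * b - 6 * a), sq_nonneg a]
        have h6 : a = 0 := by simpa using h5
        subst h6
        nlinarith
      positivity
    nlinarith [sq_nonneg (16 * a ^ 2 - 14 * a * b + 4 * b ^ 2)]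
  -- the integer square
  have hintg : ∃ n : ℤ, n ^ 2 = g * (b * q) := by
    have h1 : (y * b ^ 4) ^ 2 = ((g * (b * q) : ℤ) : ℚ) := by
      rw [mul_pow, h, hx, hg, hq]; push_cast; field_simp; ring
    have h2 : IsSquare (((g * (b * q) : ℤ) : ℚ)) := ⟨y * b ^ 4, by rw [← h1]; ring⟩
    rw [Rat.isSquare_intCast_iff] at h2
    obtain ⟨n, hn⟩ := h2
    exact ⟨n, by rw [hn]; ring⟩
  obtain ⟨n, hn⟩ := hintg
  have hodd : g % 2 = 1 := by
    obtain ⟨s, t, hst⟩ := hcop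
    rcases Int.emod_two_eq_zero_or_one a with h1 | h1 <;>
    rcases Int.emod_two_eq_zero_or_one b with h2 | h2
    · exfalso
      have : (s * a + t * b) % 2 = 0 := by simp [Int.add_emod, Int.mul_emod, h1, h2]
      omega
    all_goals
      rw [hg]; simp [Int.add_emod, Int.sub_emod, Int.mul_emod, h1, h2, pow_succ]
  have hgb : IsCoprime g b := by
    have : IsCoprime (a ^ 3) b := hcop.pow_left
    have h2 : g = a ^ 3 + b * (b ^ 2 - a ^ 2) := by rw [hg]; ring
    rw [h2]; exact this.add_mul_left_left _
  have hgq : IsCoprime g q := by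
    rw [Int.isCoprime_iff_gcd_eq_one]
    by_contra hne
    obtain ⟨p, hp, hpd⟩ := Nat.exists_prime_and_dvd hne
    have hpg : (p : ℤ) ∣ g := (Int.natCast_dvd_natCast.mpr hpd).trans (Int.gcd_dvd_left ..)
    have hpq : (p : ℤ) ∣ q := (Int.natCast_dvd_natCast.mpr hpd).trans (Int.gcd_dvd_right ..)
    have hpp := Nat.prime_iff_prime_int.mp hp
    have hpb : ¬ (p : ℤ) ∣ b := fun hb' => hpp.not_isUnit (hgb.isUnit_of_dvd' hpg hb')
    -- q = 4 (a-b)^2 b^2 + (4a - 3b) g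
    have h1 : (p : ℤ) ∣ 4 * (a - b) ^ 2 * b ^ 2 := by
      have : 4 * (a - b) ^ 2 * b ^ 2 = q - (4 * a - 3 * b) * g := by rw [hg, hq]; ring
      rw [this]; exact dvd_sub hpq (hpg.mul_left _)
    have hp2 : ¬ (p : ℤ) ∣ 4 := by
      intro h4
      have : (p : ℤ) ∣ 2 := hpp.dvd_of_dvd_pow (n := 2) (by norm_num; exact h4)
      have := this.trans (a := (p : ℤ)) (dvd_refl _)
      have hp2 : p = 2 := by
        have : p ∣ 2 := by exact_mod_cast this
        exact (Nat.prime_dvd_prime_iff_eq hp Nat.prime_two).mp this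
      subst hp2
      have : (2 : ℤ) ∣ g := by exact_mod_cast hpg
      omega
    rcases hpp.dvd_or_dvd h1 with h2 | h2
    · rcases hpp.dvd_or_dvd h2 with h3 | h3
      · exact hp2 h3
      · have h4 := hpp.dvd_of_dvd_pow h3
        have h5 : (p : ℤ) ∣ b ^ 3 := by
          have : b ^ 3 = g - (a - b) * a ^ 2 := by rw [hg]; ring
          rw [this]; exact dvd_sub hpg (h4.mul_right _)
        exact hpb (hpp.dvd_of_dvd_pow h5)
    · exact hpb (hpp.dvd_of_dvd_pow h2)
  have hcop2 : IsCoprime g (b * q) := hgb.mul_right hgq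
  have hbqpos : 0 < b * q := by positivity
  have hgpos : 0 < g := by
    have : 0 ≤ g * (b * q) := by rw [← hn]; positivity
    rcases lt_trichotomy g 0 with h0 | h0 | h0
    · nlinarith
    · omega
    · exact h0
  obtain ⟨u, hu⟩ := coprime_sq hcop2 hn.symm hgpos
  obtain ⟨v, hv⟩ := coprime_sq' hcop2 hn.symm hbqpos
  -- b is a square
  have hbsq : ∃ e : ℤ, b = e ^ 2 := by
    rcases Int.emod_two_eq_zero_or_one b with h2 | h2
    · obtain ⟨b', hb'⟩ : ∃ b', b = 2 * b' := ⟨b / 2, by omega⟩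
      rcases Int.emod_two_eq_zero_or_one b' with h3 | h3
      · obtain ⟨c, hc⟩ : ∃ c, b = 4 * c := ⟨b / 4, by omega⟩
        set q1 : ℤ := a ^ 4 - 7 * a ^ 3 * c + 28 * a ^ 2 * c ^ 2 - 64 * a * c ^ 3 + 64 * c ^ 4
          with hq1
        have e1 : v ^ 2 = 16 * (c * q1) := by rw [← hv, hq, hc, hq1]; ring
        have h4 : (4 : ℤ) ∣ v := by
          have : (4 : ℤ) ^ 2 ∣ v ^ 2 := ⟨c * q1, by rw [e1]; ring⟩
          exact (Int.pow_dvd_pow_iff (by norm_num)).mp this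
        obtain ⟨v1, rfl⟩ := h4
        have e2 : c * q1 = v1 ^ 2 := by nlinarith
        have hac : IsCoprime a c := by
          rw [hc] at hcop; exact hcop.of_mul_right_right
        have hc1 : IsCoprime q1 c := by
          have : q1 = a ^ 4 + c * (- 7 * a ^ 3 + 28 * a ^ 2 * c - 64 * a * c ^ 2 + 64 * c ^ 3) := by
            rw [hq1]; ring
          rw [this]; exact (hac.pow_left).add_mul_left_left _
        obtain ⟨e, he⟩ := coprime_sq hc1.symm e2 (by omega)
        exact ⟨2 * e, by rw [hc, he]; ring⟩
      · exfalso
        set q1 : ℤ := 2 * a ^ 4 - 7 * a ^ 3 * b' + 14 * a ^ 2 * b' ^ 2 - 16 * a * b' ^ 3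
          + 8 * b' ^ 4 with hq1
        have e1 : v ^ 2 = 4 * (b' * q1) := by rw [← hv, hq, hb', hq1]; ring
        have h4 : (2 : ℤ) ∣ v := by
          have : (2 : ℤ) ^ 2 ∣ v ^ 2 := ⟨b' * q1, by rw [e1]; ring⟩
          exact (Int.pow_dvd_pow_iff (by norm_num)).mp this
        obtain ⟨v1, rfl⟩ := h4
        have e2 : b' * q1 = v1 ^ 2 := by nlinarith
        have hac : IsCoprime a b' := by
          rw [hb'] at hcop; exact hcop.of_mul_right_right
        have h2b : IsCoprime 2 b' := by
          rw [Int.isCoprime_iff_gcd_eq_one, Int.gcd_comm]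
          have := (Int.odd_iff.mpr h3)
          exact Int.isCoprime_iff_gcd_eq_one.mp (Int.isCoprime_two_right.mpr this)
        have hc1 : IsCoprime q1 b' := by
          have : q1 = 2 * a ^ 4 + b' * (- 7 * a ^ 3 + 14 * a ^ 2 * b' - 16 * a * b' ^ 2
              + 8 * b' ^ 3) := by
            rw [hq1]; ring
          rw [this]; exact (h2b.mul_left hac.pow_left).add_mul_left_left _
        have hb'pos : 0 < b' := by omega
        have hq1pos : 0 < q1 := by
          have : q = 2 * q1 := by rw [hq, hb', hq1]; ring
          omega
        obtain ⟨e, he⟩ := coprime_sq hc1.symm e2 hb'pos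
        obtain ⟨k, hk⟩ := coprime_sq' hc1.symm e2 hq1pos
        have hgu : u ^ 2 = a ^ 3 - 2 * a ^ 2 * b' + 8 * b' ^ 3 := by rw [← hu, hg, hb']; ring
        have key : ∀ e k u a : ZMod 8, (a ^ 3 - 2 * a ^ 2 * e ^ 2 + 8 * (e ^ 2) ^ 3 = u ^ 2) →
           2 * a ^ 4 - 7 * a ^ 3 * e ^ 2 + 14 * a ^ 2 * (e ^ 2) ^ 2 - 16 * a * (e ^ 2) ^ 3
          + 8 * (e ^ 2) ^ 4 = k ^ 2 → e ^ 2 = 1 → a ^ 2 = 1 → False := by decide +kernel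
        have hoddsq : ∀ z : ℤ, z % 2 = 1 → ((z : ℤ) : ZMod 8) ^ 2 = 1 := by
          intro z hz
          have h8 : z % 8 = 1 ∨ z % 8 = 3 ∨ z % 8 = 5 ∨ z % 8 = 7 := by omega
          have : ((z : ℤ) : ZMod 8) = ((z % 8 : ℤ) : ZMod 8) := by
            rw [ZMod.intCast_eq_intCast_iff]; exact (Int.mod_modEq z 8).symm
          rw [this]
          rcases h8 with h8 | h8 | h8 | h8 <;> rw [h8] <;> decide
        have hao : a % 2 = 1 := by
          rcases Int.emod_two_eq_zero_or_one a with h5 | h5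
          · exfalso
            obtain ⟨a', rfl⟩ : ∃ a', a = 2 * a' := ⟨a / 2, by omega⟩
            have : g = 2 * (4 * a' ^ 3 - 4 * a' ^ 2 * b' + 4 * b' ^ 3) := by rw [hg, hb']; ring
            omega
          · exact h5
        have heo : e % 2 = 1 := by
          rcases Int.emod_two_eq_zero_or_one e with h5 | h5
          · exfalso
            obtain ⟨a', rfl⟩ : ∃ a', e = 2 * a' := ⟨e / 2, by omega⟩
            have : b' = 2 * (2 * a' ^ 2) := by rw [he]; ring
            omega
          · exact h5
        rw [he] at hgu
        refine key (e : ℤ) (k : ℤ) (u : ℤ) (a : ℤ) ?_ ?_ (hoddsq e heo) (hoddsq a hao)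
        · have := congrArg (fun z : ℤ => (z : ZMod 8)) hgu
          push_cast at this; rw [this]
        · have h7 := hk
          rw [hq1, he] at h7
          have := congrArg (fun z : ℤ => (z : ZMod 8)) h7
          push_cast at this; rw [← this]
    · have h2b : IsCoprime 4 b := by
        have : IsCoprime (2 : ℤ) b := (Int.isCoprime_two_left).mpr (Int.odd_iff.mpr h2)
        have := this.pow_left (m := 2)
        norm_num at this; exact this
      have hc1 : IsCoprime q b := by
        have : q = 4 * a ^ 4 + b * (- 7 * a ^ 3 + 7 * a ^ 2 * b - 4 * a * b ^ 2
              + b ^ 3) := by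
            rw [hq]; ring
        rw [this]; exact (h2b.mul_left hcop.pow_left).add_mul_left_left _
      exact coprime_sq hc1.symm hv hbpos
  obtain ⟨e, he⟩ := hbsq
  have he0 : (e : ℚ) ≠ 0 := by
    intro h0; apply hbq; rw [he]; push_cast; rw [h0]; ring
  refine ⟨u / e ^ 3, v / e ^ 5, ?_, ?_⟩
  · have : (u : ℚ) ^ 2 = a ^ 3 - a ^ 2 * e ^ 2 + (e ^ 2) ^ 3 := by
      rw [hg, he] at hu; exact_mod_cast hu.symm
    rw [div_pow, this, hx, he]; push_cast; field_simp
  · have : (v : ℚ) ^ 2 = e ^ 2 * (4 * a ^ 4 - 7 * a ^ 3 * e ^ 2 + 7 * a ^ 2 * (e ^ 2) ^ 2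
       - 4 * a * (e ^ 2) ^ 3 + (e ^ 2) ^ 4) := by
      rw [hq, he] at hv; exact_mod_cast hv.symm
    rw [div_pow, this, hx, he]; push_cast; field_simp

end Q13


set_option linter.unusedSectionVars false
set_option linter.unusedSimpArgs false

namespace Q13

open WeierstrassCurve.Affine

/-- the elliptic curve `y² = x³ - x² + 1` -/
def E (F : Type*) [Field F] : WeierstrassCurve.Affine F :=
  { a₁ := 0, a₂ := -1, a₃ := 0, a₄ := 0, a₆ := 1 }

section curve
variable {F : Type*} [Field F] [DecidableEq F]

/-- `P` is the affine point with coordinates `x`, `y` -/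
def IsPt (P : (E F).Point) (x y : F) : Prop := ∃ h, P = Point.some x y h

theorem IsPt.eq {P : (E F).Point} {x y : F} (h : IsPt P x y) : y ^ 2 = x ^ 3 - x ^ 2 + 1 := by
  obtain ⟨h, -⟩ := h
  have := ((nonsingular_iff' _ _).mp h).1
  rw [equation_iff] at this
  simp only [E] at this
  linear_combination this

theorem IsPt.ns {P : (E F).Point} {x y : F} (h : IsPt P x y) :
    3 * x ^ 2 - 2 * x ≠ 0 ∨ 2 * y ≠ 0 := by
  obtain ⟨h, -⟩ := h
  have := ((nonsingular_iff' _ _).mp h).2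
  simp only [E] at this
  rcases this with h | h
  · left; intro h0; apply h; linear_combination -h0
  · right; intro h0; apply h; linear_combination h0

theorem IsPt.mk {x y : F} (h : y ^ 2 = x ^ 3 - x ^ 2 + 1)
    (h2 : 3 * x ^ 2 - 2 * x ≠ 0 ∨ 2 * y ≠ 0) : ∃ P : (E F).Point, IsPt P x y := by
  have : (E F).Nonsingular x y := by
    rw [nonsingular_iff', equation_iff]
    simp only [E]
    refine ⟨by linear_combination h, ?_⟩
    rcases h2 with h | h
    · left; intro h0; apply h; linear_combination -h0
    · right; intro h0; apply h; linear_combination h0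
  exact ⟨.some x y this, this, rfl⟩

theorem IsPt.inj {P : (E F).Point} {x y x' y' : F} (h : IsPt P x y) (h' : IsPt P x' y') :
    x = x' ∧ y = y' := by
  obtain ⟨h, rfl⟩ := h
  obtain ⟨h', h2⟩ := h'
  simpa using h2

theorem IsPt.uniq {P Q : (E F).Point} {x y : F} (h : IsPt P x y) (h' : IsPt Q x y) :
    P = Q := by
  obtain ⟨h, rfl⟩ := h
  obtain ⟨h', rfl⟩ := h'
  rfl

theorem IsPt.ne_zero {P : (E F).Point} {x y : F} (h : IsPt P x y) : P ≠ 0 := by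
  obtain ⟨h, rfl⟩ := h
  exact Point.some_ne_zero h

theorem isPt_of_ne_zero {P : (E F).Point} (h : P ≠ 0) : ∃ x y, IsPt P x y := by
  cases P with
  | zero => exact absurd rfl h
  | some x y h' => exact ⟨x, y, h', rfl⟩

theorem IsPt.neg {P : (E F).Point} {x y : F} (h : IsPt P x y) : IsPt (-P) x (-y) := by
  obtain ⟨h, rfl⟩ := h
  have e : (E F).negY x y = -y := by simp only [negY, E]; ring
  rw [Point.neg_some]
  have h2 := (nonsingular_neg x y).mpr h
  rw [e] at h2
  exact ⟨h2, by simp only [e]⟩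

theorem IsPt.add {P Q : (E F).Point} {x₁ y₁ x₂ y₂ : F} (h : IsPt P x₁ y₁) (h' : IsPt Q x₂ y₂)
    (hx : x₁ ≠ x₂) {s x₃ y₃ : F} (hs : s * (x₁ - x₂) = y₁ - y₂) (h3 : x₃ = s ^ 2 + 1 - x₁ - x₂)
    (h4 : y₃ = - (s * (x₃ - x₁) + y₁)) : IsPt (P + Q) x₃ y₃ := by
  obtain ⟨h, rfl⟩ := h
  obtain ⟨h', rfl⟩ := h'
  rw [Point.add_of_X_ne hx]
  have e0 : (E F).slope x₁ x₂ y₁ y₂ = s := by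
    rw [slope_of_X_ne hx, div_eq_iff (sub_ne_zero.mpr hx), hs]
  have e1 : (E F).addX x₁ x₂ ((E F).slope x₁ x₂ y₁ y₂) = x₃ := by
    rw [e0]; simp only [addX, E]; rw [h3]; ring
  have e2 : (E F).addY x₁ x₂ y₁ ((E F).slope x₁ x₂ y₁ y₂) = y₃ := by
    rw [addY, negAddY, e1, e0]; simp only [negY, E]; rw [h4]; ring
  have := nonsingular_add h h' (fun hxy => hx hxy.left)
  rw [e1, e2] at this
  exact ⟨this, by simp only [e1, e2]⟩

theorem IsPt.dbl {P : (E F).Point} {x₁ y₁ : F} (h : IsPt P x₁ y₁)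
    (hy : 2 * y₁ ≠ 0) {s x₃ y₃ : F} (hs : s * (2 * y₁) = 3 * x₁ ^ 2 - 2 * x₁)
    (h3 : x₃ = s ^ 2 + 1 - 2 * x₁)
    (h4 : y₃ = - (s * (x₃ - x₁) + y₁)) : IsPt (P + P) x₃ y₃ := by
  obtain ⟨h, rfl⟩ := h
  have hy' : y₁ ≠ (E F).negY x₁ y₁ := by
    intro h0; apply hy; simp only [negY, E] at h0; linear_combination h0
  rw [Point.add_self_of_Y_ne hy']
  have e0 : (E F).slope x₁ x₁ y₁ y₁ = s := by
    rw [slope_of_Y_ne rfl hy', div_eq_iff (sub_ne_zero.mpr hy')]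
    simp only [negY, E]; linear_combination -hs
  have e1 : (E F).addX x₁ x₁ ((E F).slope x₁ x₁ y₁ y₁) = x₃ := by
    rw [e0]; simp only [addX, E]; rw [h3]; ring
  have e2 : (E F).addY x₁ x₁ y₁ ((E F).slope x₁ x₁ y₁ y₁) = y₃ := by
    rw [addY, negAddY, e1, e0]; simp only [negY, E]; rw [h4]; ring
  have := nonsingular_add h h (fun hxy => hy' hxy.right)
  rw [e1, e2] at this
  exact ⟨this, by simp only [e1, e2]⟩

theorem IsPt.x_eq {P Q : (E F).Point} {x y z : F} (h : IsPt P x y) (h' : IsPt Q x z) :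
    Q = P ∨ Q = -P := by
  have h1 := h.eq
  have h2 := h'.eq
  have : (z - y) * (z + y) = 0 := by linear_combination h2 - h1
  rcases mul_eq_zero.mp this with h0 | h0
  · left
    have : z = y := by linear_combination h0
    subst this
    exact h'.uniq h
  · right
    have : z = -y := by linear_combination h0
    subst this
    exact h'.uniq h.neg

/-- the x-coordinate of the double -/
theorem IsPt.dbl_x {P : (E F).Point} {x y : F} (h : IsPt P x y) (hy : 2 * y ≠ 0) :
    ∃ z, IsPt (P + P) ((x ^ 4 - 8 * x + 4) / (4 * y ^ 2)) z := by
  have h1 := h.eq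
  have h2 : (2 : F) ≠ 0 := left_ne_zero_of_mul hy
  have h3 : y ≠ 0 := right_ne_zero_of_mul hy
  refine ⟨_, h.dbl hy (s := (3 * x ^ 2 - 2 * x) / (2 * y)) (by field_simp) ?_ rfl⟩
  have h4 : (4 : F) ≠ 0 := by
    have : (4 : F) = 2 * 2 := by norm_num
    rw [this]; exact mul_ne_zero h2 h2
  rw [div_pow, mul_pow]
  have e : (2 : F) ^ 2 = 4 := by norm_num
  rw [e]
  field_simp
  linear_combination (8 * x - 4) * h1

/-- `G = (0,1)` -/
def G [NeZero (2 : F)] : (E F).Point := .some 0 1 (by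
    rw [nonsingular_iff', equation_iff]
    simp only [E]
    refine ⟨by ring, ?_⟩
    right; simpa using NeZero.ne (2 : F))

theorem isPt_G [NeZero (2 : F)] : IsPt (G : (E F).Point) 0 1 := ⟨_, rfl⟩

end curve

end Q13


namespace Q13

open Polynomial NumberField

noncomputable section nf

/-- the cubic -/
def gpol : ℚ[X] := X ^ 3 - X ^ 2 + 1

theorem gpol_natDegree : gpol.natDegree = 3 := by
  unfold gpol; compute_degree!

theorem gpol_monic : gpol.Monic := by
  unfold gpol; monicity!

theorem cubic_no_root (x : ℚ) : x ^ 3 - x ^ 2 + 1 ≠ 0 := by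
  intro h
  have hintg : IsIntegral ℤ x := by
    refine ⟨X ^ 3 - X ^ 2 + 1, by monicity!, ?_⟩
    simpa using h
  obtain ⟨n, hn⟩ := IsIntegrallyClosed.isIntegral_iff.mp hintg
  have hn' : (n : ℚ) = x := by simpa using hn
  rw [← hn'] at h
  have h2 : n ^ 3 - n ^ 2 + 1 = 0 := by exact_mod_cast h
  have h3 : n * (n * (n - 1)) = -1 := by linear_combination h2
  have : n ∣ 1 := ⟨-(n * (n - 1)), by linear_combination h2⟩
  rcases Int.isUnit_iff.mp (isUnit_of_dvd_one this) with h | h <;> rw [h] at h2 <;> norm_num at h2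

instance gpol_irr : Fact (Irreducible gpol) := ⟨by
  rw [gpol_monic.irreducible_iff_roots_eq_zero_of_degree_le_three (by rw [gpol_natDegree]; norm_num)
    (by rw [gpol_natDegree])]
  rw [Multiset.eq_zero_iff_forall_notMem]
  intro a ha
  have := (mem_roots'.mp ha).2
  simp only [gpol, IsRoot.def, eval_add, eval_sub, eval_pow, eval_X, eval_one] at this
  exact cubic_no_root a this⟩

/-- the cubic field of discriminant -23 -/
abbrev K := AdjoinRoot gpol

/-- the generator -/
def θ : K := AdjoinRoot.root gpol

theorem θ_eq : θ ^ 3 = θ ^ 2 - 1 := by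
  have : eval₂ (AdjoinRoot.of gpol) θ (X ^ 3 - X ^ 2 + 1) = 0 := AdjoinRoot.eval₂_root gpol
  rw [eval₂_add, eval₂_sub, eval₂_pow, eval₂_pow, eval₂_X, eval₂_one] at this
  linear_combination this

/-- power basis -/
def pb : PowerBasis ℚ K := AdjoinRoot.powerBasis gpol_irr.1.ne_zero

instance : FiniteDimensional ℚ K := pb.finite
instance : CharZero K := algebraRat.charZero K
instance : NumberField K := ⟨⟩

theorem pb_dim : pb.dim = 3 := by
  simp [pb, AdjoinRoot.powerBasis_dim, gpol_natDegree]

/-- the basis `1, θ, θ²` -/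
def bas : Module.Basis (Fin 3) ℚ K := pb.basis.reindex (finCongr pb_dim)

theorem bas_apply (i : Fin 3) : bas i = θ ^ (i : ℕ) := by
  simp [bas, pb, θ]
  rfl

theorem finrank_K : Module.finrank ℚ K = 3 := by
  rw [Module.finrank_eq_card_basis bas]; simp

theorem coords (z : K) : ∃ r s t : ℚ, z = r + s * θ + t * θ ^ 2 := by
  refine ⟨bas.repr z 0, bas.repr z 1, bas.repr z 2, ?_⟩
  have := bas.sum_repr z
  rw [Fin.sum_univ_three, bas_apply, bas_apply, bas_apply] at this
  simp only [Algebra.smul_def] at this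
  conv_lhs => rw [← this]
  simp

theorem coords_inj {r s t r' s' t' : ℚ}
    (h : (r + s * θ + t * θ ^ 2 : K) = r' + s' * θ + t' * θ ^ 2) : r = r' ∧ s = s' ∧ t = t' := by
  have li := bas.linearIndependent
  rw [Fintype.linearIndependent_iff] at li
  have h2 := li ![r - r', s - s', t - t'] (by
    rw [Fin.sum_univ_three, bas_apply, bas_apply, bas_apply]
    simp only [Algebra.smul_def]
    simp
    linear_combination h)
  have e0 := h2 0
  have e1 := h2 1
  have e2 := h2 2
  simp at e0 e1 e2
  refine ⟨by linarith, by linarith, by linarith⟩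

theorem leftMul_θ : Algebra.leftMulMatrix bas θ = !![0, 0, -1; 1, 0, 0; 0, 1, 1] := by
  have key : ∀ (j : Fin 3) (r s t : ℚ), θ * bas j = r + s * θ + t * θ ^ 2 →
      bas.repr (θ * bas j) = Finsupp.equivFunOnFinite.symm ![r, s, t] := by
    intro j r s t h
    apply bas.repr.symm.injective
    rw [LinearEquiv.symm_apply_apply, h, Module.Basis.repr_symm_apply,
      Finsupp.linearCombination_apply, Finsupp.sum_fintype _ _ (by simp), Fin.sum_univ_three, bas_apply, bas_apply, bas_apply]
    simp [Algebra.smul_def]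
  have k0 := key 0 0 1 0 (by rw [bas_apply]; simp)
  have k1 := key 1 0 0 1 (by rw [bas_apply]; simp; ring)
  have k2 := key 2 (-1) 0 1 (by rw [bas_apply]; simp; linear_combination θ_eq)
  ext i j
  rw [Algebra.leftMulMatrix_eq_repr_mul]
  fin_cases j
  · show bas.repr (θ * bas 0) i = _
    rw [k0]; fin_cases i <;> simp
  · show bas.repr (θ * bas 1) i = _
    rw [k1]; fin_cases i <;> simp
  · show bas.repr (θ * bas 2) i = _
    rw [k2]; fin_cases i <;> simp

theorem leftMul (r s t : ℚ) : Algebra.leftMulMatrix bas (r + s * θ + t * θ ^ 2) =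
    !![r, -t, -s-t; s, r, -t; t, s+t, r+s+t] := by
  have h : (r + s * θ + t * θ ^ 2 : K) = algebraMap ℚ K r + algebraMap ℚ K s * θ +
    algebraMap ℚ K t * θ ^ 2 := by simp
  rw [h, map_add, map_add, map_mul, map_mul, map_pow, leftMul_θ]
  simp only [AlgHom.commutes]
  ext i j
  fin_cases i <;> fin_cases j <;>
    simp [Matrix.algebraMap_eq_diagonal, Matrix.mul_apply, Fin.sum_univ_three, pow_two,
      Matrix.diagonal] <;> try ring

theorem norm_eq (r s t : ℚ) : Algebra.norm ℚ (r + s * θ + t * θ ^ 2 : K) =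
    Matrix.det !![r, -t, -s-t; s, r, -t; t, s+t, r+s+t] := by
  rw [Algebra.norm_eq_matrix_det bas, leftMul]

theorem trace_eq (r s t : ℚ) : Algebra.trace ℚ K (r + s * θ + t * θ ^ 2 : K) =
    3 * r + s + t := by
  rw [Algebra.trace_eq_matrix_trace bas, leftMul, Matrix.trace_fin_three]
  simp; ring

theorem discr_bas : Algebra.discr ℚ bas = -23 := by
  rw [Algebra.discr_def]
  have : Algebra.traceMatrix ℚ bas = !![3, 1, 1; 1, 1, -2; 1, -2, -3] := by
    ext i j
    rw [Algebra.traceMatrix_apply, Algebra.traceForm_apply, bas_apply, bas_apply]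
    have e0 : Algebra.trace ℚ K 1 = 3 := by
      have := trace_eq 1 0 0
      simpa using this
    have e1 : Algebra.trace ℚ K θ = 1 := by
      have := trace_eq 0 1 0
      simpa using this
    have e2 : Algebra.trace ℚ K (θ ^ 2) = 1 := by
      have := trace_eq 0 0 1
      simpa using this
    have e3 : Algebra.trace ℚ K (θ ^ 3) = -2 := by
      have := trace_eq (-1) 0 1
      rw [θ_eq]
      convert this using 2
      · simp; ring
      · norm_num
    have e4 : Algebra.trace ℚ K (θ ^ 4) = -3 := by
      have := trace_eq (-1) (-1) 1
      have h : θ ^ 4 = ((-1 : ℚ) + (-1 : ℚ) * θ + (1 : ℚ) * θ ^ 2 : K) := by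
        push_cast
        linear_combination (θ + 1) * θ_eq
      rw [h, this]; norm_num
    fin_cases i <;> fin_cases j <;> simp [← pow_add, ← pow_succ, ← pow_succ', e0, e1, e2, e3, e4]
      <;> simp [← pow_two, e2]
  rw [this, Matrix.det_fin_three]
  simp; norm_num

end nf
end Q13


namespace Q13

open Polynomial NumberField Module

noncomputable section nf2

theorem isInt_θ : IsIntegral ℤ θ := by
  refine ⟨X ^ 3 - X ^ 2 + 1, by monicity!, ?_⟩
  simp only [eval₂_add, eval₂_sub, eval₂_pow, eval₂_X, eval₂_one]
  linear_combination θ_eq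

theorem discr_K : discr K = -23 := by
  have hcard : Fintype.card (Module.Free.ChooseBasisIndex ℤ (𝓞 K)) = Fintype.card (Fin 3) := by
    rw [← Module.finrank_eq_card_basis (RingOfIntegers.basis K), RingOfIntegers.rank, finrank_K]
    simp
  let e := Fintype.equivOfCardEq hcard
  let b := (integralBasis K).reindex e
  have hb : Algebra.discr ℚ b = (discr K : ℚ) := by
    rw [coe_discr]
    have := Algebra.discr_reindex ℚ (integralBasis K) e
    rw [← this]; congr 1; ext i; simp [b]
  have hintg : ∀ i j, ∃ n : ℤ, (n : ℚ) = b.toMatrix bas i j := by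
    intro i j
    have h1 : IsIntegral ℤ (bas j) := by rw [bas_apply]; exact isInt_θ.pow _
    have h2 : ∃ n : ℤ, (n : ℚ) = (integralBasis K).repr (bas j) (e.symm i) := by
      let x : 𝓞 K := ⟨bas j, h1⟩
      refine ⟨(RingOfIntegers.basis K).repr x (e.symm i), ?_⟩
      have := integralBasis_repr_apply K x (e.symm i)
      rw [eq_intCast] at this
      exact this.symm
    obtain ⟨n, hn⟩ := h2
    refine ⟨n, ?_⟩
    rw [hn, Module.Basis.toMatrix_apply]
    simp [b]
  choose N hN using hintg
  have hdet : ∃ m : ℤ, (m : ℚ) = (b.toMatrix bas).det := by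
    refine ⟨(Matrix.of N).det, ?_⟩
    have : b.toMatrix bas = (Matrix.of N).map (Int.castRingHom ℚ) := by
      ext i j; simp [hN]
    rw [this, ← RingHom.mapMatrix_apply, ← RingHom.map_det]; simp
  obtain ⟨m, hm⟩ := hdet
  have key : (-23 : ℚ) = m ^ 2 * discr K := by
    rw [← discr_bas, hm, ← hb, ← Algebra.discr_of_matrix_vecMul]
    congr 1
    exact (Module.Basis.toMatrix_map_vecMul b bas).symm
  have key2 : (-23 : ℤ) = m ^ 2 * discr K := by exact_mod_cast key
  have hm1 : m ^ 2 = 1 := by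
    have h23 : Prime (23 : ℤ) := Int.prime_iff_natAbs_prime.mpr (by norm_num)
    have hd : m ^ 2 ∣ 23 := ⟨- discr K, by linear_combination -key2⟩
    have hm0 : m ≠ 0 := by rintro rfl; norm_num at key2
    have : m ^ 2 ≤ 23 := Int.le_of_dvd (by norm_num) hd
    have h3 : m ≤ 4 := by nlinarith
    have h4 : -4 ≤ m := by nlinarith
    interval_cases m <;> revert hd <;> norm_num
  rw [hm1, one_mul] at key2
  exact key2.symm

theorem nrC : InfinitePlace.nrComplexPlaces K = 1 := by
  have h1 := NumberField.sign_discr K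
  have h2 := InfinitePlace.card_add_two_mul_card_eq_rank K
  rw [finrank_K] at h2
  rw [discr_K] at h1
  have h3 : InfinitePlace.nrComplexPlaces K ≤ 1 := by omega
  interval_cases h : InfinitePlace.nrComplexPlaces K
  · simp at h1
    exact absurd h1 (by decide)
  · rfl

theorem nrR : InfinitePlace.nrRealPlaces K = 1 := by
  have h2 := InfinitePlace.card_add_two_mul_card_eq_rank K
  rw [finrank_K, nrC] at h2
  omega

instance pid : IsPrincipalIdealRing (𝓞 K) := by
  apply RingOfIntegers.isPrincipalIdealRing_of_abs_discr_lt
  rw [discr_K, nrC, finrank_K]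
  have : (3 : ℝ) < Real.pi := Real.pi_gt_three
  norm_num [Nat.factorial]
  nlinarith

theorem rank_K : Units.rank K = 1 := by
  unfold Units.rank
  rw [InfinitePlace.card_eq_nrRealPlaces_add_nrComplexPlaces, nrC, nrR]

/-- θ as a unit -/
def θo : 𝓞 K := ⟨θ, isInt_θ⟩

theorem θo_eq : θo ^ 3 = θo ^ 2 - 1 := by
  apply RingOfIntegers.coe_injective
  have h1 : algebraMap (𝓞 K) K θo = θ := rfl
  rw [map_pow, map_sub, map_pow, map_one, h1]
  exact θ_eq

def θu : (𝓞 K)ˣ := ⟨θo, θo - θo ^ 2, by linear_combination -θo_eq, by linear_combination -θo_eq⟩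

theorem neg_θ_nonsq (r s t d : ℤ) (h1 : r ^ 2 - 2 * s * t - t ^ 2 = 0)
    (h2 : 2 * r * s - t ^ 2 = - d ^ 2) (h3 : s ^ 2 + 2 * r * t + 2 * s * t + t ^ 2 = 0) : d = 0 := by
  have main : ∀ n : ℕ, ∀ r s t d : ℤ, d.natAbs ≤ n → r ^ 2 - 2 * s * t - t ^ 2 = 0 →
    2 * r * s - t ^ 2 = - d ^ 2 → s ^ 2 + 2 * r * t + 2 * s * t + t ^ 2 = 0 → d = 0 := by
    intro n
    induction n with
    | zero => intro r s t d hd _ _ _; omega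
    | succ n ih =>
      intro r s t d hd h1 h2 h3
      have key : ∀ r s t d : ZMod 5, r ^ 2 - 2 * s * t - t ^ 2 = 0 →
        2 * r * s - t ^ 2 = - d ^ 2 → s ^ 2 + 2 * r * t + 2 * s * t + t ^ 2 = 0 →
        r = 0 ∧ s = 0 ∧ t = 0 ∧ d = 0 := by decide +kernel
      have := key r s t d (by exact_mod_cast congrArg (Int.cast : ℤ → ZMod 5) h1)
        (by have := congrArg (Int.cast : ℤ → ZMod 5) h2; push_cast at this; exact this)
        (by exact_mod_cast congrArg (Int.cast : ℤ → ZMod 5) h3)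
      obtain ⟨hr, hs, ht, hd'⟩ := this
      rw [ZMod.intCast_zmod_eq_zero_iff_dvd] at hr hs ht hd'
      obtain ⟨r, rfl⟩ := hr
      obtain ⟨s, rfl⟩ := hs
      obtain ⟨t, rfl⟩ := ht
      obtain ⟨d, rfl⟩ := hd'
      push_cast at *
      by_cases hd0 : d = 0
      · simp [hd0]
      have := ih r s t d (by omega) (by linarith) (by linarith) (by linarith)
      simp [this]
  exact main _ r s t d le_rfl h1 h2 h3

theorem sq_coords (r s t : ℚ) : ((r + s * θ + t * θ ^ 2) ^ 2 : K) =
    ((r ^ 2 - 2 * s * t - t ^ 2 : ℚ) : K) + ((2 * r * s - t ^ 2 : ℚ) : K) * θ +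
      ((s ^ 2 + 2 * r * t + 2 * s * t + t ^ 2 : ℚ) : K) * θ ^ 2 := by
  push_cast
  linear_combination (2 * s * t + t ^ 2 * (θ + 1) : K) * θ_eq

theorem neg_θ_not_sq (z : K) : z ^ 2 ≠ -θ := by
  intro h
  obtain ⟨r, s, t, rfl⟩ := coords z
  rw [sq_coords] at h
  have h2 := coords_inj (h.trans (show (-θ : K) = ((0:ℚ):K) + ((-1 : ℚ):K) * θ + ((0:ℚ):K) * θ ^ 2 by
    push_cast; ring))
  obtain ⟨e1, e2, e3⟩ := h2
  have hr := r.num_div_den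
  have hs := s.num_div_den
  have ht := t.num_div_den
  set d : ℤ := r.den * s.den * t.den with hd
  have hr0 : (r.den : ℚ) ≠ 0 := by exact_mod_cast r.den_nz
  have hs0 : (s.den : ℚ) ≠ 0 := by exact_mod_cast s.den_nz
  have ht0 : (t.den : ℚ) ≠ 0 := by exact_mod_cast t.den_nz
  have hR : ((r.num * (s.den * t.den) : ℤ) : ℚ) = r * d := by
    have h' : (r.num : ℚ) = r * r.den := by rw [div_eq_iff hr0] at hr; exact hr
    rw [hd]; push_cast; rw [h']; ring
  have hS : ((s.num * (r.den * t.den) : ℤ) : ℚ) = s * d := by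
    have h' : (s.num : ℚ) = s * s.den := by rw [div_eq_iff hs0] at hs; exact hs
    rw [hd]; push_cast; rw [h']; ring
  have hT : ((t.num * (r.den * s.den) : ℤ) : ℚ) = t * d := by
    have h' : (t.num : ℚ) = t * t.den := by rw [div_eq_iff ht0] at ht; exact ht
    rw [hd]; push_cast; rw [h']; ring
  have := neg_θ_nonsq (r.num * (s.den * t.den)) (s.num * (r.den * t.den))
    (t.num * (r.den * s.den)) d
    (by
      have : (((r.num * (s.den * t.den) : ℤ) : ℚ)) ^ 2 - 2 * ((s.num * (r.den * t.den) : ℤ) : ℚ)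
        * ((t.num * (r.den * s.den) : ℤ) : ℚ) - ((t.num * (r.den * s.den) : ℤ) : ℚ) ^ 2 = 0 := by
          rw [hR, hS, hT]; linear_combination (d : ℚ) ^ 2 * e1
      exact_mod_cast this)
    (by
      have : 2 * (((r.num * (s.den * t.den) : ℤ) : ℚ)) * ((s.num * (r.den * t.den) : ℤ) : ℚ)
         - ((t.num * (r.den * s.den) : ℤ) : ℚ) ^ 2 = - (d : ℚ) ^ 2 := by
          rw [hR, hS, hT]; linear_combination (d : ℚ) ^ 2 * e2
      exact_mod_cast this)
    (by
      have : ((s.num * (r.den * t.den) : ℤ) : ℚ) ^ 2 + 2 * (((r.num * (s.den * t.den) : ℤ) : ℚ)) *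
        ((t.num * (r.den * s.den) : ℤ) : ℚ) + 2 * ((s.num * (r.den * t.den) : ℤ) : ℚ)
        * ((t.num * (r.den * s.den) : ℤ) : ℚ) + ((t.num * (r.den * s.den) : ℤ) : ℚ) ^ 2 = 0 := by
          rw [hR, hS, hT]; linear_combination (d : ℚ) ^ 2 * e3
      exact_mod_cast this)
  rw [hd] at this
  simp at this

theorem norm_θ : Algebra.norm ℚ θ = -1 := by
  have := norm_eq 0 1 0
  rw [Matrix.det_fin_three] at this
  simpa using this

theorem θ_not_sq (z : K) : z ^ 2 ≠ θ := by
  intro h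
  have := congrArg (Algebra.norm ℚ) h
  rw [map_pow, norm_θ] at this
  nlinarith [sq_nonneg (Algebra.norm ℚ z)]

/-- units modulo squares -/
theorem units_mod_sq (x : (𝓞 K)ˣ) : ∃ w : (𝓞 K)ˣ,
    x = w ^ 2 ∨ x = -w ^ 2 ∨ x = θu * w ^ 2 ∨ x = -θu * w ^ 2 := by
  have htor : ∀ ζ : (𝓞 K)ˣ, ζ ∈ Units.torsion K → ζ = 1 ∨ ζ = -1 := by
    intro ζ hζ
    have := Units.torsion_eq_one_or_neg_one_of_odd_finrank (K := K) (by rw [finrank_K]; decide) ⟨ζ, hζ⟩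
    rcases this with h | h
    · left; exact h
    · right; exact h
  let i0 : Fin (Units.rank K) := ⟨0, by rw [rank_K]; norm_num⟩
  obtain ⟨η, hη⟩ : ∃ η, η = Units.fundSystem K i0 := ⟨_, rfl⟩
  have gen : ∀ y : (𝓞 K)ˣ, ∃ n : ℤ, y = η ^ n ∨ y = -η ^ n := by
    intro y
    obtain ⟨⟨ζ, f⟩, h, -⟩ := Units.exist_unique_eq_mul_prod K y
    have hp : ∏ i, Units.fundSystem K i ^ f i = η ^ f i0 := by
      rw [hη]
      apply Fintype.prod_eq_single
      intro j hj
      exfalso; apply hj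
      ext
      have := j.2
      have h1 := rank_K
      simp only [i0]; omega
    refine ⟨f i0, ?_⟩
    simp only at h
    rw [hp] at h
    rcases htor ζ.1 ζ.2 with h1 | h1
    · left; rw [h, h1, one_mul]
    · right; rw [h, h1]; simp
  obtain ⟨k, hk⟩ := gen θu
  have hodd : ¬ Even k := by
    rintro ⟨j, rfl⟩
    have hcoe : ((θu : 𝓞 K) : K) = θ := rfl
    have : ((((η ^ j : (𝓞 K)ˣ) : 𝓞 K) : K)) ^ 2 = (((η ^ (j + j) : (𝓞 K)ˣ) : 𝓞 K) : K) := by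
      rw [zpow_add]; push_cast; ring
    rcases hk with h | h
    · apply θ_not_sq (((η ^ j : (𝓞 K)ˣ) : 𝓞 K) : K)
      rw [this, ← h]; rfl
    · apply neg_θ_not_sq (((η ^ j : (𝓞 K)ˣ) : 𝓞 K) : K)
      rw [this]
      have h' : η ^ (j + j) = -θu := by rw [h, neg_neg]
      rw [h']; push_cast; rfl
  have hηθ : ∃ w, η = θu * w ^ 2 ∨ η = -θu * w ^ 2 := by
    rw [Int.not_even_iff_odd] at hodd
    obtain ⟨j, rfl⟩ := hodd
    refine ⟨η ^ (-j), ?_⟩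
    have e : (η ^ (-j)) ^ 2 = η ^ (-(2 * j + 1)) * η := by
      rw [← zpow_natCast, ← zpow_mul, ← zpow_add_one]; congr 1; push_cast; ring
    rw [e]
    rcases hk with h | h
    · left; rw [h, ← mul_assoc, ← zpow_add]; simp
    · right; rw [h, neg_neg, ← mul_assoc, ← zpow_add]; simp
  obtain ⟨w0, hw0⟩ := hηθ
  obtain ⟨n, hn⟩ := gen x
  rcases Int.even_or_odd n with ⟨j, hj⟩ | ⟨j, hj⟩
  · refine ⟨η ^ j, ?_⟩
    have : η ^ n = (η ^ j) ^ 2 := by rw [hj, zpow_add, pow_two]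
    rw [this] at hn
    tauto
  · refine ⟨η ^ j * w0, ?_⟩
    have : η ^ n = η * (η ^ j) ^ 2 := by
      rw [hj, zpow_add, two_mul, zpow_add, zpow_one, pow_two, mul_comm]
    have hn' : x = η * (η ^ j) ^ 2 ∨ x = - (η * (η ^ j) ^ 2) := by rwa [this] at hn
    rw [mul_pow]
    rcases hw0 with h | h <;> rcases hn' with h1 | h1
    · right; right; left
      rw [h1]; nth_rw 1 [h]; rw [mul_assoc, mul_comm (w0 ^ 2)]
    · right; right; right
      rw [h1]; nth_rw 1 [h]; rw [mul_assoc, mul_comm (w0 ^ 2), neg_mul]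
    · right; right; right
      rw [h1]; nth_rw 1 [h]; rw [mul_assoc, mul_comm (w0 ^ 2)]
    · right; right; left
      rw [h1]; nth_rw 1 [h]; rw [mul_assoc, mul_comm (w0 ^ 2), neg_mul, neg_neg]

end nf2
end Q13


namespace Q13

open NumberField Module

noncomputable section nf3

/-- the ramified prime -/
def π0 : 𝓞 K := 3 * θo - 2

theorem norm_π0 : Algebra.norm ℚ ((π0 : 𝓞 K) : K) = -23 := by
  have h1 : ((π0 : 𝓞 K) : K) = ((-2 : ℚ) : K) + ((3 : ℚ) : K) * θ + ((0:ℚ) : K) * θ ^ 2 := by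
    have h1 : algebraMap (𝓞 K) K θo = θ := rfl
    have h2 : algebraMap (𝓞 K) K π0 = 3 * θ - 2 := by
      rw [π0, map_sub, map_mul, h1, map_ofNat, map_ofNat]
    refine h2.trans ?_
    push_cast; ring
  rw [h1, norm_eq, Matrix.det_fin_three]
  simp; norm_num

theorem prime_π0 : Prime π0 := by
  have h0 : π0 ≠ 0 := by
    intro h
    have := norm_π0
    rw [h] at this
    simp at this
  rw [← Ideal.span_singleton_prime h0]
  apply Ideal.isPrime_of_irreducible_absNorm
  rw [Ideal.absNorm_span_singleton]
  have : Algebra.norm ℤ π0 = -23 := by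
    have := Algebra.coe_norm_int π0
    rw [norm_π0] at this
    exact_mod_cast this
  rw [this]
  exact Nat.prime_iff.mp (by norm_num) |>.irreducible

theorem norm_lin (a b : ℤ) : Algebra.norm ℚ ((a : K) - b * θ) = a ^ 3 - a ^ 2 * b + b ^ 3 := by
  have h1 : (a : K) - b * θ = ((a : ℚ) : K) + ((-b : ℚ) : K) * θ + ((0:ℚ) : K) * θ ^ 2 := by
    push_cast; ring
  rw [h1, norm_eq, Matrix.det_fin_three]
  simp; ring

theorem descent (a b u : ℤ) (hcop : IsCoprime a b) (h : u ^ 2 = a ^ 3 - a ^ 2 * b + b ^ 3)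
    (hu : u ≠ 0) : ∃ z : K, z ≠ 0 ∧ ((a - b * θ : K) = z ^ 2 ∨ (a - b * θ : K) = - θ * z ^ 2) := by
  set α : 𝓞 K := a - b * θo with hα
  set γ : 𝓞 K := a ^ 2 + (θo - 1) * a * b + (θo ^ 2 - θo) * b ^ 2 with hγ
  have hαγ : α * γ = (u : 𝓞 K) ^ 2 := by
    have : ((u ^ 2 : ℤ) : 𝓞 K) = ((a ^ 3 - a ^ 2 * b + b ^ 3 : ℤ) : 𝓞 K) := by rw [h]
    push_cast at this
    rw [this, hα, hγ]
    linear_combination (-b ^ 3 : 𝓞 K) * θo_eq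
  have hcopO : IsCoprime (a : 𝓞 K) (b : 𝓞 K) := by
    have := hcop.map (Int.castRingHom (𝓞 K))
    simpa using this
  have hαb : IsCoprime α (b : 𝓞 K) := by
    rw [hα, sub_eq_add_neg, neg_mul_eq_mul_neg]
    exact hcopO.add_mul_left_left _
  have hu0 : (u : 𝓞 K) ≠ 0 := by exact_mod_cast hu
  have hα0 : α ≠ 0 := by rintro h0; rw [h0, zero_mul] at hαγ; exact (pow_ne_zero 2 hu0) hαγ.symm
  have hγ0 : γ ≠ 0 := by rintro h0; rw [h0, mul_zero] at hαγ; exact (pow_ne_zero 2 hu0) hαγ.symm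
  have hcommon : ∀ p : 𝓞 K, Prime p → p ∣ α → p ∣ γ → p ∣ π0 := by
    intro p hp h1 h2
    have h3 : p ∣ (b : 𝓞 K) ^ 2 * (θo * π0) := by
      have : (b : 𝓞 K) ^ 2 * (θo * π0) = γ - α * (a + (2 * θo - 1) * b) := by
        rw [hα, hγ, π0]; ring
      rw [this]; exact dvd_sub h2 (h1.mul_right _)
    rcases hp.dvd_or_dvd h3 with h4 | h4
    · exact absurd (hαb.isUnit_of_dvd' h1 (hp.dvd_of_dvd_pow h4)) hp.not_isUnit
    · rcases hp.dvd_or_dvd h4 with h5 | h5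
      · exact absurd (isUnit_of_dvd_unit h5 θu.isUnit) hp.not_isUnit
      · exact h5
  have hπ := prime_π0
  have fin : ∀ x : 𝓞 K, x ≠ 0 → FiniteMultiplicity π0 x := fun x hx =>
    FiniteMultiplicity.of_prime_left hπ hx
  obtain ⟨α', hα1, hα2⟩ := (fin α hα0).exists_eq_pow_mul_and_not_dvd
  obtain ⟨γ', hγ1, hγ2⟩ := (fin γ hγ0).exists_eq_pow_mul_and_not_dvd
  obtain ⟨u', hu1, hu2⟩ := (fin _ hu0).exists_eq_pow_mul_and_not_dvd
  generalize multiplicity π0 α = n at *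
  generalize multiplicity π0 γ = k at *
  generalize multiplicity π0 (u : 𝓞 K) = j at *
  have hprod : π0 ^ (n + k) * (α' * γ') = π0 ^ (2 * j) * u' ^ 2 := by
    have : π0 ^ n * α' * (π0 ^ k * γ') = (π0 ^ j * u') ^ 2 := by
      rw [← hα1, ← hγ1, ← hu1]; exact hαγ
    rw [pow_add, pow_mul']
    linear_combination this
  have hnd1 : ¬ π0 ∣ α' * γ' := fun h0 => (hπ.dvd_or_dvd h0).elim hα2 hγ2
  have hnd2 : ¬ π0 ∣ u' ^ 2 := fun h0 => hu2 (hπ.dvd_of_dvd_pow h0)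
  have hexp : n + k = 2 * j := by
    rcases lt_trichotomy (n + k) (2 * j) with hlt | heq | hlt
    · exfalso
      obtain ⟨d, hd⟩ := Nat.exists_eq_add_of_lt hlt
      rw [hd, add_assoc, pow_add _ (n + k), mul_assoc] at hprod
      have := mul_left_cancel₀ (pow_ne_zero _ hπ.ne_zero) hprod
      apply hnd1; rw [this, pow_succ]; exact ⟨π0 ^ d * u' ^ 2, by ring⟩
    · exact heq
    · exfalso
      obtain ⟨d, hd⟩ := Nat.exists_eq_add_of_lt hlt
      rw [hd, add_assoc, pow_add, mul_assoc] at hprod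
      have := mul_left_cancel₀ (pow_ne_zero _ hπ.ne_zero) hprod
      apply hnd2; rw [← this, pow_succ]; exact ⟨π0 ^ d * (α' * γ'), by ring⟩
  rw [hexp] at hprod
  have hprod' := mul_left_cancel₀ (pow_ne_zero _ hπ.ne_zero) hprod
  have hcop' : IsCoprime α' γ' := by
    apply isCoprime_of_prime_dvd
    · rintro ⟨h1, -⟩; exact hα2 (h1 ▸ dvd_zero _)
    · intro p hp h1 h2
      have h3 := hcommon p hp (by rw [hα1]; exact h1.mul_left _) (by rw [hγ1]; exact h2.mul_left _)
      have h4 : Associated p π0 := (hp.dvd_prime_iff_associated hπ).mp h3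
      exact hα2 (h4.dvd_iff_dvd_left.mp h1)
  obtain ⟨d, hd⟩ := exists_associated_pow_of_mul_eq_pow' hcop' hprod'
  obtain ⟨ε, hε⟩ := hd
  -- norm consideration
  have hcα : ((α : 𝓞 K) : K) = a - b * θ := by
    have h1 : algebraMap (𝓞 K) K θo = θ := rfl
    simp [hα, h1]
  have hNα : Algebra.norm ℚ ((α : 𝓞 K) : K) = (u : ℚ) ^ 2 := by
    rw [hcα, norm_lin]; exact_mod_cast h.symm
  have hN : Algebra.norm ℚ ((α : 𝓞 K) : K) = (-23) ^ n * ((Algebra.norm ℚ ((d : 𝓞 K) : K)) ^ 2 *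
      Algebra.norm ℚ ((ε : 𝓞 K) : K)) := by
    rw [hα1, ← hε]; simp only [map_mul, map_pow, norm_π0]
  have hNε : Algebra.norm ℚ ((ε : 𝓞 K) : K) = 1 ∨ Algebra.norm ℚ ((ε : 𝓞 K) : K) = -1 := by
    have := NumberField.Units.norm K ε
    have h2 : |Algebra.norm ℚ ((ε : 𝓞 K) : K)| = 1 := by
      simpa [RingOfIntegers.coe_norm] using this
    exact (abs_eq (by norm_num)).mp h2
  have hu0' : (u : ℚ) ≠ 0 := by exact_mod_cast hu
  have hneven : Even n := by
    by_contra hne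
    rw [Nat.not_even_iff_odd] at hne
    obtain ⟨m, rfl⟩ := hne
    have hsq : IsSquare (23 : ℚ) := by
      have hpos : (u : ℚ) ^ 2 = 23 * ((23 ^ m) * Algebra.norm ℚ ((d : 𝓞 K) : K)) ^ 2 ∨
        (u : ℚ) ^ 2 = - (23 * ((23 ^ m) * Algebra.norm ℚ ((d : 𝓞 K) : K)) ^ 2) := by
        rw [← hNα, hN, pow_succ, pow_mul]
        rcases hNε with h1 | h1 <;> rw [h1]
        · right; norm_num [mul_pow, ← pow_mul]; rw [mul_comm m 2, pow_mul]; norm_num; ring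
        · left; norm_num [mul_pow, ← pow_mul]; rw [mul_comm m 2, pow_mul]; norm_num; ring
      have hpos' : (u : ℚ) ^ 2 = 23 * ((23 ^ m) * Algebra.norm ℚ ((d : 𝓞 K) : K)) ^ 2 := by
        rcases hpos with h1 | h1
        · exact h1
        · exfalso
          have : 0 < (u : ℚ) ^ 2 := by positivity
          nlinarith [sq_nonneg ((23 ^ m) * Algebra.norm ℚ ((d : 𝓞 K) : K))]
      set y := (23 ^ m) * Algebra.norm ℚ ((d : 𝓞 K) : K)
      have hy : y ≠ 0 := by intro h0; rw [h0] at hpos'; simp at hpos'; first | exact hu hpos' | skip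
      refine ⟨u / y, ?_⟩
      field_simp
      rw [hpos']
    have h23 : ¬ IsSquare (23 : ℚ) := by
      have : ¬ IsSquare (23 : ℕ) := by
        rintro ⟨r, hr⟩
        have : r ≤ 4 := by nlinarith
        interval_cases r <;> omega
      have h2 := (Rat.isSquare_natCast_iff (n := 23)).not.mpr this
      exact_mod_cast h2
    exact h23 hsq
  obtain ⟨m, hm⟩ := hneven
  obtain ⟨w, hw⟩ := units_mod_sq ε
  have hαeq : ((α : 𝓞 K) : K) = (((ε : 𝓞 K) : K)) * ((π0 : K) ^ m * (d : K)) ^ 2 := by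
    rw [hα1, ← hε, hm]; push_cast; ring
  have hα0' : ((α : 𝓞 K) : K) ≠ 0 := by
    intro h0; apply hα0; apply RingOfIntegers.coe_injective; rw [map_zero]; exact h0
  have hNpos : Algebra.norm ℚ ((ε : 𝓞 K) : K) = 1 := by
    rcases hNε with h1 | h1
    · exact h1
    · exfalso
      have h2 := congrArg (Algebra.norm ℚ) hαeq
      rw [hNα, map_mul, h1, map_pow] at h2
      have : 0 < (u : ℚ) ^ 2 := by positivity
      nlinarith [sq_nonneg (Algebra.norm ℚ ((π0 : K) ^ m * (d : K)))]
  have hNm : Algebra.norm ℚ (-1 : K) = -1 := by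
    have := norm_eq (-1) 0 0
    rw [Matrix.det_fin_three] at this
    simp at this; convert this using 2
  have hwsq : 0 ≤ (Algebra.norm ℚ ((w : 𝓞 K) : K)) ^ 2 := sq_nonneg _
  have hθc : ((θu : 𝓞 K) : K) = θ := rfl
  rw [hcα] at hαeq hα0'
  have hz0 : ((π0 : K) ^ m * (d : K)) ≠ 0 := by
    intro h0; rw [h0] at hαeq; simp at hαeq; exact hα0' hαeq
  have hw0 : ((w : 𝓞 K) : K) ≠ 0 := Units.coe_ne_zero w
  refine ⟨((w : 𝓞 K) : K) * ((π0 : K) ^ m * (d : K)), mul_ne_zero hw0 hz0, ?_⟩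
  rcases hw with h1 | h1 | h1 | h1
  · left; rw [hαeq, h1]; push_cast; ring
  · exfalso
    have : ((ε : 𝓞 K) : K) = (-1) * ((w : 𝓞 K) : K) ^ 2 := by rw [h1]; push_cast; ring
    rw [this, map_mul, map_pow, hNm] at hNpos
    nlinarith
  · exfalso
    have : ((ε : 𝓞 K) : K) = θ * ((w : 𝓞 K) : K) ^ 2 := by rw [h1]; push_cast; rfl
    rw [this, map_mul, map_pow, norm_θ] at hNpos
    nlinarith
  · right; rw [hαeq, h1]; push_cast; change -θ * _ * _ = _; ring

end nf3
end Q13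


namespace Q13

theorem halve {P : (E ℚ).Point} {x y : ℚ} (h : IsPt P x y) {z : K} (hz : (x : K) - θ = z ^ 2) :
    ∃ Q : (E ℚ).Point, P = Q + Q := by
  obtain ⟨r, s, t, rfl⟩ := coords z
  rw [sq_coords] at hz
  have hz' : ((x : ℚ) : K) + ((-1 : ℚ) : K) * θ + ((0 : ℚ) : K) * θ ^ 2 =
      ((r ^ 2 - 2 * s * t - t ^ 2 : ℚ) : K) + ((2 * r * s - t ^ 2 : ℚ) : K) * θ +
      ((s ^ 2 + 2 * r * t + 2 * s * t + t ^ 2 : ℚ) : K) * θ ^ 2 := by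
    rw [← hz]; push_cast; ring
  obtain ⟨h1, h2, h3⟩ := coords_inj hz'
  have ht : t ≠ 0 := by
    rintro rfl
    have : s = 0 := by
      have : s ^ 2 = 0 := by linear_combination -h3
      exact pow_eq_zero_iff (two_ne_zero) |>.mp this
    rw [this] at h2; norm_num at h2
  have hr : r = - (s + t) ^ 2 / (2 * t) := by field_simp; linear_combination -h3
  have heq : (-1 / t) ^ 2 = (1 + s / t) ^ 3 - (1 + s / t) ^ 2 + 1 := by
    field_simp
    linear_combination s * h3 - t * h2
  have hy : (2 : ℚ) * (-1 / t) ≠ 0 := by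
    apply mul_ne_zero two_ne_zero; exact div_ne_zero (by norm_num) ht
  obtain ⟨Q, hQ⟩ := IsPt.mk heq (Or.inr hy)
  obtain ⟨w, hw⟩ := hQ.dbl_x hy
  have hx : ((1 + s / t) ^ 4 - 8 * (1 + s / t) + 4) / (4 * (-1 / t) ^ 2) = x := by
    rw [h1, hr]; field_simp; ring
  rw [hx] at hw
  rcases hw.x_eq h with h0 | h0
  · exact ⟨Q, h0⟩
  · exact ⟨-Q, by rw [h0]; abel⟩

/-- integral form of a point -/
theorem intForm {x y : ℚ} (h : y ^ 2 = x ^ 3 - x ^ 2 + 1) :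
    ∃ a e u : ℤ, 0 < e ∧ IsCoprime a e ∧ x = a / e ^ 2 ∧ y = u / e ^ 3 ∧
      u ^ 2 = a ^ 3 - a ^ 2 * e ^ 2 + e ^ 6 ∧ u ≠ 0 := by
  have hb0 : (x.den : ℚ) ≠ 0 := by exact_mod_cast x.den_nz
  have hcop : IsCoprime x.num (x.den : ℤ) := by
    rw [Int.isCoprime_iff_gcd_eq_one]; exact x.reduced
  have hxn : x = x.num / x.den := (Rat.num_div_den x).symm
  set a := x.num with ha
  obtain ⟨b, hb⟩ : ∃ b : ℤ, (x.den : ℤ) = b := ⟨_, rfl⟩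
  have hbpos : 0 < b := by rw [← hb]; exact_mod_cast x.den_pos
  have hbq : (x.den : ℚ) = b := by rw [← hb]; simp
  rw [hbq] at hxn hb0
  rw [hb] at hcop
  -- (y b^2)^2 = b * g
  have hv : (y * b ^ 2) ^ 2 = ((b * (a ^ 3 - a ^ 2 * b + b ^ 3) : ℤ) : ℚ) := by
    rw [mul_pow, h, hxn]; push_cast; field_simp
  have hintg : ∃ v : ℤ, y * b ^ 2 = v := by
    have hs : IsSquare (((b * (a ^ 3 - a ^ 2 * b + b ^ 3) : ℤ)) : ℚ) := ⟨y * b ^ 2, by rw [← hv]; ring⟩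
    rw [Rat.isSquare_intCast_iff] at hs
    obtain ⟨w, hw⟩ := hs
    rw [hw] at hv
    have : (y * b ^ 2 - w) * (y * b ^ 2 + w) = 0 := by push_cast at hv; linear_combination hv
    rcases mul_eq_zero.mp this with h0 | h0
    · exact ⟨w, by linear_combination h0⟩
    · exact ⟨-w, by push_cast; linear_combination h0⟩
  obtain ⟨v, hv'⟩ := hintg
  have hvz : b * (a ^ 3 - a ^ 2 * b + b ^ 3) = v ^ 2 := by
    rw [hv'] at hv; exact_mod_cast hv.symm
  have hc1 : IsCoprime b (a ^ 3 - a ^ 2 * b + b ^ 3) := by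
    have h1 : IsCoprime b (a ^ 3) := (hcop.pow_left).symm
    have : a ^ 3 - a ^ 2 * b + b ^ 3 = a ^ 3 + b * (- a ^ 2 + b ^ 2) := by ring
    rw [this]; exact IsCoprime.add_mul_left_right h1 _
  obtain ⟨e', he'⟩ := coprime_sq hc1 hvz hbpos
  obtain ⟨e, he, hepos⟩ : ∃ e : ℤ, b = e ^ 2 ∧ 0 < e := by
    refine ⟨|e'|, by rw [sq_abs]; exact he', ?_⟩
    rw [abs_pos]; rintro rfl; simp at he'; omega
  have he0 : (e : ℚ) ≠ 0 := by exact_mod_cast hepos.ne'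
  have hdv : e ∣ v := by
    have : e ^ 2 ∣ v ^ 2 := ⟨_, by rw [← hvz, he]⟩
    exact (Int.pow_dvd_pow_iff two_ne_zero).mp this
  obtain ⟨u, rfl⟩ := hdv
  have hue : u ^ 2 = a ^ 3 - a ^ 2 * e ^ 2 + e ^ 6 := by
    have h1 : e ^ 2 * (u ^ 2) = e ^ 2 * (a ^ 3 - a ^ 2 * e ^ 2 + e ^ 6) := by
      rw [he] at hvz; linear_combination -hvz
    exact mul_left_cancel₀ (pow_ne_zero 2 hepos.ne') h1
  have hyu : y = u / e ^ 3 := by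
    rw [he] at hv'; push_cast at hv'; field_simp
    have : e * (y * e ^ 3 - u) = 0 := by linear_combination hv'
    rcases mul_eq_zero.mp this with h0 | h0
    · exact absurd h0 he0
    · linear_combination h0
  refine ⟨a, e, u, hepos, ?_, by rw [hxn, he]; push_cast; ring, hyu, hue, ?_⟩
  · rw [he] at hcop; exact hcop.of_isCoprime_of_dvd_right (dvd_pow_self e two_ne_zero)
  · rintro rfl
    simp at hyu
    rw [hyu] at h
    exact cubic_no_root x (by linear_combination -h)

theorem halving {P : (E ℚ).Point} {x y : ℚ} (h : IsPt P x y) (hx : x ≠ 0) :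
    ∃ Q : (E ℚ).Point, P = Q + Q ∨ P + G = Q + Q := by
  obtain ⟨a, e, u, he, hc, hxa, hyu, hu, hu0⟩ := intForm h.eq
  obtain ⟨z, hz0, hz⟩ := descent a (e ^ 2) u hc.pow_right (by rw [hu]; ring) hu0
  have he0 : (e : ℚ) ≠ 0 := by exact_mod_cast he.ne'
  have he0' : (e : K) ≠ 0 := by exact_mod_cast he.ne'
  have hxK : (x : K) - θ = (a - (e ^ 2 : ℤ) * θ) / e ^ 2 := by
    rw [hxa]; push_cast; field_simp
  rcases hz with hz | hz
  · obtain ⟨Q, hQ⟩ := halve h (z := z / e) (by rw [hxK, hz]; field_simp)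
    exact ⟨Q, Or.inl hQ⟩
  · have hz2 : (x : K) - θ = - θ * (z / e) ^ 2 := by rw [hxK, hz]; field_simp
    have hs : (y - 1) / x * (x - 0) = y - 1 := by field_simp; ring
    have hadd := h.add isPt_G hx hs rfl rfl
    set s := (y - 1) / x with hsdef
    set x3 := s ^ 2 + 1 - x - 0 with hx3
    have hy2 : y = s * x + 1 := by linear_combination -hs
    have hxy := h.eq
    have key : -θ * ((x : K) - θ) * ((x3 : K) - θ) = (s * θ + 1) ^ 2 := by
      have e1 : (s * x + 1) ^ 2 = x ^ 3 - x ^ 2 + 1 := by rw [← hy2, hxy]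
      have e2 : s ^ 2 * x + 2 * s = x ^ 2 - x := by
        apply mul_left_cancel₀ hx; linear_combination e1
      have e3 : ((s ^ 2 * x + 2 * s : ℚ) : K) = ((x ^ 2 - x : ℚ) : K) := by rw [e2]
      push_cast at e3
      rw [hx3]; push_cast
      linear_combination (-θ) * e3 - θ_eq
    have hθ : θ ≠ 0 := by intro h0; have := θ_eq; rw [h0] at this; norm_num at this
    obtain ⟨Q, hQ⟩ := halve hadd (z := (s * θ + 1) / (θ * (z / e))) (by
      rw [div_pow, ← key, hz2]
      field_simp)
    exact ⟨Q, Or.inr hQ⟩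

end Q13


namespace Q13

theorem dbl_cop {A e U : ℤ} (hc : IsCoprime A e)
    (hU : U ^ 2 = A ^ 3 - A ^ 2 * e ^ 2 + e ^ 6) :
    IsCoprime (A ^ 4 - 8 * A * e ^ 6 + 4 * e ^ 8) (e ^ 2 * U ^ 2) := by
  apply isCoprime_of_prime_dvd
  · rintro ⟨h1, h2⟩
    rcases mul_eq_zero.mp h2 with h3 | h3
    · have h3 := pow_eq_zero_iff (two_ne_zero) |>.mp h3
      subst h3
      have h4 : A = 0 := by
        have : A ^ 4 = 0 := by linear_combination h1
        exact pow_eq_zero_iff (by norm_num) |>.mp this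
      subst h4
      obtain ⟨p, q, hpq⟩ := hc; simp at hpq
    · have h3 := pow_eq_zero_iff (two_ne_zero) |>.mp h3
      subst h3
      by_cases he : e = 0
      · subst he
        have h4 : A = 0 := by
          have : A ^ 4 = 0 := by linear_combination h1
          exact pow_eq_zero_iff (by norm_num) |>.mp this
        subst h4
        obtain ⟨p, q, hpq⟩ := hc; simp at hpq
      have he' : (e : ℚ) ≠ 0 := by exact_mod_cast he
      apply cubic_no_root (A / e ^ 2)
      have : (A : ℚ) ^ 3 - A ^ 2 * e ^ 2 + e ^ 6 = 0 := by exact_mod_cast hU.symm.trans (by ring)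
      field_simp
      linear_combination this
  · intro p hp h1 h2
    have hpe : ¬ p ∣ e := by
      intro h3
      have h4 : p ∣ A := by
        apply hp.dvd_of_dvd_pow (n := 4)
        have : A ^ 4 = (A ^ 4 - 8 * A * e ^ 6 + 4 * e ^ 8) - e * (4 * e ^ 7 - 8 * A * e ^ 5) := by ring
        rw [this]; exact dvd_sub h1 (h3.mul_right _)
      exact hp.not_isUnit (hc.isUnit_of_dvd' h4 h3)
    have hpA : ¬ p ∣ A → ¬ p ∣ e := fun _ => hpe
    have hpU : p ∣ U := by
      rcases hp.dvd_or_dvd h2 with h3 | h3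
      · exact absurd (hp.dvd_of_dvd_pow h3) hpe
      · exact hp.dvd_of_dvd_pow h3
    have hpU2 : p ^ 2 ∣ A ^ 3 - A ^ 2 * e ^ 2 + e ^ 6 := by rw [← hU]; exact pow_dvd_pow_of_dvd hpU 2
    have hpg : p ∣ A ^ 3 - A ^ 2 * e ^ 2 + e ^ 6 := dvd_trans (dvd_pow_self p two_ne_zero) hpU2
    have h5 : p ∣ A ^ 2 - 9 * A * e ^ 2 + 3 * e ^ 4 := by
      have h6 : p ∣ e ^ 4 * (A ^ 2 - 9 * A * e ^ 2 + 3 * e ^ 4) := by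
        have : e ^ 4 * (A ^ 2 - 9 * A * e ^ 2 + 3 * e ^ 4) = (A ^ 4 - 8 * A * e ^ 6 + 4 * e ^ 8)
          - (A ^ 3 - A ^ 2 * e ^ 2 + e ^ 6) * (A + e ^ 2) := by ring
        rw [this]; exact dvd_sub h1 (hpg.mul_right _)
      rcases hp.dvd_or_dvd h6 with h7 | h7
      · exact absurd (hp.dvd_of_dvd_pow h7) hpe
      · exact h7
    have h6 : p ∣ 23 * (e ^ 4 * (3 * A - e ^ 2)) := by
      have : 23 * (e ^ 4 * (3 * A - e ^ 2)) = (A ^ 3 - A ^ 2 * e ^ 2 + e ^ 6) -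
        (A ^ 2 - 9 * A * e ^ 2 + 3 * e ^ 4) * (A + 8 * e ^ 2) := by ring
      rw [this]; exact dvd_sub hpg (h5.mul_right _)
    rcases hp.dvd_or_dvd h6 with h7 | h7
    · -- p associated to 23
      have h23 : Prime (23 : ℤ) := by norm_num
      have has : Associated p 23 := (hp.dvd_prime_iff_associated h23).mp h7
      have g1 : (23 : ℤ) ∣ A ^ 2 - 9 * A * e ^ 2 + 3 * e ^ 4 := has.dvd_iff_dvd_left.mp h5
      have g2 : (23 : ℤ) ^ 2 ∣ A ^ 3 - A ^ 2 * e ^ 2 + e ^ 6 := (has.pow_pow).dvd_iff_dvd_left.mp hpU2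
      have g3 : (23 : ℤ) ∣ A - 16 * e ^ 2 := by
        apply h23.dvd_of_dvd_pow (n := 2)
        have : (A - 16 * e ^ 2) ^ 2 = (A ^ 2 - 9 * A * e ^ 2 + 3 * e ^ 4) + 23 * (- A * e ^ 2 + 11 * e ^ 4) := by ring
        rw [this]; exact dvd_add g1 (dvd_mul_right _ _)
      obtain ⟨k, hk⟩ := g3
      obtain ⟨l, hl⟩ := g2
      have hA : A = 16 * e ^ 2 + 23 * k := by linear_combination hk
      have g4 : (23 : ℤ) ∣ 167 * e ^ 6 := by
        refine ⟨l - (32 * e ^ 4 * k + 47 * e ^ 2 * k ^ 2 + 23 * k ^ 3), ?_⟩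
        rw [hA] at hl
        linarith
      rcases h23.dvd_or_dvd g4 with g5 | g5
      · norm_num at g5
      · exact hpe (has.dvd_iff_dvd_left.mpr (h23.dvd_of_dvd_pow g5))
    · rcases hp.dvd_or_dvd h7 with h8 | h8
      · exact hpe (hp.dvd_of_dvd_pow h8)
      · have h9 : p ∣ A := by
          apply hp.dvd_of_dvd_pow (n := 2)
          have : A ^ 2 = (A ^ 2 - 9 * A * e ^ 2 + 3 * e ^ 4) + (3 * A - e ^ 2) * (3 * e ^ 2) := by ring
          rw [this]; exact dvd_add h5 (h8.mul_right _)
        apply hpe; apply hp.dvd_of_dvd_pow (n := 2)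
        have : e ^ 2 = A * 3 - (3 * A - e ^ 2) := by ring
        rw [this]; exact dvd_sub (h9.mul_right _) h8

/-- the numerator and denominator of the double have gcd dividing 4 -/
theorem dbl_gcd {A e U n d : ℤ} (hc : IsCoprime A e)
    (hU : U ^ 2 = A ^ 3 - A ^ 2 * e ^ 2 + e ^ 6)
    (h : (A ^ 4 - 8 * A * e ^ 6 + 4 * e ^ 8) * d = n * (4 * e ^ 2 * U ^ 2)) :
    (A ^ 4 - 8 * A * e ^ 6 + 4 * e ^ 8) ∣ 4 * n ∧ 4 * e ^ 2 * U ^ 2 ∣ 4 * d := by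
  have hcop := dbl_cop hc hU
  constructor
  · have h1 : (A ^ 4 - 8 * A * e ^ 6 + 4 * e ^ 8) ∣ (4 * n) * (e ^ 2 * U ^ 2) := ⟨d, by linear_combination -h⟩
    exact hcop.dvd_of_dvd_mul_right h1
  · have h1 : e ^ 2 * U ^ 2 ∣ (A ^ 4 - 8 * A * e ^ 6 + 4 * e ^ 8) * d := ⟨4 * n, by linear_combination h⟩
    have h2 := hcop.symm.dvd_of_dvd_mul_left h1
    rw [mul_assoc]; exact mul_dvd_mul_left 4 h2

theorem height_lower {A B : ℤ} (hB : 0 < B) (hg : 0 < A ^ 3 - A ^ 2 * B + B ^ 3) :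
    (max |A| B) ^ 4 ≤ 4 * max |A ^ 4 - 8 * A * B ^ 3 + 4 * B ^ 4| (4 * B * (A ^ 3 - A ^ 2 * B + B ^ 3)) := by
  have hAB : -B < A := by
    by_contra h0
    push Not at h0
    have : A ^ 2 * (A - B) ≤ B ^ 2 * (-2 * B) := by
      have h1 : B ^ 2 ≤ A ^ 2 := by nlinarith
      have h2 : A - B ≤ -2 * B := by linarith
      nlinarith [mul_nonneg (sub_nonneg.mpr h1) hB.le]
    nlinarith [pow_pos hB 3]
  rcases lt_or_ge A 0 with h | h
  · have : max |A| B = B := by rw [max_eq_right]; rw [abs_of_neg h]; linarith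
    rw [this]
    have h1 : B ^ 4 ≤ A ^ 4 - 8 * A * B ^ 3 + 4 * B ^ 4 := by
      have := pow_pos hB 3
      have := pow_pos hB 4
      nlinarith [mul_pos this (neg_pos.mpr h), mul_pos (pow_pos hB 3) (neg_pos.mpr h), sq_nonneg (A ^ 2)]
    have h2 := le_trans h1 (le_abs_self _)
    have h3 := le_trans h2 (le_max_left _ (4 * B * (A ^ 3 - A ^ 2 * B + B ^ 3)))
    nlinarith [pow_pos hB 4]
  · rcases lt_or_ge A B with h4 | h4
    · have : max |A| B = B := by rw [max_eq_right]; rw [abs_of_nonneg h]; linarith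
      rw [this]
      have h1 : B ^ 3 ≤ 4 * (A ^ 3 - A ^ 2 * B + B ^ 3) := by
        nlinarith [mul_nonneg h (sq_nonneg (3 * A - 2 * B)), pow_pos hB 3, mul_nonneg h (sq_nonneg B), mul_nonneg (sub_nonneg.mpr h4.le) (sq_nonneg (3 * A - B)), mul_nonneg (sub_nonneg.mpr h4.le) (sq_nonneg (3 * A - 2 * B)), mul_nonneg (sub_nonneg.mpr h4.le) (sq_nonneg B)]
      have h2 : B ^ 4 ≤ 4 * B * (A ^ 3 - A ^ 2 * B + B ^ 3) := by nlinarith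
      have h3 := le_trans h2 (le_max_right |A ^ 4 - 8 * A * B ^ 3 + 4 * B ^ 4| _)
      nlinarith [pow_pos hB 4]
    · have : max |A| B = A := by rw [abs_of_nonneg h]; exact max_eq_left h4
      rw [this]
      obtain ⟨c, hc⟩ : ∃ c, A = B + c := ⟨A - B, by ring⟩
      have hc0 : 0 ≤ c := by linarith
      rcases lt_or_ge A (2 * B) with h5 | h5
      · have h1 : A ^ 4 ≤ 16 * B * (A ^ 3 - A ^ 2 * B + B ^ 3) := by
          obtain ⟨d, hd⟩ : ∃ d, B = c + d := ⟨B - c, by ring⟩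
          have hd0 : 0 ≤ d := by linarith
          have : 16 * B * (A ^ 3 - A ^ 2 * B + B ^ 3) - A ^ 4 = 64 * c ^ 4 + 160 * c ^ 3 * d + 152 * c ^ 2 * d ^ 2 + 72 * c * d ^ 3 + 15 * d ^ 4 := by
            rw [hc, hd]; ring
          have h6 : 0 ≤ 64 * c ^ 4 + 160 * c ^ 3 * d + 152 * c ^ 2 * d ^ 2 + 72 * c * d ^ 3 + 15 * d ^ 4 := by positivity
          linarith
        have h3 := (le_max_right |A ^ 4 - 8 * A * B ^ 3 + 4 * B ^ 4| (4 * B * (A ^ 3 - A ^ 2 * B + B ^ 3)))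
        linarith
      · have h1 : A ^ 4 ≤ 4 * (A ^ 4 - 8 * A * B ^ 3 + 4 * B ^ 4) := by
          obtain ⟨d, hd⟩ : ∃ d, A = 2 * B + d := ⟨A - 2 * B, by ring⟩
          have hd0 : 0 ≤ d := by linarith
          have : 4 * (A ^ 4 - 8 * A * B ^ 3 + 4 * B ^ 4) - A ^ 4 = 3 * d ^ 4 + 24 * d ^ 3 * B + 72 * d ^ 2 * B ^ 2 + 64 * d * B ^ 3 := by
            rw [hd]; ring
          have h6 : 0 ≤ 3 * d ^ 4 + 24 * d ^ 3 * B + 72 * d ^ 2 * B ^ 2 + 64 * d * B ^ 3 := by positivity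
          linarith
        have h3 := le_trans (le_abs_self _) (le_max_left |A ^ 4 - 8 * A * B ^ 3 + 4 * B ^ 4| (4 * B * (A ^ 3 - A ^ 2 * B + B ^ 3)))
        linarith

theorem height_dbl {A e U n d : ℤ} (he : 0 < e) (hc : IsCoprime A e)
    (hU : U ^ 2 = A ^ 3 - A ^ 2 * e ^ 2 + e ^ 6) (hU0 : U ≠ 0) (hd : d ≠ 0)
    (h : (A ^ 4 - 8 * A * e ^ 6 + 4 * e ^ 8) * d = n * (4 * e ^ 2 * U ^ 2)) (T : ℤ)
    (hn : |n| ≤ T) (hdT : |d| ≤ T) : (max |A| (e ^ 2)) ^ 4 ≤ 16 * T := by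
  obtain ⟨h1, h2⟩ := dbl_gcd hc hU h
  have hU2 : 0 < U ^ 2 := by positivity
  have he2 : 0 < e ^ 2 := by positivity
  have h3 := height_lower (A := A) (B := e ^ 2) he2 (by
    have : A ^ 3 - A ^ 2 * e ^ 2 + (e ^ 2) ^ 3 = U ^ 2 := by rw [hU]; ring
    rw [this]; exact hU2)
  have e1 : A ^ 4 - 8 * A * (e ^ 2) ^ 3 + 4 * (e ^ 2) ^ 4 = A ^ 4 - 8 * A * e ^ 6 + 4 * e ^ 8 := by ring
  have e2 : 4 * e ^ 2 * (A ^ 3 - A ^ 2 * e ^ 2 + (e ^ 2) ^ 3) = 4 * e ^ 2 * U ^ 2 := by rw [hU]; ring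
  rw [e1, e2] at h3
  have h4 : |A ^ 4 - 8 * A * e ^ 6 + 4 * e ^ 8| ≤ 4 * T := by
    by_cases hn0 : n = 0
    · rw [hn0, zero_mul] at h
      rcases mul_eq_zero.mp h with h5 | h5
      · rw [h5]; simp; linarith [abs_nonneg n]
      · exact absurd h5 hd
    · have h5 := Int.le_of_dvd (by positivity) ((abs_dvd_abs _ _).mpr h1)
      rw [abs_mul] at h5
      have h40 : |(4 : ℤ)| = 4 := by norm_num
      rw [h40] at h5; linarith
  have h5 : 4 * e ^ 2 * U ^ 2 ≤ 4 * T := by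
    have h5 := Int.le_of_dvd (by positivity) ((dvd_abs _ _).mpr h2)
    rw [abs_mul] at h5
    have h40 : |(4 : ℤ)| = 4 := by norm_num
    rw [h40] at h5; linarith
  have h6 := max_le h4 h5
  linarith

theorem small_pts (a e u : ℤ) (he : 0 < e) (hc : IsCoprime a e) (ha : |a| ≤ 10) (he2 : e ^ 2 ≤ 10)
    (hU : u ^ 2 = a ^ 3 - a ^ 2 * e ^ 2 + e ^ 6) :
    (a = 0 ∧ e = 1) ∨ (a = 1 ∧ e = 1) ∨ (a = 4 ∧ e = 1) ∨ (a = -3 ∧ e = 2) := by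
  have he3 : e ≤ 3 := by nlinarith
  have ha' := abs_le.mp ha
  obtain ⟨h1, h2⟩ := ha'
  have hs : ∀ n : ℤ, u ^ 2 = n → n = (n.natAbs.sqrt : ℤ) ^ 2 := by
    rintro n rfl
    rw [Int.natAbs_pow, Nat.sqrt_eq']
    simp
  have h3 := hs _ hU
  rw [Int.isCoprime_iff_gcd_eq_one] at hc
  clear hU hs ha he2
  interval_cases e <;> interval_cases a <;> revert h3 hc <;> decide +kernel

end Q13


namespace Q13

theorem isPt_2G : IsPt ((2 : ℤ) • (G : (E ℚ).Point)) 1 (-1) := by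
  rw [two_zsmul]
  exact (isPt_G (F := ℚ)).dbl (by norm_num) (s := 0) (by norm_num) (by norm_num) (by norm_num)

theorem isPt_3G : IsPt ((3 : ℤ) • (G : (E ℚ).Point)) 4 7 := by
  have : (3 : ℤ) • (G : (E ℚ).Point) = (2 : ℤ) • G + G := by
    rw [show (3 : ℤ) = 2 + 1 by norm_num, add_zsmul, one_zsmul]
  rw [this]
  exact isPt_2G.add isPt_G (by norm_num) (s := -2) (by norm_num) (by norm_num) (by norm_num)

theorem isPt_4G : IsPt ((4 : ℤ) • (G : (E ℚ).Point)) (-3/4) (1/8) := by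
  have : (4 : ℤ) • (G : (E ℚ).Point) = (2 : ℤ) • G + (2 : ℤ) • G := by
    rw [show (4 : ℤ) = 2 + 2 by norm_num, add_zsmul]
  rw [this]
  exact isPt_2G.dbl (by norm_num) (s := -1/2) (by norm_num) (by norm_num) (by norm_num)

theorem mult_of_x {P : (E ℚ).Point} {m : ℤ} {x y z : ℚ} (h : IsPt (m • (G : (E ℚ).Point)) x y)
    (h' : IsPt P x z) : ∃ m : ℤ, P = m • G := by
  rcases h.x_eq h' with h0 | h0
  · exact ⟨m, h0⟩
  · exact ⟨-m, by rw [h0, neg_zsmul]⟩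

theorem gen_aux (n : ℕ) : ∀ (P : (E ℚ).Point) (a e u : ℤ), 0 < e → IsCoprime a e →
    u ^ 2 = a ^ 3 - a ^ 2 * e ^ 2 + e ^ 6 → IsPt P (a / e ^ 2) (u / e ^ 3) →
    max |a| (e ^ 2) ≤ n → ∃ m : ℤ, P = m • G := by
  induction n using Nat.strong_induction_on with
  | _ n ih =>
  intro P a e u he hc hu hP hn
  set H := max |a| (e ^ 2) with hH
  have ha : |a| ≤ H := le_max_left _ _
  have hb : e ^ 2 ≤ H := le_max_right _ _
  by_cases hsmall : H ≤ 10
  · rcases small_pts a e u he hc (ha.trans hsmall) (hb.trans hsmall) hu with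
      ⟨rfl, rfl⟩ | ⟨rfl, rfl⟩ | ⟨rfl, rfl⟩ | ⟨rfl, rfl⟩
    · exact mult_of_x (m := 1) (by rw [one_zsmul]; exact isPt_G) (by simpa using hP)
    · exact mult_of_x isPt_2G (by simpa using hP)
    · exact mult_of_x isPt_3G (by simpa using hP)
    · refine mult_of_x isPt_4G (z := u / 2 ^ 3) ?_
      convert hP using 2 <;> norm_num
  have hH0 : 10 < H := by omega
  have he0 : (e : ℚ) ≠ 0 := by exact_mod_cast he.ne'
  -- key step
  have step : ∀ (Q : (E ℚ).Point) (nn d : ℤ) (z : ℚ), d ≠ 0 → IsPt (Q + Q) (nn / d) z →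
      |nn| ≤ 6 * H ^ 2 → |d| ≤ 6 * H ^ 2 → ∃ m : ℤ, Q = m • G := by
    intro Q nn d z hd hQQ hnn hdd
    by_cases hQ0 : Q = 0
    · exact ⟨0, by rw [hQ0, zero_zsmul]⟩
    obtain ⟨xq, yq, hQ⟩ := isPt_of_ne_zero hQ0
    obtain ⟨A, e', U, he', hc', hxq, hyq, hU, hU0⟩ := intForm hQ.eq
    have he0' : (e' : ℚ) ≠ 0 := by exact_mod_cast he'.ne'
    have hU0' : (U : ℚ) ≠ 0 := by exact_mod_cast hU0
    have hd' : (d : ℚ) ≠ 0 := by exact_mod_cast hd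
    obtain ⟨w, hw⟩ := hQ.dbl_x (by rw [hyq]; positivity)
    obtain ⟨hx, -⟩ := hw.inj hQQ
    have heq : (A ^ 4 - 8 * A * e' ^ 6 + 4 * e' ^ 8) * d = nn * (4 * e' ^ 2 * U ^ 2) := by
      rw [hxq, hyq] at hx
      field_simp at hx
      have : ((A : ℚ) ^ 4 - 8 * A * e' ^ 6 + 4 * e' ^ 8) * d = nn * (4 * e' ^ 2 * U ^ 2) := by
        linear_combination hx
      exact_mod_cast this
    have hh := height_dbl he' hc' hU hU0 hd heq (6 * H ^ 2) hnn hdd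
    set H' := max |A| (e' ^ 2) with hH'
    have hlt : H' < H := by
      by_contra h0
      push Not at h0
      have h1 : H ^ 4 ≤ H' ^ 4 := by gcongr
      have h2 : 100 < H ^ 2 := by nlinarith
      nlinarith
    have hH'0 : 0 ≤ H' := le_trans (abs_nonneg A) (le_max_left _ _)
    refine ih H'.toNat (by omega) Q A e' U he' hc' hU ?_ (by omega)
    rw [← hxq, ← hyq]; exact hQ
  have ha0 : a ≠ 0 := by
    rintro rfl
    have h1 : IsUnit e := by rw [isCoprime_zero_left] at hc; exact hc
    have h2 : e = 1 := by
      rcases Int.isUnit_iff.mp h1 with h | h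
      · exact h
      · omega
    rw [h2] at hH; norm_num at hH; omega
  have ha0' : (a : ℚ) ≠ 0 := by exact_mod_cast ha0
  have hx0 : (a / e ^ 2 : ℚ) ≠ 0 := by positivity
  obtain ⟨Q, hQ | hQ⟩ := halving hP hx0
  · obtain ⟨m, hm⟩ := step Q a (e ^ 2) (u / e ^ 3) (by positivity) (by rw [← hQ]; push_cast; exact hP)
      (by nlinarith) (by rw [abs_of_pos (by positivity)]; nlinarith)
    exact ⟨2 * m, by rw [hQ, hm, two_mul, add_zsmul]⟩
  · have hu' : (u : ℚ) ^ 2 = a ^ 3 - a ^ 2 * e ^ 2 + e ^ 6 := by exact_mod_cast hu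
    have hadd := hP.add isPt_G hx0 (s := (u - e ^ 3) / (e * a)) (by field_simp; ring) rfl rfl
    have hx3 : ((u - e ^ 3) / (e * a) : ℚ) ^ 2 + 1 - a / e ^ 2 - 0 = ((2 * e * (e ^ 3 - u) : ℤ) : ℚ) / ((a ^ 2 : ℤ) : ℚ) := by
      push_cast
      field_simp
      linear_combination hu'
    rw [hx3, hQ] at hadd
    obtain ⟨m, hm⟩ := step Q _ _ _ (by positivity) hadd (by
        apply abs_le_of_sq_le_sq _ (by positivity)
        have hH00 : 0 < H := by omega
        have h1 : u ^ 2 ≤ 3 * H ^ 3 := by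
          rw [hu]
          have g1 : a ^ 3 ≤ H ^ 3 := by
            calc a ^ 3 ≤ |a| ^ 3 := by rw [← abs_pow]; exact le_abs_self _
              _ ≤ H ^ 3 := by gcongr
          have g2 : e ^ 6 ≤ H ^ 3 := by
            calc e ^ 6 = (e ^ 2) ^ 3 := by ring
              _ ≤ H ^ 3 := by gcongr
          have g3 : 0 ≤ a ^ 2 * e ^ 2 := by positivity
          have : 0 < H ^ 3 := by positivity
          linarith
        have h2 : (e ^ 3 - u) ^ 2 ≤ 2 * (H ^ 3 + 3 * H ^ 3) := by
          have g2 : e ^ 6 ≤ H ^ 3 := by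
            calc e ^ 6 = (e ^ 2) ^ 3 := by ring
              _ ≤ H ^ 3 := by gcongr
          nlinarith [sq_nonneg (e ^ 3 + u)]
        calc (2 * e * (e ^ 3 - u)) ^ 2 = 4 * (e ^ 2 * (e ^ 3 - u) ^ 2) := by ring
          _ ≤ 4 * (H * (2 * (H ^ 3 + 3 * H ^ 3))) := by gcongr
          _ ≤ (6 * H ^ 2) ^ 2 := by nlinarith [pow_pos hH00 4])
      (by rw [abs_pow]; have := pow_le_pow_left₀ (abs_nonneg a) ha 2; nlinarith)
    exact ⟨2 * m - 1, by rw [sub_zsmul, one_zsmul, two_mul, add_zsmul, ← hm, ← hQ]; abel⟩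

/-- Mordell–Weil: every rational point is a multiple of `G` -/
theorem gen {x y : ℚ} (h : y ^ 2 = x ^ 3 - x ^ 2 + 1) :
    ∃ m : ℤ, IsPt (m • (G : (E ℚ).Point)) x y := by
  obtain ⟨a, e, u, he, hc, hxa, hyu, hu, hu0⟩ := intForm h
  have hy : 2 * y ≠ 0 := by
    have he0 : (e : ℚ) ≠ 0 := by exact_mod_cast he.ne'
    have hu0' : (u : ℚ) ≠ 0 := by exact_mod_cast hu0
    rw [hyu]; positivity
  obtain ⟨P, hP⟩ := IsPt.mk h (Or.inr hy)
  obtain ⟨m, hm⟩ := gen_aux (max |a| (e ^ 2)).toNat P a e u he hc hu (by rw [← hxa, ← hyu]; exact hP)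
    (Int.self_le_toNat _)
  exact ⟨m, hm ▸ hP⟩

end Q13


namespace Q13

section red
variable (p : ℕ) [Fact p.Prime]

/-- `z` is the reduction of the `p`-integral rational `r` -/
def Rd (r : ℚ) (z : ZMod p) : Prop := ∃ n d : ℤ, (d : ZMod p) ≠ 0 ∧ r = n / d ∧ z = n / d

variable {p}

theorem Rd.ofInt (n : ℤ) : Rd p n n := ⟨n, 1, by simp, by simp, by simp⟩

theorem Rd.one : Rd p 1 1 := by simpa using Rd.ofInt (p := p) 1
theorem Rd.zero : Rd p 0 0 := by simpa using Rd.ofInt (p := p) 0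
theorem Rd.two : Rd p 2 2 := by simpa using Rd.ofInt (p := p) 2

theorem ne_of_zmod {d : ℤ} (h : (d : ZMod p) ≠ 0) : (d : ℚ) ≠ 0 := by
  intro h0; apply h; have : d = 0 := by exact_mod_cast h0
  rw [this]; simp

theorem Rd.add {r s : ℚ} {z w : ZMod p} (h : Rd p r z) (h' : Rd p s w) : Rd p (r + s) (z + w) := by
  obtain ⟨n, d, hd, rfl, rfl⟩ := h
  obtain ⟨n', d', hd', rfl, rfl⟩ := h'
  have h1 := ne_of_zmod hd
  have h2 := ne_of_zmod hd'
  refine ⟨n * d' + d * n', d * d', by push_cast; exact mul_ne_zero hd hd', ?_, ?_⟩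
  · push_cast; rw [div_add_div _ _ h1 h2]
  · push_cast; rw [div_add_div _ _ hd hd']

theorem Rd.mul {r s : ℚ} {z w : ZMod p} (h : Rd p r z) (h' : Rd p s w) : Rd p (r * s) (z * w) := by
  obtain ⟨n, d, hd, rfl, rfl⟩ := h
  obtain ⟨n', d', hd', rfl, rfl⟩ := h'
  refine ⟨n * n', d * d', by push_cast; exact mul_ne_zero hd hd', ?_, ?_⟩
  · push_cast; rw [div_mul_div_comm]
  · push_cast; rw [div_mul_div_comm]

theorem Rd.neg {r : ℚ} {z : ZMod p} (h : Rd p r z) : Rd p (-r) (-z) := by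
  obtain ⟨n, d, hd, rfl, rfl⟩ := h
  exact ⟨-n, d, hd, by push_cast; ring, by push_cast; ring⟩

theorem Rd.sub {r s : ℚ} {z w : ZMod p} (h : Rd p r z) (h' : Rd p s w) : Rd p (r - s) (z - w) := by
  rw [sub_eq_add_neg, sub_eq_add_neg]; exact h.add h'.neg

theorem Rd.pow {r : ℚ} {z : ZMod p} (h : Rd p r z) (k : ℕ) : Rd p (r ^ k) (z ^ k) := by
  induction k with
  | zero => simpa using Rd.one
  | succ k ih => rw [pow_succ, pow_succ]; exact ih.mul h

theorem Rd.uniq {r : ℚ} {z w : ZMod p} (h : Rd p r z) (h' : Rd p r w) : z = w := by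
  obtain ⟨n, d, hd, rfl, rfl⟩ := h
  obtain ⟨n', d', hd', h1, rfl⟩ := h'
  rw [div_eq_div_iff (ne_of_zmod hd) (ne_of_zmod hd')] at h1
  rw [div_eq_div_iff hd hd']
  have : n * d' = n' * d := by exact_mod_cast h1
  exact_mod_cast congrArg (Int.cast : ℤ → ZMod p) this

theorem Rd.inv {r : ℚ} {z : ZMod p} (h : Rd p r z) (hz : z ≠ 0) : Rd p (r⁻¹) (z⁻¹) := by
  obtain ⟨n, d, hd, rfl, rfl⟩ := h
  refine ⟨d, n, ?_, by rw [inv_div], by rw [inv_div]⟩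
  intro h0; apply hz; rw [h0]; simp

theorem Rd.div {r s : ℚ} {z w : ZMod p} (h : Rd p r z) (h' : Rd p s w) (hw : w ≠ 0) :
    Rd p (r / s) (z / w) := by
  rw [div_eq_mul_inv, div_eq_mul_inv]; exact h.mul (h'.inv hw)

variable (p) in
/-- `Pb` is the reduction of `P` modulo `p` -/
def Cp (P : (E ℚ).Point) (Pb : (E (ZMod p)).Point) : Prop :=
  (P = 0 ∧ Pb = 0) ∨
  (Pb = 0 ∧ ∃ a e u : ℤ, (a : ZMod p) ≠ 0 ∧ (e : ZMod p) = 0 ∧ e ≠ 0 ∧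
    u ^ 2 = a ^ 3 - a ^ 2 * e ^ 2 + e ^ 6 ∧ IsPt P (a / e ^ 2) (u / e ^ 3)) ∨
  (∃ x y xb yb, IsPt P x y ∧ IsPt Pb xb yb ∧ Rd p x xb ∧ Rd p y yb)

theorem Cp.neg {P : (E ℚ).Point} {Pb : (E (ZMod p)).Point} (h : Cp p P Pb) : Cp p (-P) (-Pb) := by
  rcases h with ⟨h1, h2⟩ | ⟨h1, a, e, u, ha, he, he0, hu, hP⟩ | ⟨x, y, xb, yb, h1, h2, h3, h4⟩
  · left; simp [h1, h2]
  · right; left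
    refine ⟨by simp [h1], a, e, -u, ha, he, he0, by rw [← hu]; ring, ?_⟩
    have := hP.neg
    push_cast
    rwa [neg_div]
  · right; right
    exact ⟨x, -y, xb, -yb, h1.neg, h2.neg, h3, h4.neg⟩

theorem Cp.step [NeZero (2 : ZMod p)] {P : (E ℚ).Point} {Pb : (E (ZMod p)).Point} (h : Cp p P Pb) :
    Cp p (P + G) (Pb + G) := by
  have h2p : (2 : ZMod p) ≠ 0 := NeZero.ne _
  rcases h with ⟨h1, h2⟩ | ⟨h1, a, e, u, ha, he, he0, hu, hP⟩ | ⟨x, y, xb, yb, h1, h2, h3, h4⟩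
  · right; right
    rw [h1, h2, zero_add, zero_add]
    exact ⟨0, 1, 0, 1, isPt_G, isPt_G, Rd.zero, Rd.one⟩
  · right; right
    rw [h1, zero_add]
    have ha0 : (a : ℚ) ≠ 0 := ne_of_zmod ha
    have he0' : (e : ℚ) ≠ 0 := by exact_mod_cast he0
    have hu' : (u : ℚ) ^ 2 = a ^ 3 - a ^ 2 * e ^ 2 + e ^ 6 := by exact_mod_cast hu
    have hub : (u : ZMod p) ^ 2 = a ^ 3 := by
      have : ((u ^ 2 : ℤ) : ZMod p) = ((a ^ 3 - a ^ 2 * e ^ 2 + e ^ 6 : ℤ) : ZMod p) := by rw [hu]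
      push_cast at this; rw [this, he]; ring
    have hadd := hP.add isPt_G (by positivity) (s := (u - e ^ 3) / (e * a))
      (x₃ := ((2 * e * (e ^ 3 - u) : ℤ) : ℚ) / ((a ^ 2 : ℤ) : ℚ))
      (y₃ := ((2 * (u - e ^ 3) ^ 2 - a ^ 3 : ℤ) : ℚ) / ((a ^ 3 : ℤ) : ℚ))
      (by field_simp; ring) (by push_cast; field_simp; linear_combination -hu')
      (by push_cast; field_simp; linear_combination (a * 0 * e : ℚ) * hu')
    refine ⟨_, _, 0, 1, hadd, isPt_G, ⟨_, _, ?_, rfl, ?_⟩, ⟨_, _, ?_, rfl, ?_⟩⟩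
    · push_cast; exact pow_ne_zero _ ha
    · push_cast; rw [he]; simp
    · push_cast; exact pow_ne_zero _ ha
    · push_cast; rw [he, eq_div_iff (pow_ne_zero _ ha)]; linear_combination (-2) * hub
  · have e1 := h1.eq
    have e2 := h2.eq
    by_cases hx : x = 0
    · subst hx
      have hxb : xb = 0 := h3.uniq Rd.zero
      subst hxb
      have : (y - 1) * (y + 1) = 0 := by linear_combination e1
      rcases mul_eq_zero.mp this with h0 | h0
      · have hy : y = 1 := by linear_combination h0
        subst hy
        have hyb : yb = 1 := h4.uniq Rd.one
        subst hyb
        have hP : P = G := h1.uniq isPt_G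
        have hPb : Pb = G := h2.uniq isPt_G
        subst hP; subst hPb
        right; right
        refine ⟨1, -1, 1, -1, isPt_G.dbl (by norm_num) (s := 0) (by norm_num) (by norm_num) (by norm_num),
          isPt_G.dbl (by simpa using h2p) (s := 0) (by norm_num) (by norm_num) (by norm_num), Rd.one, Rd.one.neg⟩
      · have hy : y = -1 := by linear_combination h0
        subst hy
        have hyb : yb = -1 := h4.uniq Rd.one.neg
        subst hyb
        have hP : P = -G := h1.uniq isPt_G.neg
        have hPb : Pb = -G := h2.uniq isPt_G.neg
        left; simp [hP, hPb]
    · have hadd := h1.add isPt_G hx (s := (y - 1) / x) (by field_simp; ring) rfl rfl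
      by_cases hxb : xb = 0
      · subst hxb
        have : (yb - 1) * (yb + 1) = 0 := by linear_combination e2
        rcases mul_eq_zero.mp this with h0 | h0
        · have hyb : yb = 1 := by linear_combination h0
          subst hyb
          have hPb : Pb = G := h2.uniq isPt_G
          subst hPb
          have hne : (1 : ZMod p) + 1 ≠ 0 := by rw [one_add_one_eq_two]; exact h2p
          have hy1 : y + 1 ≠ 0 := by
            intro h5
            have h6 := h4.add Rd.one
            rw [h5] at h6
            exact hne (h6.uniq Rd.zero)
          have hs : (y - 1) / x = (x ^ 2 - x) / (y + 1) := by
            field_simp; linear_combination e1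
          have hrs := ((h3.pow 2).sub h3).div (h4.add Rd.one) hne
          rw [← hs] at hrs
          have hadd2 := (isPt_G (F := ZMod p)).dbl (by simpa using h2p) (s := 0) (by norm_num) rfl rfl
          right; right
          refine ⟨_, _, _, _, hadd, hadd2, ?_, ?_⟩
          · have := (((hrs.pow 2).add Rd.one).sub h3).sub Rd.zero
            convert this using 1; simp
          · have := ((hrs.mul (((((hrs.pow 2).add Rd.one).sub h3).sub Rd.zero).sub h3)).add h4).neg
            convert this using 1; simp
        · have hyb : yb = -1 := by linear_combination h0
          subst hyb
          have hPb : Pb = -G := h2.uniq isPt_G.neg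
          right; left
          refine ⟨by rw [hPb]; simp, ?_⟩
          obtain ⟨a, e, u, he, hc, hxa, hyu, hu, hu0⟩ := intForm hadd.eq
          have hpe : (e : ZMod p) = 0 := by
            by_contra hpe
            have hx3 : Rd p (((y - 1) / x) ^ 2 + 1 - x - 0) (a / e ^ 2) :=
              ⟨a, e ^ 2, by push_cast; exact pow_ne_zero 2 hpe, by rw [hxa]; push_cast; ring, by push_cast; ring⟩
            have h5 := hx3.mul (h3.pow 2)
            have h6 : (((y - 1) / x) ^ 2 + 1 - x - 0) * x ^ 2 = 2 * (1 - y) := by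
              field_simp; linear_combination e1
            rw [h6] at h5
            have h7 := h5.uniq (Rd.two.mul (Rd.one.sub h4))
            apply h2p
            have h8 : (2 : ZMod p) ^ 2 = 0 := by linear_combination -h7
            exact pow_eq_zero_iff (two_ne_zero) |>.mp h8
          refine ⟨a, e, u, ?_, hpe, he.ne', hu, by rw [← hxa, ← hyu]; exact hadd⟩
          intro hpa
          obtain ⟨r, s, hrs⟩ := hc
          have : ((r * a + s * e : ℤ) : ZMod p) = 1 := by rw [hrs]; simp
          push_cast at this
          rw [hpa, hpe] at this
          simp at this
      · have hrs := (h4.sub Rd.one).div h3 hxb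
        right; right
        refine ⟨_, _, _, _, hadd, h2.add isPt_G hxb (s := (yb - 1) / xb) (by field_simp; ring) rfl rfl, ?_, ?_⟩
        · exact (((hrs.pow 2).add Rd.one).sub h3).sub Rd.zero
        · exact ((hrs.mul (((((hrs.pow 2).add Rd.one).sub h3).sub Rd.zero).sub h3)).add h4).neg

theorem cp_nat [NeZero (2 : ZMod p)] (m : ℕ) : Cp p (m • G) (m • G) := by
  induction m with
  | zero => left; simp
  | succ m ih => rw [succ_nsmul, succ_nsmul]; exact ih.step

theorem cp [NeZero (2 : ZMod p)] (m : ℤ) : Cp p (m • G) (m • G) := by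
  obtain ⟨n, rfl | rfl⟩ := m.eq_nat_or_neg
  · rw [natCast_zsmul, natCast_zsmul]; exact cp_nat n
  · rw [neg_zsmul, neg_zsmul, natCast_zsmul, natCast_zsmul]; exact (cp_nat n).neg

end red

end Q13


namespace Q13

/-- integral form of the multiple `m G` -/
structure IF (m a e u : ℤ) : Prop where
  e0 : e ≠ 0
  cop : IsCoprime a e
  eq : u ^ 2 = a ^ 3 - a ^ 2 * e ^ 2 + e ^ 6
  pt : IsPt (m • (G : (E ℚ).Point)) (a / e ^ 2) (u / e ^ 3)

theorem IF.u0 {m a e u : ℤ} (h : IF m a e u) : u ≠ 0 := by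
  rintro rfl
  have h1 : (e : ℚ) ≠ 0 := by exact_mod_cast h.e0
  have h2 : (0 : ℚ) ^ 2 = a ^ 3 - a ^ 2 * e ^ 2 + e ^ 6 := by exact_mod_cast h.eq
  apply cubic_no_root (a / e ^ 2)
  field_simp; linear_combination -h2

theorem exists_IF {m : ℤ} {x y : ℚ} (h : IsPt (m • (G : (E ℚ).Point)) x y) :
    ∃ a e u, IF m a e u ∧ 0 < e ∧ x = a / e ^ 2 ∧ y = u / e ^ 3 := by
  obtain ⟨a, e, u, he, hc, hxa, hyu, hu, hu0⟩ := intForm h.eq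
  exact ⟨a, e, u, ⟨he.ne', hc, hu, by rw [← hxa, ← hyu]; exact h⟩, he, hxa, hyu⟩

section red2
variable {p : ℕ} [Fact p.Prime] [NeZero (2 : ZMod p)]

theorem cop_zmod {a e : ℤ} (hc : IsCoprime a e) (he : (e : ZMod p) = 0) : (a : ZMod p) ≠ 0 := by
  intro hpa
  obtain ⟨r, s, hrs⟩ := hc
  have : ((r * a + s * e : ℤ) : ZMod p) = 1 := by rw [hrs]; simp
  push_cast at this
  rw [hpa, he] at this
  simp at this

theorem IF.red {m a e u : ℤ} (h : IF m a e u) :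
    ((e : ZMod p) = 0 ∧ m • (G : (E (ZMod p)).Point) = 0) ∨
    ((e : ZMod p) ≠ 0 ∧ IsPt (m • (G : (E (ZMod p)).Point)) (a / e ^ 2) (u / e ^ 3)) := by
  have he0 : (e : ℚ) ≠ 0 := by exact_mod_cast h.e0
  rcases cp (p := p) m with ⟨h1, h2⟩ | ⟨h1, a', e', u', ha, he, he0', hu, hP⟩ | ⟨x, y, xb, yb, h1, h2, h3, h4⟩
  · exact absurd h1 h.pt.ne_zero
  · left; refine ⟨?_, h1⟩
    have he0'' : (e' : ℚ) ≠ 0 := by exact_mod_cast he0'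
    have h2 := (hP.inj h.pt).1
    field_simp at h2
    have h3 : a' * e ^ 2 = e' ^ 2 * a := by exact_mod_cast h2
    have h4 : (a' : ZMod p) * e ^ 2 = e' ^ 2 * a := by
      exact_mod_cast congrArg (Int.cast : ℤ → ZMod p) h3
    rw [he] at h4
    have h5 : (e : ZMod p) ^ 2 = 0 := by
      have : (a' : ZMod p) * e ^ 2 = 0 := by rw [h4]; ring
      exact (mul_eq_zero.mp this).resolve_left ha
    exact pow_eq_zero_iff (two_ne_zero) |>.mp h5
  · right
    obtain ⟨g1, g2⟩ := h1.inj h.pt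
    have he : (e : ZMod p) ≠ 0 := by
      intro he
      obtain ⟨n, d, hd, hnd, -⟩ := h3
      rw [hnd] at g1
      have hd' := ne_of_zmod hd
      field_simp at g1
      have h5 : n * e ^ 2 = d * a := by exact_mod_cast g1
      have h6 : (n : ZMod p) * e ^ 2 = d * a := by
        exact_mod_cast congrArg (Int.cast : ℤ → ZMod p) h5
      rw [he] at h6
      have h7 : (d : ZMod p) * a = 0 := by rw [← h6]; ring
      rcases mul_eq_zero.mp h7 with h8 | h8
      · exact hd h8
      · exact cop_zmod h.cop he h8
    refine ⟨he, ?_⟩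
    have r1 : Rd p x (a / e ^ 2) := ⟨a, e ^ 2, by push_cast; exact pow_ne_zero _ he, by rw [g1]; push_cast; ring, by push_cast; ring⟩
    have r2 : Rd p y (u / e ^ 3) := ⟨u, e ^ 3, by push_cast; exact pow_ne_zero _ he, by rw [g2]; push_cast; ring, by push_cast; ring⟩
    rw [← h3.uniq r1, ← h4.uniq r2]; exact h2

theorem IF.red_zero {m a e u : ℤ} (h : IF m a e u) (hm : m • (G : (E (ZMod p)).Point) = 0) :
    (e : ZMod p) = 0 := by
  rcases h.red (p := p) with ⟨h1, -⟩ | ⟨-, h2⟩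
  · exact h1
  · exact absurd hm h2.ne_zero

theorem IF.red_ne {m a e u : ℤ} (h : IF m a e u) (hm : (e : ZMod p) ≠ 0) :
    IsPt (m • (G : (E (ZMod p)).Point)) (a / e ^ 2) (u / e ^ 3) := by
  rcases h.red (p := p) with ⟨h1, -⟩ | ⟨-, h2⟩
  · exact absurd h1 hm
  · exact h2

end red2

/-! 2-adic facts -/

/-- doubling in integral form when `a` is odd -/
theorem IF.dbl {m a e u : ℤ} (h : IF m a e u) (ha : Odd a) :
    ∃ u', IF (2 * m) (a ^ 4 - 8 * a * e ^ 6 + 4 * e ^ 8) (2 * e * u) u' := by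
  have he0 : (e : ℚ) ≠ 0 := by exact_mod_cast h.e0
  have hu0 : (u : ℚ) ≠ 0 := by exact_mod_cast h.u0
  obtain ⟨z, hz⟩ := h.pt.dbl_x (by positivity)
  have e1 : (((a : ℚ) / e ^ 2) ^ 4 - 8 * (a / e ^ 2) + 4) / (4 * (u / e ^ 3) ^ 2) =
      ((a ^ 4 - 8 * a * e ^ 6 + 4 * e ^ 8 : ℤ) : ℚ) / ((2 * e * u : ℤ) : ℚ) ^ 2 := by
    push_cast; field_simp; ring
  rw [e1] at hz
  have hz2 : IsPt ((2 * m) • (G : (E ℚ).Point)) (((a ^ 4 - 8 * a * e ^ 6 + 4 * e ^ 8 : ℤ) : ℚ) / ((2 * e * u : ℤ) : ℚ) ^ 2) z := by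
    rw [two_mul, add_zsmul]; exact hz
  have hc := (dbl_cop h.cop h.eq)
  have hc2 : IsCoprime (a ^ 4 - 8 * a * e ^ 6 + 4 * e ^ 8) (2 * e * u) := by
    have hodd : IsCoprime (a ^ 4 - 8 * a * e ^ 6 + 4 * e ^ 8) 2 := by
      have : Odd (a ^ 4 - 8 * a * e ^ 6 + 4 * e ^ 8) := by
        have h1 : Odd (a ^ 4) := ha.pow
        have h2 : Even (8 * a * e ^ 6 - 4 * e ^ 8) := ⟨4 * a * e ^ 6 - 2 * e ^ 8, by ring⟩
        have h3 : a ^ 4 - 8 * a * e ^ 6 + 4 * e ^ 8 = a ^ 4 - (8 * a * e ^ 6 - 4 * e ^ 8) := by ring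
        rw [h3]; exact h1.sub_even h2
      exact Int.isCoprime_iff_gcd_eq_one.mpr (by
        obtain ⟨k, hk⟩ := this
        rw [hk, Int.gcd_comm]; simp)
    have h1 : IsCoprime (a ^ 4 - 8 * a * e ^ 6 + 4 * e ^ 8) (e * u) :=
      hc.of_isCoprime_of_dvd_right ⟨e * u, by ring⟩
    have h2 := hodd.mul_right h1
    rwa [← mul_assoc] at h2
  obtain ⟨a', e', u', he', hc', hxa, hyu, hu, hu0'⟩ := intForm hz2.eq
  -- compare
  have hD : ((2 * e * u : ℤ) : ℚ) ≠ 0 := by push_cast; positivity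
  have hE : (e' : ℚ) ≠ 0 := by exact_mod_cast he'.ne'
  have h5 := hxa
  rw [div_eq_div_iff (pow_ne_zero 2 hD) (pow_ne_zero 2 hE)] at h5
  have h6 : (a ^ 4 - 8 * a * e ^ 6 + 4 * e ^ 8) * e' ^ 2 = a' * (2 * e * u) ^ 2 := by exact_mod_cast h5
  have d1 : (2 * e * u) ^ 2 ∣ e' ^ 2 := hc2.symm.pow_left.dvd_of_dvd_mul_left ⟨a', by rw [h6]; ring⟩
  have d2 : e' ^ 2 ∣ (2 * e * u) ^ 2 := hc'.symm.pow_left.dvd_of_dvd_mul_left ⟨a ^ 4 - 8 * a * e ^ 6 + 4 * e ^ 8, by rw [← h6]; ring⟩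
  have d1' := (Int.pow_dvd_pow_iff two_ne_zero).mp d1
  have d2' := (Int.pow_dvd_pow_iff two_ne_zero).mp d2
  have hD0 : (2 * e * u) ≠ 0 := by exact_mod_cast hD
  have has : e' = 2 * e * u ∨ e' = -(2 * e * u) := by
    rcases Int.associated_iff.mp (associated_of_dvd_dvd d1' d2') with h0 | h0
    · left; exact h0.symm
    · right; rw [h0]; ring
  have ha' : a' = a ^ 4 - 8 * a * e ^ 6 + 4 * e ^ 8 := by
    have : e' ^ 2 = (2 * e * u) ^ 2 := by rcases has with h0 | h0 <;> rw [h0] <;> ring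
    rw [this] at h6
    exact (mul_right_cancel₀ (pow_ne_zero 2 hD0) h6).symm
  rcases has with h0 | h0
  · refine ⟨u', hD0, hc2, ?_, ?_⟩
    · rw [hu, ha', h0]
    · have := hz2; rw [hyu, h0] at this; exact this
  · refine ⟨-u', hD0, hc2, ?_, ?_⟩
    · have : (-u') ^ 2 = u' ^ 2 := by ring
      rw [this, hu, ha', h0]; ring
    · have := hz2; rw [hyu, h0] at this
      convert this using 1
      push_cast; field_simp

theorem IF.uniq {m a e u a' e' u' : ℤ} (h : IF m a e u) (h' : IF m a' e' u') :
    a = a' ∧ (e = e' ∨ e = -e') := by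
  have h1 := (h.pt.inj h'.pt).1
  have he : (e : ℚ) ≠ 0 := by exact_mod_cast h.e0
  have he' : (e' : ℚ) ≠ 0 := by exact_mod_cast h'.e0
  rw [div_eq_div_iff (pow_ne_zero 2 he) (pow_ne_zero 2 he')] at h1
  have h6 : a * e' ^ 2 = a' * e ^ 2 := by exact_mod_cast h1
  have d1 : e ^ 2 ∣ e' ^ 2 := h.cop.symm.pow_left.dvd_of_dvd_mul_left ⟨a', by rw [h6]; ring⟩
  have d2 : e' ^ 2 ∣ e ^ 2 := h'.cop.symm.pow_left.dvd_of_dvd_mul_left ⟨a, by rw [← h6]; ring⟩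
  have d1' := (Int.pow_dvd_pow_iff two_ne_zero).mp d1
  have d2' := (Int.pow_dvd_pow_iff two_ne_zero).mp d2
  have has : e = e' ∨ e = -e' := Int.associated_iff.mp (associated_of_dvd_dvd d1' d2')
  refine ⟨?_, has⟩
  have : e' ^ 2 = e ^ 2 := by rcases has with h0 | h0 <;> rw [h0] <;> ring
  rw [this] at h6
  exact mul_right_cancel₀ (pow_ne_zero 2 h.e0) h6

theorem odd_of_cop {a e : ℤ} (hc : IsCoprime a e) (he : Even e) : Odd a := by
  rw [← Int.not_even_iff_odd]
  intro ha
  have := hc.isUnit_of_dvd' ha.two_dvd he.two_dvd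
  norm_num [Int.isUnit_iff] at this

theorem IF.four {m a e u : ℤ} (h : IF m a e u) : ∃ a' e' u', IF (4 * m) a' e' u' ∧ Even e' := by
  have key : ∃ a2 e2 u2, IF (2 * m) a2 e2 u2 ∧ Odd a2 := by
    rcases Int.even_or_odd a with ha | ha
    · have he0 : (e : ℚ) ≠ 0 := by exact_mod_cast h.e0
      have hu0 : (u : ℚ) ≠ 0 := by exact_mod_cast h.u0
      obtain ⟨z, hz⟩ := h.pt.dbl_x (by positivity)
      rw [← add_zsmul, ← two_mul] at hz
      obtain ⟨a2, e2, u2, h2, -, hx, -⟩ := exists_IF hz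
      refine ⟨a2, e2, u2, h2, ?_⟩
      obtain ⟨b, hb⟩ := ha
      have hb' : (a : ℚ) = b + b := by exact_mod_cast hb
      have he2 : (e2 : ℚ) ≠ 0 := by exact_mod_cast h2.e0
      have eo : Odd e := by
        rw [← Int.not_even_iff_odd]; intro he
        have := odd_of_cop h.cop he
        rw [hb] at this; rw [← Int.not_even_iff_odd] at this; exact this ⟨b, rfl⟩
      have h5 : a2 * (e ^ 2 * u ^ 2) = (2 * (2 * b ^ 4 - 2 * b * e ^ 6) + e ^ 8) * e2 ^ 2 := by
        have : (a2 * (e ^ 2 * u ^ 2) : ℚ) = (2 * (2 * b ^ 4 - 2 * b * e ^ 6) + e ^ 8) * e2 ^ 2 := by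
          rw [hb'] at hx
          field_simp at hx
          linear_combination (-1 / 4) * hx
        exact_mod_cast this
      rw [← Int.not_even_iff_odd]; intro hev
      have h6 : Even ((2 * (2 * b ^ 4 - 2 * b * e ^ 6) + e ^ 8) * e2 ^ 2) := by
        rw [← h5]; exact hev.mul_right _
      rw [Int.even_mul] at h6
      rcases h6 with h7 | h7
      · have : Odd (2 * (2 * b ^ 4 - 2 * b * e ^ 6) + e ^ 8) := (even_two_mul _).add_odd eo.pow
        exact (Int.not_even_iff_odd.mpr this) h7
      · have h8 : Even e2 := (Int.even_pow.mp h7).1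
        exact (Int.not_even_iff_odd.mpr (odd_of_cop h2.cop h8)) hev
    · obtain ⟨u', hu'⟩ := h.dbl ha
      exact ⟨_, _, u', hu', odd_of_cop hu'.cop ⟨e * u, by ring⟩⟩
  obtain ⟨a2, e2, u2, h2, ho⟩ := key
  obtain ⟨u', hu'⟩ := h2.dbl ho
  rw [← mul_assoc] at hu'
  exact ⟨_, _, u', hu', ⟨e2 * u2, by ring⟩⟩

theorem IF.two_pow {m a e u : ℤ} (h : IF m a e u) (k : ℕ) :
    ∃ a' e' u', IF (2 ^ k * (4 * m)) a' e' u' ∧ 2 ^ (k + 1) ∣ e' := by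
  induction k with
  | zero =>
    obtain ⟨a', e', u', h', he⟩ := h.four
    exact ⟨a', e', u', by simpa using h', by simpa using he.two_dvd⟩
  | succ k ih =>
    obtain ⟨a', e', u', h', he⟩ := ih
    have hev : Even e' := even_iff_two_dvd.mpr (dvd_trans (dvd_pow_self 2 (by omega)) he)
    obtain ⟨u2, h2⟩ := h'.dbl (odd_of_cop h'.cop hev)
    refine ⟨_, _, u2, by rw [pow_succ', mul_assoc]; exact h2, ?_⟩
    rw [mul_assoc, pow_succ' _ (k + 1)]
    exact mul_dvd_mul_left 2 (he.mul_right _)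

/-- the exact 2-adic valuation of `e(2^(k+2) G)` -/
theorem two_pow_exact (k : ℕ) : ∃ a e u, IF (2 ^ (k + 2)) a (2 ^ (k + 1) * e) u ∧ Odd e ∧ Odd u := by
  induction k with
  | zero =>
    refine ⟨-3, 1, 1, ⟨by norm_num, ?_, by norm_num, ?_⟩, odd_one, odd_one⟩
    · exact ⟨-1, -1, by norm_num⟩
    · have := isPt_4G
      convert this using 1 <;> norm_num
  | succ k ih =>
    obtain ⟨a, e, u, h, he, hu⟩ := ih
    have hev : Even (2 ^ (k + 1) * e) := (even_two.pow_of_ne_zero (by omega)).mul_right _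
    obtain ⟨u2, h2⟩ := h.dbl (odd_of_cop h.cop hev)
    refine ⟨a ^ 4 - 8 * a * (2 ^ (k + 1) * e) ^ 6 + 4 * (2 ^ (k + 1) * e) ^ 8, e * u, u2, ?_, he.mul hu, ?_⟩
    · rw [← pow_succ'] at h2
      convert h2 using 1; ring
    · have h3 := h2.eq
      have h4 : Odd ((a ^ 4 - 8 * a * (2 ^ (k + 1) * e) ^ 6 + 4 * (2 ^ (k + 1) * e) ^ 8)) :=
        odd_of_cop h2.cop ⟨(2 ^ (k + 1) * e) * u, by ring⟩
      have h5 : Odd (u2 ^ 2) := by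
        rw [h3]
        have h6 := h4.pow (n := 3)
        set A := (a ^ 4 - 8 * a * (2 ^ (k + 1) * e) ^ 6 + 4 * (2 ^ (k + 1) * e) ^ 8)
        set B := (2 ^ (k + 1) * e)
        have : A ^ 3 - A ^ 2 * (2 * B * u) ^ 2 + (2 * B * u) ^ 6 = A ^ 3 + 2 * (-2 * A ^ 2 * (B * u) ^ 2 + 32 * (B * u) ^ 6) := by ring
        rw [this]
        exact h6.add_even (even_two_mul _)
      exact (Int.odd_pow.mp h5).resolve_right (by norm_num)

theorem mul_G_ne_zero {m : ℤ} (hm : m ≠ 0) : m • (G : (E ℚ).Point) ≠ 0 := by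
  intro h0
  have hfin : IsOfFinAddOrder (G : (E ℚ).Point) := by
    rw [isOfFinAddOrder_iff_zsmul_eq_zero]; exact ⟨m, hm, h0⟩
  have hf : Finite (AddSubgroup.zmultiples (G : (E ℚ).Point)) := by
    exact finite_zmultiples.mpr hfin
  obtain ⟨i, j, hij, heq⟩ := Finite.exists_ne_map_eq_of_infinite
    (fun k : ℕ => (⟨((2 ^ (k + 2) : ℤ)) • G, AddSubgroup.zsmul_mem_zmultiples _ _⟩ :
      AddSubgroup.zmultiples (G : (E ℚ).Point)))
  have heq' : ((2 ^ (i + 2) : ℤ)) • (G : (E ℚ).Point) = ((2 ^ (j + 2) : ℤ)) • G := congrArg Subtype.val heq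
  obtain ⟨a, e, u, h, he, hu⟩ := two_pow_exact i
  obtain ⟨a', e', u', h', he', hu'⟩ := two_pow_exact j
  have h'' : IF (2 ^ (i + 2)) a' (2 ^ (j + 1) * e') u' := ⟨h'.e0, h'.cop, h'.eq, by rw [heq']; exact h'.pt⟩
  have hcmp : ∀ i j : ℕ, ∀ e e' : ℤ, i < j → Odd e → (2 ^ (i + 1) * e = 2 ^ (j + 1) * e' ∨ 2 ^ (i + 1) * e = - (2 ^ (j + 1) * e')) → False := by
    intro i j e e' hlt he hh
    obtain ⟨d, rfl⟩ := Nat.exists_eq_add_of_lt hlt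
    have h2 : (2 : ℤ) ^ (i + d + 1 + 1) = 2 ^ (i + 1) * (2 * 2 ^ d) := by ring
    rw [h2, mul_assoc, ← mul_neg] at hh
    have h3 : e = 2 * (2 ^ d * e') ∨ e = 2 * (- (2 ^ d * e')) := by
      rcases hh with hh | hh
      · left; have := mul_left_cancel₀ (pow_ne_zero _ two_ne_zero) hh; rw [this]; ring
      · right; have := mul_left_cancel₀ (pow_ne_zero _ two_ne_zero) hh; rw [this]; ring
    rw [← Int.not_even_iff_odd] at he
    rcases h3 with h3 | h3 <;> exact he (h3 ▸ even_two_mul _)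
  have hu1 := (h.uniq h'').2
  rcases lt_or_gt_of_ne hij with hlt | hlt
  · exact hcmp i j e e' hlt he hu1
  · refine hcmp j i e' e hlt he' ?_
    rcases hu1 with h1 | h1
    · left; exact h1.symm
    · right; rw [h1]; ring

theorem exists_IF' {m : ℤ} (hm : m ≠ 0) : ∃ a e u, IF m a e u ∧ 0 < e := by
  obtain ⟨x, y, h⟩ := isPt_of_ne_zero (mul_G_ne_zero hm)
  obtain ⟨a, e, u, h1, h2, -, -⟩ := exists_IF h
  exact ⟨a, e, u, h1, h2⟩

theorem IF.dvd_two {c a e u : ℤ} (h : IF c a e u) (k : ℕ) (hc : (2 : ℤ) ^ (k + 2) ∣ c) :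
    2 ^ (k + 1) ∣ e := by
  obtain ⟨m, rfl⟩ := hc
  have hm : m ≠ 0 := by
    rintro rfl
    have := h.pt.ne_zero
    simp at this
  obtain ⟨a', e', u', h', -⟩ := exists_IF' hm
  obtain ⟨a2, e2, u2, h2, hd⟩ := h'.two_pow k
  have : (2 : ℤ) ^ k * (4 * m) = 2 ^ (k + 2) * m := by ring
  rw [this] at h2
  rcases (h.uniq h2).2 with h3 | h3
  · rw [h3]; exact hd
  · rw [h3]; exact (dvd_neg).mpr hd

end Q13


namespace Q13

/-- forces evaluation of the numeral `n` -/
def frc {α : Type} (n : ℕ) (f : ℕ → α) : α := Nat.rec (f 0) (fun k _ => f (Nat.succ k)) n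

theorem frc_eq {α : Type} (n : ℕ) (f : ℕ → α) : frc n f = f n := by cases n <;> rfl

/-- walk through the multiples of `(h1,h2)` modulo `p`, testing each of them -/
def run (p h1 h2 : ℕ) (t : ℕ → ℕ → ℕ → Bool) (fuel : ℕ) : ℕ → ℕ → ℕ → ℕ → Bool :=
  Nat.rec (motive := fun _ => ℕ → ℕ → ℕ → ℕ → Bool)
    (fun _ X Y Z => Nat.beq ((X + (p - h1) * Z) % p) 0 && Nat.beq ((Y + h2 * Z) % p) 0)
    (fun _ ih n X Y Z =>
      frc ((X + (p - h1) * Z) % p) fun A =>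
      frc ((Y + (p - h2) * Z) % p) fun B =>
      frc ((A * A * Z) % p) fun C =>
      frc ((B * B * Z + C + (p - h1) * C + (p - 1) * (X * A * A)) % p) fun X' =>
      frc ((A * X') % p) fun X3 =>
      frc ((A * C) % p) fun Z3 =>
      frc (((p - B) * (X' + (p - h1) * C) + (p - h2) * Z3) % p) fun Y3 =>
      frc (n + 1) fun n' =>
      !(Nat.beq A 0) && t n' X3 Z3 && ih n' X3 Y3 Z3) fuel

theorem run_zero (p h1 h2 : ℕ) (t : ℕ → ℕ → ℕ → Bool) (n X Y Z : ℕ) :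
  run p h1 h2 t 0 n X Y Z =
    (Nat.beq ((X + (p - h1) * Z) % p) 0 && Nat.beq ((Y + h2 * Z) % p) 0) := rfl

theorem run_succ (p h1 h2 : ℕ) (t : ℕ → ℕ → ℕ → Bool) (fuel n X Y Z : ℕ) :
  run p h1 h2 t (fuel + 1) n X Y Z =
     (frc ((X + (p - h1) * Z) % p) fun A =>
      frc ((Y + (p - h2) * Z) % p) fun B =>
      frc ((A * A * Z) % p) fun C =>
      frc ((B * B * Z + C + (p - h1) * C + (p - 1) * (X * A * A)) % p) fun X' =>
      frc ((A * X') % p) fun X3 =>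
      frc ((A * C) % p) fun Z3 =>
      frc (((p - B) * (X' + (p - h1) * C) + (p - h2) * Z3) % p) fun Y3 =>
      frc (n + 1) fun n' =>
      !(Nat.beq A 0) && t n' X3 Z3 && run p h1 h2 t fuel n' X3 Y3 Z3) := rfl

section
variable {p : ℕ} [Fact p.Prime]

theorem cast_mod (n : ℕ) : ((n % p : ℕ) : ZMod p) = n := ZMod.natCast_mod n p

theorem cast_sub' {a : ℕ} (h : a ≤ p) : ((p - a : ℕ) : ZMod p) = -a := by
  rw [Nat.cast_sub h]; simp

theorem beq_mod {n : ℕ} : Nat.beq (n % p) 0 = true ↔ (n : ZMod p) = 0 := by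
  rw [Nat.beq_eq, ZMod.natCast_eq_zero_iff, Nat.dvd_iff_mod_eq_zero]

theorem run_sound {h1 h2 : ℕ} (hh1 : h1 < p) (hh2 : h2 < p) (t : ℕ → ℕ → ℕ → Bool)
    {H : (E (ZMod p)).Point} (hH : IsPt H h1 h2) (fuel : ℕ) : ∀ (n X Y Z : ℕ),
    (Z : ZMod p) ≠ 0 → IsPt (n • H) (X / Z) (Y / Z) → run p h1 h2 t fuel n X Y Z = true →
    (n + fuel + 1) • H = 0 ∧ ∀ j, n < j → j ≤ n + fuel →
      ∃ X Z : ℕ, (Z : ZMod p) ≠ 0 ∧ (∃ y, IsPt (j • H) (X / Z) y) ∧ t j X Z = true := by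
  induction fuel with
  | zero =>
    intro n X Y Z hZ hP hr
    rw [run_zero, Bool.and_eq_true, beq_mod, beq_mod] at hr
    obtain ⟨r1, r2⟩ := hr
    push_cast at r1 r2
    rw [cast_sub' hh1.le] at r1
    refine ⟨?_, fun j h1 h2 => by omega⟩
    have e1 : (X : ZMod p) / Z = h1 := by rw [div_eq_iff hZ]; linear_combination r1
    have e2 : (Y : ZMod p) / Z = -h2 := by rw [div_eq_iff hZ]; linear_combination r2
    rw [e1, e2] at hP
    have := hP.uniq hH.neg
    rw [add_zero, succ_nsmul, this]; simp
  | succ fuel ih =>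
    intro n X Y Z hZ hP hr
    rw [run_succ] at hr
    simp only [frc_eq] at hr
    set A := (X + (p - h1) * Z) % p with hA
    set B := (Y + (p - h2) * Z) % p with hB
    set C := (A * A * Z) % p with hC
    set X' := (B * B * Z + C + (p - h1) * C + (p - 1) * (X * A * A)) % p with hX'
    set X3 := (A * X') % p with hX3
    set Z3 := (A * C) % p with hZ3
    set Y3 := ((p - B) * (X' + (p - h1) * C) + (p - h2) * Z3) % p with hY3
    have hp1 : 1 ≤ p := (Fact.out : p.Prime).one_lt.le
    have hBp : B ≤ p := (Nat.mod_lt _ (by omega)).le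
    have cA : (A : ZMod p) = X - h1 * Z := by
      rw [hA, cast_mod]; push_cast; rw [cast_sub' hh1.le]; ring
    have cB : (B : ZMod p) = Y - h2 * Z := by
      rw [hB, cast_mod]; push_cast; rw [cast_sub' hh2.le]; ring
    have cC : (C : ZMod p) = A ^ 2 * Z := by
      rw [hC, cast_mod]; push_cast; ring
    have cX' : (X' : ZMod p) = B ^ 2 * Z + (1 - h1) * C - X * A ^ 2 := by
      rw [hX', cast_mod]; push_cast; rw [cast_sub' hh1.le, cast_sub' hp1]; push_cast; ring
    have cX3 : (X3 : ZMod p) = A * X' := by rw [hX3, cast_mod]; push_cast; ring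
    have cZ3 : (Z3 : ZMod p) = A * C := by rw [hZ3, cast_mod]; push_cast; ring
    have cY3 : (Y3 : ZMod p) = - (B * (X' - h1 * C) + h2 * Z3) := by
      rw [hY3, cast_mod]; push_cast; rw [cast_sub' hh1.le, cast_sub' hh2.le, cast_sub' hBp]; ring
    rw [Bool.and_eq_true, Bool.and_eq_true] at hr
    obtain ⟨⟨r1, r2⟩, r3⟩ := hr
    have hA0 : (A : ZMod p) ≠ 0 := by
      intro h0
      have : Nat.beq A 0 = true := by
        rw [hA, beq_mod, ← cast_mod, ← hA, h0]
      rw [this] at r1; simp at r1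
    have hx : (X : ZMod p) / Z ≠ h1 := by
      intro h0; rw [div_eq_iff hZ] at h0; apply hA0; rw [cA, h0]; ring
    have hZ30 : (Z3 : ZMod p) ≠ 0 := by
      rw [cZ3, cC]; exact mul_ne_zero hA0 (mul_ne_zero (pow_ne_zero _ hA0) hZ)
    have hnew : IsPt ((n + 1) • H) ((X3 : ZMod p) / Z3) (Y3 / Z3) := by
      rw [succ_nsmul, add_comm]
      refine hH.add hP (Ne.symm hx) (s := B / A) ?_ ?_ ?_
      · rw [cB]; field_simp; rw [cA]; ring
      · rw [cX3, cZ3, cX', cC]; field_simp; rw [cA]; ring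
      · rw [cX3, cY3, cZ3, cC]; field_simp
    obtain ⟨q1, q2⟩ := ih (n + 1) X3 Y3 Z3 hZ30 hnew r3
    refine ⟨by rw [← q1]; congr 1; ring, fun j j1 j2 => ?_⟩
    by_cases hj : j = n + 1
    · subst hj
      exact ⟨X3, Z3, hZ30, ⟨_, hnew⟩, r2⟩
    · exact q2 j (by omega) (by omega)

end

/-- the test with a mask of allowed residues -/
def tq (p mask n X Z : ℕ) : Bool :=
  mask.testBit n ||
  Nat.beq ((4 * X ^ 4 + 7 * (X * Z) ^ 2 + Z ^ 4 + (p - 1) * (7 * X ^ 3 * Z + 4 * X * Z ^ 3)) ^ ((p - 1) / 2) % p) (p - 1)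

/-- all data for the prime `p` -/
def chk (p ord mask : ℕ) : Bool :=
  Nat.ble 5 p && Nat.ble 3 ord && Nat.beq (p % 2) 1 && mask.testBit 0 && mask.testBit 1 && mask.testBit 2 &&
   run p 0 1 (tq p mask) (ord - 3) 2 1 (p - 1) 1

/-- `m` passes all local tests -/
def Good (m : ℤ) : Prop := m = 0 ∨ ∃ a e u s : ℤ, IF m a e u ∧
  s ^ 2 = 4 * a ^ 4 - 7 * a ^ 3 * e ^ 2 + 7 * a ^ 2 * e ^ 4 - 4 * a * e ^ 6 + e ^ 8

theorem not_sq_of_pow {p : ℕ} [Fact p.Prime] {n : ℕ} (hp : 2 < p) {k : ℕ} (hk : k = (p - 1) / 2)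
    (h : n ^ k % p = p - 1) : ¬ IsSquare (n : ZMod p) := by
  have hp2 : (p - 1) / 2 = p / 2 := by
    rcases (Fact.out : p.Prime).eq_two_or_odd with h | h <;> omega
  have h1 : ((n : ZMod p)) ^ (p / 2) = -1 := by
    have : ((n ^ k % p : ℕ) : ZMod p) = ((p - 1 : ℕ) : ZMod p) := by rw [h]
    rw [cast_mod, cast_sub' (by omega)] at this
    rw [← hp2, ← hk]; push_cast at this; simpa using this
  have : Fact (2 < p) := ⟨hp⟩
  intro hs
  have hn : (n : ZMod p) ≠ 0 := by
    intro h0; rw [h0, zero_pow (by omega)] at h1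
    have : (1 : ZMod p) = 0 := by linear_combination h1
    exact one_ne_zero this
  have h2 := (ZMod.euler_criterion p hn).mp hs
  rw [h2] at h1
  exact ZMod.neg_one_ne_one h1.symm

theorem nz2 {p : ℕ} (hp : p.Prime) (h : 2 < p) : NeZero (2 : ZMod p) := by
  refine ⟨fun h0 => ?_⟩
  have : ((2 : ℕ) : ZMod p) = 0 := by exact_mod_cast h0
  rw [ZMod.natCast_eq_zero_iff] at this
  have := Nat.le_of_dvd (by norm_num) this
  omega

theorem isPt_2Gp {p : ℕ} [Fact p.Prime] [NeZero (2 : ZMod p)] :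
    IsPt ((2 : ℕ) • (G : (E (ZMod p)).Point)) 1 (-1) := by
  rw [two_nsmul]
  exact (isPt_G).dbl (by simpa using NeZero.ne (2 : ZMod p)) (s := 0) (by norm_num) (by norm_num) (by norm_num)

theorem chk_ord {p ord mask : ℕ} [Fact p.Prime] [NeZero (2 : ZMod p)] (h : chk p ord mask = true) :
    ord • (G : (E (ZMod p)).Point) = 0 := by
  unfold chk at h
  simp only [Bool.and_eq_true, Nat.ble_eq, Nat.beq_eq] at h
  obtain ⟨⟨⟨⟨⟨⟨h1, h2⟩, h3⟩, h4⟩, h5⟩, h6⟩, h7⟩ := h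
  have := (run_sound (by omega) (by omega) (tq p mask) (by simpa using isPt_G) _ 2 1 (p - 1) 1 (by simp)
    (by rw [cast_sub' (by omega)]; simpa using isPt_2Gp) h7).1
  rwa [show 2 + (ord - 3) + 1 = ord by omega] at this

theorem chk_good {p ord mask : ℕ} [Fact p.Prime] (h : chk p ord mask = true) {m : ℤ} (hm : Good m) :
    mask.testBit (m % ord).toNat = true := by
  have hc := h
  unfold chk at h
  simp only [Bool.and_eq_true, Nat.ble_eq, Nat.beq_eq] at h
  obtain ⟨⟨⟨⟨⟨⟨h1, h2⟩, h3⟩, h4⟩, h5⟩, h6⟩, h7⟩ := h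
  have := nz2 (Fact.out : p.Prime) (by omega)
  have hord := chk_ord hc
  have hrun := (run_sound (by omega) (by omega) (tq p mask) (by simpa using isPt_G) _ 2 1 (p - 1) 1 (by simp)
    (by rw [cast_sub' (by omega)]; simpa using isPt_2Gp) h7).2
  rcases hm with rfl | ⟨a, e, u, s, hI, hs⟩
  · simpa using h4
  have ho : (0 : ℤ) < ord := by omega
  set j := (m % ord).toNat with hj
  have hj1 : (j : ℤ) = m % ord := Int.toNat_of_nonneg (Int.emod_nonneg _ ho.ne')
  have hj2 : (j : ℤ) < ord := by rw [hj1]; exact Int.emod_lt_of_pos _ ho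
  have hmj : m • (G : (E (ZMod p)).Point) = j • G := by
    have : m = j + (m / ord) * ord := by rw [hj1]; have := Int.emod_add_mul_ediv m ord; linarith
    conv_lhs => rw [this]
    rw [add_zsmul, mul_zsmul, natCast_zsmul, natCast_zsmul, hord]; simp
  by_cases g0 : j = 0
  · rw [g0]; exact h4
  by_cases g1 : j = 1
  · rw [g1]; exact h5
  by_cases g2 : j = 2
  · rw [g2]; exact h6
  obtain ⟨X, Z, hZ, ⟨y, hP⟩, ht⟩ := hrun j (by omega) (by omega)
  rw [← hmj] at hP
  have he : (e : ZMod p) ≠ 0 := by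
    intro he
    rcases hI.red (p := p) with ⟨-, h0⟩ | ⟨h0, -⟩
    · exact hP.ne_zero h0
    · exact h0 he
  have hx := (hP.inj (hI.red_ne he)).1
  unfold tq at ht
  rw [Bool.or_eq_true] at ht
  rcases ht with ht | ht
  · exact ht
  exfalso
  rw [Nat.beq_eq] at ht
  refine not_sq_of_pow (by omega) rfl ht ?_
  push_cast
  have hs' : (s : ZMod p) ^ 2 = 4 * a ^ 4 - 7 * a ^ 3 * e ^ 2 + 7 * a ^ 2 * e ^ 4 - 4 * a * e ^ 6 + e ^ 8 := by
    exact_mod_cast congrArg (Int.cast : ℤ → ZMod p) hs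
  have hXe : (X : ZMod p) * e ^ 2 = a * Z := by
    field_simp at hx; linear_combination hx
  rw [cast_sub' (by omega)]
  push_cast
  refine ⟨s * Z ^ 2 / e ^ 4, ?_⟩
  field_simp
  have e1 : (X : ZMod p) = a * Z / e ^ 2 := by field_simp; linear_combination hXe
  rw [e1]; field_simp
  linear_combination - hs'

end Q13


set_option linter.all false

namespace Q13

/-- one stage of the sieve: all residues modulo `n * l` above the residue `r` modulo `n` -/
def okT (n r : ℕ) : List (ℕ × ℕ) → Bool
  | [] => true
  | t :: ts => Nat.beq (n % t.1) 0 && t.2.testBit (r % t.1) && okT n r ts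

def go (f : ℕ → Bool) : List (ℕ × List (ℕ × ℕ)) → ℕ → ℕ → Bool
  | [], _, r => f r
  | s :: rest, n, r => frc (n * s.1) fun n' =>
      (List.range s.1).all fun c => frc (r + n * c) fun r' => !(okT n' r' s.2) || go f rest n' r'

theorem chk53 : chk 53 24 0xf9113f = true := by decide +kernel
theorem chk5 : chk 5 10 0x327 = true := by decide +kernel
theorem chk17 : chk 17 20 0xda4b7 = true := by decide +kernel
theorem chk223 : chk 223 60 0xfa7af1fff1ebcbf = true := by decide +kernel
theorem chk347 : chk 347 40 0xee39ff38ef = true := by decide +kernel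
theorem chk19 : chk 19 7 0x67 = true := by decide +kernel
theorem chk37 : chk 37 42 0x3cfc0201f9f = true := by decide +kernel
theorem chk101 : chk 101 28 0xddce777 = true := by decide +kernel
theorem chk271 : chk 271 70 0x310bf87e2a3f0fe847 = true := by decide +kernel
theorem chk317 : chk 317 28 0xf6842df = true := by decide +kernel
theorem chk11 : chk 11 16 0xc107 = true := by decide +kernel
theorem chk43 : chk 43 18 0x37277 = true := by decide +kernel
theorem chk67 : chk 67 72 0xc80b3894105239a027 = true := by decide +kernel
theorem chk59 : chk 59 32 0xc3bbbb87 = true := by decide +kernel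
theorem chk281 : chk 281 288 0xe5c175fb03de46b418f10ac09c3c38cf002ba801e638787206a11e305ac4f781bf5d074f = true := by decide +kernel
theorem chk1583 : chk 1583 224 0xc20b2d053ea18e6cbc00dc0bc2555487a076007a6ce30af94169a087 = true := by decide +kernel
theorem chk457 : chk 457 448 0xf9b5e61a4a3f288eac0f3e17aa66b5108db98a39373a3235da39bb67cdbb38b75898b9d938a33b62115accabd0f9e06ae229f8a4b0cf5b3f = true := by decide +kernel
theorem chk1279 : chk 1279 448 0xd583a89db436d90568110936891f9e1f05d1238476e3cc96d92169bd7b2d0936d2678edc43891741f0f3f122d921102d4136d85b722b8357 = true := by decide +kernel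
theorem chk113 : chk 113 108 0xd244d9d9d681e4f02d737364497 = true := by decide +kernel
theorem chk127 : chk 127 135 0x78019266710db4b93c9d2db08e6649801f = true := by decide +kernel
theorem chk359 : chk 359 27 0x6a29457 = true := by decide +kernel
theorem chk613 : chk 613 640 0xd95bf467eaec4129f35f47e9f317282cb65536bf926578e242bde47dd56b05b681516cad422a80539402a8856a6d1502db41ad577c4f7a848e3d4c93fad954da6829d19f2fc5f59f29046eafcc5fb537 = true := by decide +kernel
theorem chk283 : chk 283 300 0xc9511252faf6d502b760bdc781eaa5b5d5a55554b575b4aaf03c77a0dda8156debe94911527 = true := by decide +kernel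
theorem chk367 : chk 367 50 0x32f5cefb9d7a7 = true := by decide +kernel
theorem chk853 : chk 853 450 0x34b90c59720f31faf2eaf782668a224e7ad93fe6cfa5f90240527d302065f2501204fd2f9b3fe4daf392228b320f7aba7afc678274d184e97 = true := by decide +kernel
theorem chk71 : chk 71 77 0x18bd5459dc0ee68aaf47 = true := by decide +kernel
theorem chk97 : chk 97 88 0xf1f45a905cd67412b45f1f = true := by decide +kernel
theorem chk109 : chk 109 55 0x6b0e0d42b070d7 = true := by decide +kernel
theorem chk173 : chk 173 88 0xc67e87ce16d6d0e7c2fcc7 = true := by decide +kernel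
theorem chk383 : chk 383 66 0x3441fe16ab43fc117 = true := by decide +kernel
theorem chk479 : chk 479 154 0x39110e51d7835a9db3efbe6dcad60f5c538444f = true := by decide +kernel
theorem chk631 : chk 631 77 0x1c865e8cb6db4c5e984f = true := by decide +kernel
theorem chk1579 : chk 1579 825 0x1fc3377778a5d5d516364203e10719c251bb0d5487e01587a8bd28d2da47edcd656769d807f4975732e884e2a7c638745688ca6b594c45a8b8718f951c845d33aba4bf806e5b9a9acedf896d2c52f45786a01f84aac376290e63821f0109b1a2aeae947bbbb30ff = true := by decide +kernel
theorem chk4297 : chk 4297 1408 0xe48f9e1d00f1a1f8fed1f10b486c4402bb62d1d88ebe58e415d708df419300169a80b284ef96d526721706a51477def2c2e45a310a3fffc84b4a6707029c072f5bf0ee0bce4679c3113f8fe008a7adb48f551d45621627ababc8d08d457155e25b6bca200fe3f911873cc4e7a0ee1fb5e9c07281c1cca5a427fff8a118b44e869ef7dc514ac1d09cc956d3ee429a02b2d0019305f621d7504e34fae237168dba80446c25a11f16fe3f0b1e0170f3e24f = true := by decide +kernel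
theorem chk41 : chk 41 39 0x69d8811b97 = true := by decide +kernel
theorem chk83 : chk 83 26 0x3ec21bf = true := by decide +kernel
theorem chk167 : chk 167 78 0x3320ba2f8be8fa2e8267 = true := by decide +kernel
theorem chk401 : chk 401 130 0x304975345f7784bfffe90f77d16574907 = true := by decide +kernel
theorem chk683 : chk 683 715 0x6612668a0acc4308fc935f5dc868de075339100038cdf3ddb9776fda31b8568468217335ffca55e3ed674135000ac82e6b7c7aa53ffacce8416216a1d8c5bf6ee9dbbcfb31c00089ccae07b1613bafac93f10c2335051664867 = true := by decide +kernel
theorem chk227 : chk 227 242 0x3f677128804d7b780dda01fbaadd672735daaefc02dd80f6f59008a47737f = true := by decide +kernel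
theorem chk263 : chk 263 121 0x1cf02ed91e89b73033b645e26dd03cf = true := by decide +kernel
theorem chk1193 : chk 1193 605 0x182525252051a644c6a30e97f1df8a592b9caa37657031bdb3313825e9dfb910219944812275eb912048a66102277ee5e90723336f6303a9bb154e7526947ee3fa5c3158c899628129292907 = true := by decide +kernel
theorem chk1499 : chk 1499 121 0x1b425ff74cfd98186066fccbbfe90b7 = true := by decide +kernel
theorem chk2903 : chk 2903 726 0x364682924fc672f1ec9c1a7dd31d414a8ce75bdd4973cd86589a2e53d1af950379977bbee0e424eec955dc7fe79cf3ff1dd549bb921383beef74cf6054fac5e53a2c8d30d9e7495ded7398a9415c65df2c1c9bc7a731f924a0b137 = true := by decide +kernel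

/-- the sieve data -/
def stages : List (ℕ × List (ℕ × ℕ)) :=
  [(2, []),
   (2, []),
   (3, []),
   (2, [(24, 0xf9113f)]),
   (5, [(10, 0x327), (20, 0xda4b7), (60, 0xfa7af1fff1ebcbf), (40, 0xee39ff38ef)]),
   (7, [(7, 0x67), (42, 0x3cfc0201f9f), (28, 0xddce777), (70, 0x310bf87e2a3f0fe847), (28, 0xf6842df)]),
   (2, [(16, 0xc107)]),
   (3, [(18, 0x37277), (72, 0xc80b3894105239a027)]),
   (2, [(32, 0xc3bbbb87), (288, 0xe5c175fb03de46b418f10ac09c3c38cf002ba801e638787206a11e305ac4f781bf5d074f), (224, 0xc20b2d053ea18e6cbc00dc0bc2555487a076007a6ce30af94169a087)]),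
   (2, [(448, 0xf9b5e61a4a3f288eac0f3e17aa66b5108db98a39373a3235da39bb67cdbb38b75898b9d938a33b62115accabd0f9e06ae229f8a4b0cf5b3f), (448, 0xd583a89db436d90568110936891f9e1f05d1238476e3cc96d92169bd7b2d0936d2678edc43891741f0f3f122d921102d4136d85b722b8357)]),
   (3, [(108, 0xd244d9d9d681e4f02d737364497), (135, 0x78019266710db4b93c9d2db08e6649801f), (27, 0x6a29457)]),
   (2, [(640, 0xd95bf467eaec4129f35f47e9f317282cb65536bf926578e242bde47dd56b05b681516cad422a80539402a8856a6d1502db41ad577c4f7a848e3d4c93fad954da6829d19f2fc5f59f29046eafcc5fb537)]),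
   (5, [(300, 0xc9511252faf6d502b760bdc781eaa5b5d5a55554b575b4aaf03c77a0dda8156debe94911527), (50, 0x32f5cefb9d7a7), (450, 0x34b90c59720f31faf2eaf782668a224e7ad93fe6cfa5f90240527d302065f2501204fd2f9b3fe4daf392228b320f7aba7afc678274d184e97)]),
   (11, [(77, 0x18bd5459dc0ee68aaf47), (88, 0xf1f45a905cd67412b45f1f), (55, 0x6b0e0d42b070d7), (88, 0xc67e87ce16d6d0e7c2fcc7), (66, 0x3441fe16ab43fc117), (154, 0x39110e51d7835a9db3efbe6dcad60f5c538444f), (77, 0x1c865e8cb6db4c5e984f), (825, 0x1fc3377778a5d5d516364203e10719c251bb0d5487e01587a8bd28d2da47edcd656769d807f4975732e884e2a7c638745688ca6b594c45a8b8718f951c845d33aba4bf806e5b9a9acedf896d2c52f45786a01f84aac376290e63821f0109b1a2aeae947bbbb30ff), (1408, 0xe48f9e1d00f1a1f8fed1f10b486c4402bb62d1d88ebe58e415d708df419300169a80b284ef96d526721706a51477def2c2e45a310a3fffc84b4a6707029c072f5bf0ee0bce4679c3113f8fe008a7adb48f551d45621627ababc8d08d457155e25b6bca200fe3f911873cc4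e7a0ee1fb5e9c07281c1cca5a427fff8a118b44e869ef7dc514ac1d09cc956d3ee429a02b2d0019305f621d7504e34fae237168dba80446c25a11f16fe3f0b1e0170f3e24f)]),
   (13, [(39, 0x69d8811b97), (26, 0x3ec21bf), (78, 0x3320ba2f8be8fa2e8267), (130, 0x304975345f7784bfffe90f77d16574907), (715, 0x6612668a0acc4308fc935f5dc868de075339100038cdf3ddb9776fda31b8568468217335ffca55e3ed674135000ac82e6b7c7aa53ffacce8416216a1d8c5bf6ee9dbbcfb31c00089ccae07b1613bafac93f10c2335051664867)]),
   (11, [(242, 0x3f677128804d7b780dda01fbaadd672735daaefc02dd80f6f59008a47737f), (121, 0x1cf02ed91e89b73033b645e26dd03cf), (605, 0x182525252051a644c6a30e97f1df8a592b9caa37657031bdb3313825e9dfb910219944812275eb912048a66102277ee5e90723336f6303a9bb154e7526947ee3fa5c3158c899628129292907), (121, 0x1b425ff74cfd98186066fccbbfe90b7), (726, 0x364682924fc672f1ec9c1a7dd31d414a8ce75bdd4973cd86589a2e53d1af950379977bbee0e424eec955dc7fe79cf3ff1dd549bb921383beef74cf6054fac5e53a2c8d30d9e7495ded7398a9415c6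5df2c1c9bc7a731f924a0b137)])]

def fin11 (r : ℕ) : Bool :=
  Nat.beq (r % 237837600) 0 || Nat.beq r 2 || Nat.beq r 951350398 ||
  Nat.beq (r % 475675200) 1 || Nat.beq (r % 475675200) 475675199

theorem go_stages : go fin11 stages 1 0 = true := by decide +kernel

/-- `m` passes the test -/
def TG (m : ℤ) (t : ℕ × ℕ) : Prop := t.2.testBit (m % t.1).toNat = true

theorem okT_fail {m : ℤ} {n r : ℕ} {ts : List (ℕ × ℕ)} (hr : m % n = r) (h : ∀ t ∈ ts, TG m t)
    (hd : ∀ t ∈ ts, n % t.1 = 0) : okT n r ts = true := by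
  induction ts with
  | nil => rfl
  | cons t ts ih =>
    rw [okT, Bool.and_eq_true, Bool.and_eq_true, Nat.beq_eq]
    refine ⟨⟨hd t (by simp), ?_⟩, ih (fun t' h' => h t' (by simp [h'])) (fun t' h' => hd t' (by simp [h']))⟩
    have h1 : TG m t := h t (by simp)
    unfold TG at h1
    have h2 : m % t.1 = ((r % t.1 : ℕ) : ℤ) := by
      push_cast
      rw [← hr, Int.emod_emod_of_dvd]
      exact_mod_cast Nat.dvd_of_mod_eq_zero (hd t (by simp))
    rw [h2, Int.toNat_natCast] at h1
    exact h1

/-- the product of the stages, with divisibility of the orders -/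
def wf : List (ℕ × List (ℕ × ℕ)) → ℕ → Bool
  | [], _ => true
  | s :: rest, n => frc (n * s.1) fun n' => Nat.blt 0 n' && s.2.all (fun t => Nat.beq (n' % t.1) 0) && wf rest n'

def tot : List (ℕ × List (ℕ × ℕ)) → ℕ → ℕ
  | [], n => n
  | s :: rest, n => tot rest (n * s.1)

theorem go_sound (f : ℕ → Bool) {m : ℤ} (ss : List (ℕ × List (ℕ × ℕ))) : ∀ (n r : ℕ), 0 < n →
    m % n = r → wf ss n = true → (∀ s ∈ ss, ∀ t ∈ s.2, TG m t) → go f ss n r = true →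
    f (m % tot ss n).toNat = true := by
  induction ss with
  | nil =>
    intro n r hn hr _ _ hg
    simp only [tot]; rw [hr]; simpa [go] using hg
  | cons s rest ih =>
    intro n r hn hr hw ht hg
    simp only [wf, frc_eq, Bool.and_eq_true] at hw
    obtain ⟨⟨w1, w2⟩, w3⟩ := hw
    have w1 : 0 < n * s.1 := by simpa using w1
    simp only [go, frc_eq, List.all_eq_true, List.mem_range] at hg
    have hs : 0 < s.1 := Nat.pos_of_mul_pos_left w1
    have hq0 : 0 ≤ m / n % s.1 := Int.emod_nonneg _ (by omega)
    have hq1 : m / n % s.1 < s.1 := Int.emod_lt_of_pos _ (by omega)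
    obtain ⟨c, hc⟩ := Int.eq_ofNat_of_zero_le hq0
    have hg' := hg c (by omega)
    have hr' : m % ((n * s.1 : ℕ) : ℤ) = ((r + n * c : ℕ) : ℤ) := by
      have a1 : m = n * (m / n) + r := by rw [← hr]; exact (Int.mul_ediv_add_emod m n).symm
      have a2 : m / n = s.1 * (m / n / s.1) + c := by
        have := (Int.mul_ediv_add_emod (m / n) s.1).symm
        rw [hc] at this; exact this
      have hrn : (r : ℤ) < n := by rw [← hr]; exact Int.emod_lt_of_pos _ (by exact_mod_cast hn)
      have hcl : (c : ℤ) + 1 ≤ s.1 := by rw [hc] at hq1; simpa using hq1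
      have a3 : m = ((r + n * c : ℕ) : ℤ) + ((n * s.1 : ℕ) : ℤ) * (m / n / s.1) := by
        push_cast; linear_combination a1 + (n : ℤ) * a2
      rw [a3, Int.add_mul_emod_self_left]
      apply Int.emod_eq_of_lt (by positivity)
      push_cast; nlinarith
    rw [okT_fail hr' (fun t h => ht s (by simp) t h)
      (fun t h => by simpa using (List.all_eq_true.mp w2) t h)] at hg'
    simp only [Bool.not_true, Bool.false_or] at hg'
    exact ih _ _ w1 hr' w3 (fun s' h' => ht s' (by simp [h'])) hg'

theorem good_tests {m : ℤ} (hm : Good m) : ∀ s ∈ stages, ∀ t ∈ s.2, TG m t := by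
  simp only [stages, List.forall_mem_cons, List.not_mem_nil, IsEmpty.forall_iff, implies_true, and_true, true_and]
  refine ⟨@chk_good 53 _ _ ⟨by norm_num⟩ chk53 _ hm,
    ⟨@chk_good 5 _ _ ⟨by norm_num⟩ chk5 _ hm,
     @chk_good 17 _ _ ⟨by norm_num⟩ chk17 _ hm,
     @chk_good 223 _ _ ⟨by norm_num⟩ chk223 _ hm,
     @chk_good 347 _ _ ⟨by norm_num⟩ chk347 _ hm⟩,
    ⟨@chk_good 19 _ _ ⟨by norm_num⟩ chk19 _ hm,
     @chk_good 37 _ _ ⟨by norm_num⟩ chk37 _ hm,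
     @chk_good 101 _ _ ⟨by norm_num⟩ chk101 _ hm,
     @chk_good 271 _ _ ⟨by norm_num⟩ chk271 _ hm,
     @chk_good 317 _ _ ⟨by norm_num⟩ chk317 _ hm⟩,
    @chk_good 11 _ _ ⟨by norm_num⟩ chk11 _ hm,
    ⟨@chk_good 43 _ _ ⟨by norm_num⟩ chk43 _ hm,
     @chk_good 67 _ _ ⟨by norm_num⟩ chk67 _ hm⟩,
    ⟨@chk_good 59 _ _ ⟨by norm_num⟩ chk59 _ hm,
     @chk_good 281 _ _ ⟨by norm_num⟩ chk281 _ hm,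
     @chk_good 1583 _ _ ⟨by norm_num⟩ chk1583 _ hm⟩,
    ⟨@chk_good 457 _ _ ⟨by norm_num⟩ chk457 _ hm,
     @chk_good 1279 _ _ ⟨by norm_num⟩ chk1279 _ hm⟩,
    ⟨@chk_good 113 _ _ ⟨by norm_num⟩ chk113 _ hm,
     @chk_good 127 _ _ ⟨by norm_num⟩ chk127 _ hm,
     @chk_good 359 _ _ ⟨by norm_num⟩ chk359 _ hm⟩,
    @chk_good 613 _ _ ⟨by norm_num⟩ chk613 _ hm,
    ⟨@chk_good 283 _ _ ⟨by norm_num⟩ chk283 _ hm,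
     @chk_good 367 _ _ ⟨by norm_num⟩ chk367 _ hm,
     @chk_good 853 _ _ ⟨by norm_num⟩ chk853 _ hm⟩,
    ⟨@chk_good 71 _ _ ⟨by norm_num⟩ chk71 _ hm,
     @chk_good 97 _ _ ⟨by norm_num⟩ chk97 _ hm,
     @chk_good 109 _ _ ⟨by norm_num⟩ chk109 _ hm,
     @chk_good 173 _ _ ⟨by norm_num⟩ chk173 _ hm,
     @chk_good 383 _ _ ⟨by norm_num⟩ chk383 _ hm,
     @chk_good 479 _ _ ⟨by norm_num⟩ chk479 _ hm,
     @chk_good 631 _ _ ⟨by norm_num⟩ chk631 _ hm,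
     @chk_good 1579 _ _ ⟨by norm_num⟩ chk1579 _ hm,
     @chk_good 4297 _ _ ⟨by norm_num⟩ chk4297 _ hm⟩,
    ⟨@chk_good 41 _ _ ⟨by norm_num⟩ chk41 _ hm,
     @chk_good 83 _ _ ⟨by norm_num⟩ chk83 _ hm,
     @chk_good 167 _ _ ⟨by norm_num⟩ chk167 _ hm,
     @chk_good 401 _ _ ⟨by norm_num⟩ chk401 _ hm,
     @chk_good 683 _ _ ⟨by norm_num⟩ chk683 _ hm⟩,
    ⟨@chk_good 227 _ _ ⟨by norm_num⟩ chk227 _ hm,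
     @chk_good 263 _ _ ⟨by norm_num⟩ chk263 _ hm,
     @chk_good 1193 _ _ ⟨by norm_num⟩ chk1193 _ hm,
     @chk_good 1499 _ _ ⟨by norm_num⟩ chk1499 _ hm,
     @chk_good 2903 _ _ ⟨by norm_num⟩ chk2903 _ hm⟩⟩

theorem sieve {m : ℤ} (hm : Good m) : (237837600 ∣ m) ∨ (951350400 ∣ m - 2) ∨ (951350400 ∣ m + 2) ∨
    (475675200 ∣ m - 1) ∨ (475675200 ∣ m + 1) := by
  have h := go_sound fin11 stages 1 0 (by norm_num) (by simp [Int.emod_one]) (by decide +kernel) (good_tests hm) go_stages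
  have h2 : tot stages 1 = 951350400 := by decide +kernel
  rw [h2] at h
  unfold fin11 at h
  simp only [Bool.or_eq_true, Nat.beq_eq] at h
  omega

end Q13


namespace Q13

/-- Jacobi symbol with respect to the absolute value of `b` -/
def Ks (a b : ℤ) : ℤ := jacobiSym a b.natAbs

theorem K_mul (a a' b : ℤ) : Ks (a * a') b = Ks a b * Ks a' b := jacobiSym.mul_left _ _ _

theorem K_mul_right (a : ℤ) {b b' : ℤ} (hb : b ≠ 0) (hb' : b' ≠ 0) :
    Ks a (b * b') = Ks a b * Ks a b' := by
  unfold Ks; rw [Int.natAbs_mul]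
  haveI : NeZero b.natAbs := ⟨by simpa using hb⟩
  haveI : NeZero b'.natAbs := ⟨by simpa using hb'⟩
  exact jacobiSym.mul_right _ _ _

theorem K_mod {a a' b : ℤ} (h : b ∣ a - a') : Ks a b = Ks a' b := by
  apply jacobiSym.mod_left'
  have : ((b.natAbs : ℕ) : ℤ) ∣ a - a' := by rwa [Int.natCast_natAbs, abs_dvd]
  exact ((Int.modEq_iff_dvd).mpr this).symm

theorem K_one (b : ℤ) : Ks 1 b = 1 := jacobiSym.one_left _

theorem K_sq_one {a b : ℤ} (h : IsCoprime a b) : Ks (a ^ 2) b = 1 := by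
  unfold Ks
  apply jacobiSym.sq_one'
  rw [Int.gcd, Int.natAbs_natCast]
  exact Int.isCoprime_iff_gcd_eq_one.mp h

theorem K_sq {a b : ℤ} (h : IsCoprime a b) : Ks a b * Ks a b = 1 := by
  rw [← K_mul, ← pow_two]; exact K_sq_one h

theorem K_sq_mul {a b : ℤ} (c : ℤ) (h : IsCoprime a b) : Ks (a ^ 2 * c) b = Ks c b := by
  rw [K_mul, K_sq_one h, one_mul]

theorem K_natAbs {a b : ℤ} (hb : Odd b) (ha : a % 4 = 1) (ha0 : 0 < a) : Ks a b = Ks b a := by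
  unfold Ks
  obtain ⟨n, rfl⟩ := Int.eq_ofNat_of_zero_le ha0.le
  have hn : n % 4 = 1 := by omega
  have h1 : Odd b.natAbs := Int.natAbs_odd.mpr hb
  have h2 := jacobiSym.quadratic_reciprocity_one_mod_four hn h1
  simp only [Int.natAbs_natCast]
  rw [h2]
  rcases Int.natAbs_eq b with h | h
  · rw [← h]
  · conv_rhs => rw [h]
    rw [jacobiSym.neg _ (Nat.odd_iff.mpr (by omega)), ZMod.χ₄_nat_one_mod_four hn, one_mul]

/-- reciprocity, one of the two entries positive -/
theorem K_rec {a b : ℤ} (ha : a % 4 = 1) (hb : Odd b) (h : 0 < a ∨ 0 < b) : Ks a b = Ks b a := by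
  rcases lt_or_ge 0 a with h0 | h0
  · exact K_natAbs hb ha h0
  have hb0 : 0 < b := by
    rcases h with h | h
    · omega
    · exact h
  have ha1 : Odd a := Int.odd_iff.mpr (by omega)
  unfold Ks
  obtain ⟨n, rfl⟩ := Int.eq_ofNat_of_zero_le hb0.le
  have hn : Odd n := by exact_mod_cast hb
  obtain ⟨k, hk⟩ : ∃ k : ℕ, a = -(k : ℤ) := ⟨a.natAbs, by omega⟩
  have hk3 : k % 4 = 3 := by omega
  subst hk
  simp only [Int.natAbs_natCast, Int.natAbs_neg]
  rw [jacobiSym.neg _ hn]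
  have hn4 := Nat.odd_mod_four_iff.mp (Nat.odd_iff.mp hn)
  rcases hn4 with h4 | h4
  · rw [ZMod.χ₄_nat_one_mod_four h4, one_mul, ← jacobiSym.quadratic_reciprocity_one_mod_four h4 (Nat.odd_iff.mpr (by omega))]
  · rw [ZMod.χ₄_nat_three_mod_four h4, jacobiSym.quadratic_reciprocity_three_mod_four hk3 h4]; ring

theorem K_neg_one {b : ℤ} (hb : b % 4 = 1) : Ks (-1) b = if 0 < b then 1 else -1 := by
  unfold Ks
  have h1 : Odd b.natAbs := Int.natAbs_odd.mpr (Int.odd_iff.mpr (by omega))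
  rw [jacobiSym.at_neg_one h1]
  split_ifs with h
  · exact ZMod.χ₄_nat_one_mod_four (by omega)
  · exact ZMod.χ₄_nat_three_mod_four (by omega)

/-- reciprocity, both negative -/
theorem K_rec_neg {a b : ℤ} (ha : a % 4 = 1) (hb : b % 4 = 1) (h : a < 0) (h' : b < 0) :
    Ks a b = - Ks b a := by
  have h1 : Ks (-a) b = Ks b (-a) := by
    have := K_rec (a := b) (b := -a) hb (Int.odd_iff.mpr (by omega)) (Or.inr (by omega))
    exact this.symm
  have h2 : Ks b (-a) = Ks b a := by unfold Ks; rw [Int.natAbs_neg]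
  rw [h2, show -a = -1 * a by ring, K_mul, K_neg_one hb, if_neg (by omega)] at h1
  linarith

theorem K_two {b : ℤ} (hb : b % 8 = 1) : Ks 2 b = 1 := by
  unfold Ks
  have h1 : Odd b.natAbs := Int.natAbs_odd.mpr (Int.odd_iff.mpr (by omega))
  rw [jacobiSym.at_two h1, ZMod.χ₈_nat_eq_if_mod_eight]
  have : b.natAbs % 8 = 1 ∨ b.natAbs % 8 = 7 := by omega
  rcases this with h | h <;> simp [h] <;> omega

theorem K_ne_of_sq {a b : ℤ} 
    (h : ∀ p : ℕ, p.Prime → (p : ℤ) ∣ b → IsSquare (a : ZMod p)) : Ks a b ≠ -1 := by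
  intro h0
  unfold Ks at h0
  obtain ⟨p, hp, hpd, hJ⟩ := jacobiSym.eq_neg_one_at_prime_divisor_of_eq_neg_one h0
  have := h p hp (by rw [← Int.natAbs_dvd_natAbs]; simpa using hpd)
  exact ZMod.nonsquare_of_jacobiSym_eq_neg_one hJ this

theorem K_val {a b : ℤ} (h : IsCoprime a b) : Ks a b = 1 ∨ Ks a b = -1 := by
  have := K_sq h
  have h2 : (Ks a b - 1) * (Ks a b + 1) = 0 := by linear_combination this
  rcases mul_eq_zero.mp h2 with h | h
  · left; linarith
  · right; linarith

/-- managed primes -/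
theorem K_odd {n X b s : ℤ} {k : ℕ} (hn : Odd n) (hn0 : 0 < n) (hXn : n ∣ X ^ 3 - s ^ 2) (hs : IsCoprime X n)
    (hb : b % 4 = 1) (hbn : n ∣ b - X ^ k) : Ks n b = 1 := by
  have h1 : Ks n b = Ks b n := (K_rec hb hn (Or.inr hn0)).symm
  rw [h1, K_mod hbn]
  have hs' : IsCoprime s n := by
    have h2 : IsCoprime (X ^ 3) n := hs.pow_left
    obtain ⟨d, hd⟩ := hXn
    have h3 : IsCoprime (s ^ 2) n := by
      have h4 : s ^ 2 = X ^ 3 + n * (-d) := by linear_combination -hd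
      rw [h4]; exact h2.add_mul_left_left _
    exact (IsCoprime.pow_left_iff (by norm_num)).mp h3
  have h3 : Ks (X ^ 3) n = 1 := by rw [K_mod hXn]; exact K_sq_one hs'
  have h4 : Ks X n = 1 := by
    have e : X ^ 3 = X ^ 2 * X := by ring
    rw [e, K_sq_mul _ hs] at h3; exact h3
  induction k with
  | zero => simpa using K_one n
  | succ k ih =>
    clear hbn ih
    induction k with
    | zero => simpa using h4
    | succ k ih => rw [pow_succ, K_mul, ih, h4]; rfl

/-- the sign-careful reciprocity chain -/
theorem chain12 {M g l1 l0 γ Γ V Z k1 k0 I f u1 u2 : ℤ}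
    (hW : Z ^ 2 = I * V)
    (H1 : (-V) * (-(k1 * γ)) * (k0 * l0) ^ 2 - V * Γ * (k0 * l0) * (k1 * l1) + g * (k1 * l1) ^ 2 = (k1 * γ) ^ 2 * M)
    (H2 : k1 * l1 = -V * Γ ^ 2 + γ * u1)
    (H3 : -(k0 * l0) = f * V * (k1 * γ) ^ 2 + g * u2)
    (cM : M % 8 = 1) (cg : g % 8 = 1) (c1 : l1 % 8 = 1) (c0 : l0 % 8 = 1) (cγ : γ % 8 = 1)
    (K1M : Ks k1 M = 1) (K0M : Ks k0 M = 1) (K1l : Ks k1 l1 = 1) (KIl : Ks I l1 = 1) (K1γ : Ks k1 γ = 1)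
    (KIγ : Ks I γ = 1) (K0g : Ks k0 g = 1) (KIg : Ks I g = 1)
    (p1 : IsCoprime k1 l1) (p2 : IsCoprime γ l1) (p3 : IsCoprime l0 l1) (p3' : IsCoprime k0 l1)
    (p4 : IsCoprime Z l1) (p5 : IsCoprime Z γ) (p6 : IsCoprime Γ γ) (p7 : IsCoprime k1 l0)
    (p8 : IsCoprime γ l0) (p9 : IsCoprime Z g) (p10 : IsCoprime γ g) (p11 : IsCoprime k1 g)
    (s1 : 0 < l1 → 0 < γ) (s2 : 0 < l0 → 0 < g) (s3 : M < 0 → l0 < 0) (s4 : M < 0 → l1 < 0) :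
    Ks (k0 * k1 * l0 * l1) M = Ks f g := by
  have n1 : ∀ z : ℤ, z % 8 = 1 → z % 4 = 1 := fun z h => by omega
  have n2 : ∀ z : ℤ, z % 8 = 1 → Odd z := fun z h => Int.odd_iff.mpr (by omega)
  have n3 : ∀ z : ℤ, z % 8 = 1 → z ≠ 0 := fun z h => by rintro rfl; simp at h
  -- general: symbol of V equals symbol of I
  have hKV : ∀ b : ℤ, IsCoprime Z b → Ks I b = 1 → Ks V b = 1 := by
    intro b hb hb1
    have h := K_sq_one hb
    rw [hW, K_mul, hb1, one_mul] at h; exact h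
  -- K(M, l1)
  have a1 : Ks M l1 = Ks γ l1 := by
    have e1 : Ks ((k1 * γ) ^ 2 * M) l1 = Ks ((k0 * l0) ^ 2 * (V * (k1 * γ))) l1 := by
      apply K_mod
      exact ⟨-V * Γ * (k0 * l0) * k1 + g * k1 ^ 2 * l1, by linear_combination -H1⟩
    rw [K_sq_mul _ (p1.mul_left p2), K_sq_mul _ (p3'.mul_left p3), K_mul, K_mul, hKV _ p4 KIl, K1l] at e1
    rw [e1]; ring
  have a2 : Ks l1 γ = Ks (-1) γ := by
    have e1 : Ks (k1 * l1) γ = Ks (Γ ^ 2 * (-1 * V)) γ := by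
      apply K_mod; exact ⟨u1, by linear_combination H2⟩
    rw [K_mul, K1γ, one_mul, K_sq_mul _ p6, K_mul, hKV _ p5 KIγ, mul_one] at e1
    exact e1
  have a3 : Ks M l1 = 1 := by
    rw [a1]
    rcases lt_or_ge 0 γ with h | h
    · rw [K_rec (n1 _ cγ) (n2 _ c1) (Or.inl h), a2, K_neg_one (n1 _ cγ), if_pos h]
    · have h' : γ < 0 := lt_of_le_of_ne h (n3 _ cγ)
      have hl : l1 < 0 := by
        by_contra hc
        have : 0 < l1 := lt_of_le_of_ne (not_lt.mp hc) (Ne.symm (n3 _ c1))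
        have := s1 this; omega
      rw [K_rec_neg (n1 _ cγ) (n1 _ c1) h' hl, a2, K_neg_one (n1 _ cγ), if_neg (by omega)]; norm_num
  have b1 : Ks M l0 = Ks g l0 := by
    have e1 : Ks ((k1 * γ) ^ 2 * M) l0 = Ks ((k1 * l1) ^ 2 * g) l0 := by
      apply K_mod
      exact ⟨V * k1 * γ * k0 ^ 2 * l0 - V * Γ * k0 * (k1 * l1), by linear_combination -H1⟩
    rwa [K_sq_mul _ (p7.mul_left p8), K_sq_mul _ (p7.mul_left p3.symm)] at e1
  have b2 : Ks l0 g = Ks (-1) g * Ks f g := by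
    have e1 : Ks (-1 * (k0 * l0)) g = Ks ((k1 * γ) ^ 2 * (f * V)) g := by
      apply K_mod; exact ⟨u2, by linear_combination H3⟩
    rw [K_mul, K_mul, K0g, one_mul, K_sq_mul _ (p11.mul_left p10), K_mul, hKV _ p9 KIg, mul_one] at e1
    rw [← e1, ← mul_assoc, ← K_mul]; norm_num [K_one]
  have b3 : Ks M l0 = Ks f g := by
    rw [b1]
    rcases lt_or_ge 0 g with h | h
    · rw [K_rec (n1 _ cg) (n2 _ c0) (Or.inl h), b2, K_neg_one (n1 _ cg), if_pos h, one_mul]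
    · have h' : g < 0 := lt_of_le_of_ne h (n3 _ cg)
      have hl : l0 < 0 := by
        by_contra hc
        have : 0 < l0 := lt_of_le_of_ne (not_lt.mp hc) (Ne.symm (n3 _ c0))
        have := s2 this; omega
      rw [K_rec_neg (n1 _ cg) (n1 _ c0) h' hl, b2, K_neg_one (n1 _ cg), if_neg (by omega)]; ring
  rw [show k0 * k1 * l0 * l1 = k0 * (k1 * (l0 * l1)) by ring, K_mul, K_mul, K_mul, K0M, K1M, one_mul, one_mul]
  rcases lt_or_ge 0 M with h | h
  · rw [K_rec (n1 _ c0) (n2 _ cM) (Or.inr h), K_rec (n1 _ c1) (n2 _ cM) (Or.inr h), a3, b3, mul_one]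
  · have h' : M < 0 := lt_of_le_of_ne h (n3 _ cM)
    rw [K_rec_neg (n1 _ c0) (n1 _ cM) (s3 h') h', K_rec_neg (n1 _ c1) (n1 _ cM) (s4 h') h', a3, b3]; ring

end Q13


namespace Q13

/-- numerator of the `y`-coordinate of the double -/
def Mf (X W : ℤ) : ℤ := X ^ 6 - 2 * X ^ 5 * W + 20 * X ^ 3 * W ^ 3 - 20 * X ^ 2 * W ^ 4 + 8 * X * W ^ 5 - 8 * W ^ 6

section
variable {p : ℕ} [Fact p.Prime] [NeZero (2 : ZMod p)]

theorem half_pt {c X Z Y : ℤ} (h : IF c X Z Y) (h23 : 23 ∣ Z) (hp : (p : ℤ) ∣ Mf X (Z ^ 2)) :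
    (Z : ZMod p) ≠ 0 ∧ ∃ θ : ZMod p, IsPt (c • (G : (E (ZMod p)).Point)) (X / Z ^ 2) (Y / Z ^ 3) ∧
      IsPt (c • (G : (E (ZMod p)).Point) + c • G) θ 0 ∧ θ ^ 3 - θ ^ 2 + 1 = 0 ∧
      ((X : ZMod p) / Z ^ 2) ^ 2 - 2 * θ * (X / Z ^ 2) + 2 * θ - 2 * θ ^ 2 = 0 := by
  have hM : ((Mf X (Z ^ 2) : ℤ) : ZMod p) = 0 := (ZMod.intCast_zmod_eq_zero_iff_dvd _ _).mpr hp
  unfold Mf at hM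
  push_cast at hM
  have hZ : (Z : ZMod p) ≠ 0 := by
    intro h0
    have h1 := cop_zmod h.cop h0
    rw [h0] at hM
    apply pow_ne_zero 6 h1
    linear_combination hM
  have hP := h.red_ne hZ
  refine ⟨hZ, ?_⟩
  set x : ZMod p := X / Z ^ 2 with hx
  set y : ZMod p := Y / Z ^ 3 with hy
  have hMx : x ^ 6 - 2 * x ^ 5 + 20 * x ^ 3 - 20 * x ^ 2 + 8 * x - 8 = 0 := by
    have : x * Z ^ 2 = X := by rw [hx]; field_simp
    rw [← this] at hM
    have h2 : ((Z : ZMod p) ^ 12) * (x ^ 6 - 2 * x ^ 5 + 20 * x ^ 3 - 20 * x ^ 2 + 8 * x - 8) = 0 := by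
      linear_combination hM
    exact (mul_eq_zero.mp h2).resolve_left (pow_ne_zero _ hZ)
  have hE := hP.eq
  have hy0 : y ≠ 0 := by
    intro h0
    have h1 : (529 : ZMod p) = 0 := by
      linear_combination (-20 - 7 * x - 2 * x ^ 2) * hMx - (369+104*x+9*x^2+11*x^3+5*x^4+2*x^5) * hE
        + (369+104*x+9*x^2+11*x^3+5*x^4+2*x^5) * y * h0
    have h2 : (23 : ZMod p) = 0 := by
      have : (23 : ZMod p) ^ 2 = 0 := by linear_combination h1
      exact pow_eq_zero_iff (two_ne_zero) |>.mp this
    obtain ⟨k, hk⟩ := h23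
    apply hZ; rw [hk]; push_cast; rw [h2, zero_mul]
  have h2 : (2 : ZMod p) ≠ 0 := NeZero.ne _
  have h4 : (4 : ZMod p) ≠ 0 := by
    have : (4 : ZMod p) = 2 * 2 := by norm_num
    rw [this]; exact mul_ne_zero h2 h2
  have h8 : (8 : ZMod p) ≠ 0 := by
    have : (8 : ZMod p) = 2 * 4 := by norm_num
    rw [this]; exact mul_ne_zero h2 h4
  obtain ⟨s, hs⟩ : ∃ s : ZMod p, s * (2 * y) = 3 * x ^ 2 - 2 * x := ⟨(3 * x ^ 2 - 2 * x) / (2 * y), by field_simp⟩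
  set θ := s ^ 2 + 1 - 2 * x with hθ
  have hθ4 : 4 * y ^ 2 * θ = x ^ 4 - 8 * x + 4 := by
    rw [hθ]; linear_combination (s * (2 * y) + (3 * x ^ 2 - 2 * x)) * hs + 4 * (1 - 2 * x) * hE
  have hy3 : (0 : ZMod p) = -(s * (θ - x) + y) := by
    have : (8 * y ^ 3) * (s * (θ - x) + y) = 0 := by
      linear_combination -hMx + 4 * y ^ 2 * (θ - x) * hs + (3 * x ^ 2 - 2 * x) * hθ4
        + (-4 * x * (3 * x ^ 2 - 2 * x) + 8 * y ^ 2 + 8 * (x ^ 3 - x ^ 2 + 1)) * hE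
    have := (mul_eq_zero.mp this).resolve_left (mul_ne_zero h8 (pow_ne_zero _ hy0))
    rw [this]; ring
  have hT := hP.dbl (mul_ne_zero h2 hy0) hs hθ hy3
  have hg : θ ^ 3 - θ ^ 2 + 1 = 0 := by linear_combination -hT.eq
  refine ⟨θ, hP, hT, hg, ?_⟩
  have : (x ^ 2 - 2 * θ * x + 2 * θ - 2 * θ ^ 2) ^ 2 = 0 := by
    linear_combination (-4 + 8 * x + 4 * θ) * hg - hθ4 + 4 * θ * hE
  exact pow_eq_zero_iff (two_ne_zero) |>.mp this

/-- the value of `q` at the point -/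
theorem good_sq {m a e u s : ℤ} (hI : IF m a e u)
    (hs : s ^ 2 = 4 * a ^ 4 - 7 * a ^ 3 * e ^ 2 + 7 * a ^ 2 * e ^ 4 - 4 * a * e ^ 6 + e ^ 8)
    {x y : ZMod p} (h : IsPt (m • (G : (E (ZMod p)).Point)) x y) :
    IsSquare (4 * x ^ 4 - 7 * x ^ 3 + 7 * x ^ 2 - 4 * x + 1) := by
  have he : (e : ZMod p) ≠ 0 := by
    intro he
    rcases hI.red (p := p) with ⟨-, h0⟩ | ⟨h0, -⟩
    · exact h.ne_zero h0
    · exact h0 he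
  have hx := (h.inj (hI.red_ne he)).1
  have hs' : (s : ZMod p) ^ 2 = 4 * a ^ 4 - 7 * a ^ 3 * e ^ 2 + 7 * a ^ 2 * e ^ 4 - 4 * a * e ^ 6 + e ^ 8 := by
    exact_mod_cast congrArg (Int.cast : ℤ → ZMod p) hs
  refine ⟨s / e ^ 4, ?_⟩
  rw [hx]; field_simp; linear_combination -hs'

theorem odd_two_tors {T : (E (ZMod p)).Point} (h : T + T = 0) (t : ℤ) : (2 * t + 1) • T = T := by
  rw [add_zsmul, mul_comm, mul_zsmul, two_zsmul, h, zsmul_zero, zero_add, one_zsmul]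

theorem neg_T {T : (E (ZMod p)).Point} {θ : ZMod p} (h : IsPt T θ 0) : T + T = 0 := by
  have h2 := h.neg
  rw [neg_zero] at h2
  have := h.uniq h2
  nth_rewrite 2 [this]; simp

theorem case0 {c X Z Y m a e u s t : ℤ} (h : IF c X Z Y) (h23 : 23 ∣ Z) (hp : (p : ℤ) ∣ Mf X (Z ^ 2))
    (hI : IF m a e u)
    (hs : s ^ 2 = 4 * a ^ 4 - 7 * a ^ 3 * e ^ 2 + 7 * a ^ 2 * e ^ 4 - 4 * a * e ^ 6 + e ^ 8)
    (hm : m = c * (2 * t + 1)) :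
    IsSquare (((4 * X ^ 4 - 7 * X ^ 3 * Z ^ 2 + 7 * X ^ 2 * Z ^ 4 - 4 * X * Z ^ 6 + Z ^ 8 : ℤ) : ZMod p)) := by
  obtain ⟨hZ, θ, hP, hT, -, -⟩ := half_pt h h23 hp
  have h4 := neg_T hT
  have hmG : IsPt (m • (G : (E (ZMod p)).Point)) (X / Z ^ 2) (Y / Z ^ 3) ∨
      IsPt (m • (G : (E (ZMod p)).Point)) (X / Z ^ 2) (-(Y / Z ^ 3)) := by
    have e1 : m • (G : (E (ZMod p)).Point) = t • (c • G + c • G) + c • G := by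
      rw [hm, mul_comm, mul_zsmul, add_zsmul, mul_comm 2 t, mul_zsmul, two_zsmul, one_zsmul]
    rcases Int.even_or_odd' t with ⟨k, hk | hk⟩
    · left
      have : t • (c • G + c • (G : (E (ZMod p)).Point)) = 0 := by
        rw [hk, mul_comm, mul_zsmul, two_zsmul, h4, zsmul_zero]
      rw [e1, this, zero_add]; exact hP
    · right
      have : t • (c • G + c • (G : (E (ZMod p)).Point)) = c • G + c • G := by
        rw [hk]; exact odd_two_tors h4 k
      have e2 : m • (G : (E (ZMod p)).Point) = - (c • G) := by
        rw [e1, this]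
        have := h4
        rw [eq_neg_iff_add_eq_zero, ← this]; abel
      rw [e2]; exact hP.neg
  have : IsSquare (4 * ((X : ZMod p) / Z ^ 2) ^ 4 - 7 * (X / Z ^ 2) ^ 3 + 7 * (X / Z ^ 2) ^ 2 - 4 * (X / Z ^ 2) + 1) := by
    rcases hmG with h | h
    · exact good_sq hI hs h
    · exact good_sq hI hs h
  obtain ⟨r, hr⟩ := this
  refine ⟨r * Z ^ 4, ?_⟩
  push_cast
  field_simp at hr
  linear_combination hr

theorem m_eq {c m k t : ℤ} (hm : m = k + 2 * c * (2 * t + 1))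
    (h4 : (c • (G : (E (ZMod p)).Point) + c • G) + (c • (G : (E (ZMod p)).Point) + c • G) = 0) :
    m • (G : (E (ZMod p)).Point) = k • G + (c • G + c • G) := by
  rw [hm, add_zsmul, mul_comm (2 * c), mul_zsmul, mul_comm 2 c, mul_zsmul _ c 2, smul_comm c (2 : ℤ), two_zsmul (c • (G : (E (ZMod p)).Point)),
    odd_two_tors h4]

theorem case1 {c X Z Y m a e u s t : ℤ} (h : IF c X Z Y) (h23 : 23 ∣ Z) (hp : (p : ℤ) ∣ Mf X (Z ^ 2))
    (hI : IF m a e u)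
    (hs : s ^ 2 = 4 * a ^ 4 - 7 * a ^ 3 * e ^ 2 + 7 * a ^ 2 * e ^ 4 - 4 * a * e ^ 6 + e ^ 8)
    (hm : m = 1 + 2 * c * (2 * t + 1)) :
    IsSquare ((((44 * X ^ 3 - 246 * X ^ 2 * Z ^ 2 + 164 * X * Z ^ 4 - 88 * Z ^ 6) *
      (3230 * X ^ 3 - 6444 * X ^ 2 * Z ^ 2 + 4296 * X * Z ^ 4 - 6460 * Z ^ 6) : ℤ) : ZMod p)) := by
  obtain ⟨hZ, θ, hP, hT, hg, hb⟩ := half_pt h h23 hp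
  have h4 := neg_T hT
  have hmG := m_eq hm h4
  have hθ0 : θ ≠ 0 := by rintro rfl; simp at hg
  have hsum : IsPt (m • (G : (E (ZMod p)).Point)) (2 - 2 * θ) (-(-(1 / θ) * (2 - 2 * θ) + 1)) := by
    rw [hmG, one_zsmul]
    refine isPt_G.add hT (Ne.symm hθ0) (s := -(1 / θ)) ?_ ?_ ?_
    · field_simp; ring
    · field_simp; linear_combination -hg
    · ring
  obtain ⟨r, hr⟩ := good_sq hI hs hsum
  set x : ZMod p := X / Z ^ 2 with hx
  have e1 : (38 - 19 * θ - 22 * θ ^ 2) = (r * (1 + θ - θ ^ 2)) ^ 2 := by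
    linear_combination (-(127 + 149 * θ - 308 * θ ^ 2 + 108 * θ ^ 3) - (1 + θ - θ ^ 2) ^ 2 * (-136 + 64 * θ)) * hg
      + (1 + θ - θ ^ 2) ^ 2 * hr
  have e2 : (44 * x ^ 3 - 246 * x ^ 2 + 164 * x - 88) * (38 - 19 * θ - 22 * θ ^ 2) =
     3230 * x ^ 3 - 6444 * x ^ 2 + 4296 * x - 6460 := by
    linear_combination (-968 - 1558 * x + (1558 - 836 * x) * θ + (1804 - 968 * x) * θ ^ 2) * hb
     + (3116 + 1936 * x - 1936 * x ^ 2 + (3608 - 1936 * x) * θ) * hg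
  have e3 : (X : ZMod p) = x * Z ^ 2 := by rw [hx]; field_simp
  refine ⟨r * (1 + θ - θ ^ 2) * (44 * x ^ 3 - 246 * x ^ 2 + 164 * x - 88) * Z ^ 6, ?_⟩
  push_cast
  rw [e3]
  linear_combination (-(44 * x ^ 3 - 246 * x ^ 2 + 164 * x - 88) * Z ^ 12) * e2
    + ((44 * x ^ 3 - 246 * x ^ 2 + 164 * x - 88) ^ 2 * Z ^ 12) * e1

theorem case2 {c X Z Y m a e u s t : ℤ} (h : IF c X Z Y) (h23 : 23 ∣ Z) (hp : (p : ℤ) ∣ Mf X (Z ^ 2))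
    (hI : IF m a e u)
    (hs : s ^ 2 = 4 * a ^ 4 - 7 * a ^ 3 * e ^ 2 + 7 * a ^ 2 * e ^ 4 - 4 * a * e ^ 6 + e ^ 8)
    (hm : m = 2 + 2 * c * (2 * t + 1)) :
    IsSquare ((((40 * X ^ 3 - 384 * X ^ 2 * Z ^ 2 + 256 * X * Z ^ 4 - 80 * Z ^ 6) *
      (6472 * X ^ 3 - 5664 * X ^ 2 * Z ^ 2 + 3776 * X * Z ^ 4 - 12944 * Z ^ 6) : ℤ) : ZMod p)) := by
  obtain ⟨hZ, θ, hP, hT, hg, hb⟩ := half_pt h h23 hp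
  have h4 := neg_T hT
  have hmG := m_eq hm h4
  have hθ1 : 1 - θ ≠ 0 := by
    intro h0
    have : θ = 1 := by linear_combination -h0
    rw [this] at hg; simp at hg
  have h2G : IsPt ((2 : ℤ) • (G : (E (ZMod p)).Point)) 1 (-1) := by
    have := isPt_2Gp (p := p)
    rwa [← natCast_zsmul] at this
  have hsum : IsPt (m • (G : (E (ZMod p)).Point)) (-1 - 2 * θ + θ ^ 2)
      (-(-(1 / (1 - θ)) * (-1 - 2 * θ + θ ^ 2 - 1) + -1)) := by
    rw [hmG]
    refine h2G.add hT (sub_ne_zero.mp hθ1) (s := -(1 / (1 - θ))) ?_ ?_ ?_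
    · field_simp; ring
    · field_simp; linear_combination (θ - 2) * hg
    · ring
  obtain ⟨r, hr⟩ := good_sq hI hs hsum
  set x : ZMod p := X / Z ^ 2 with hx
  have e1 : (21 - 44 * θ - 20 * θ ^ 2) = (r * (2 - 3 * θ + 2 * θ ^ 2)) ^ 2 := by
    linear_combination (-(671 - 1268 * θ + 1148 * θ ^ 2 - 192 * θ ^ 3) - (2 - 3 * θ + 2 * θ ^ 2) ^ 2 *
       (-150 - 81 * θ + 51 * θ ^ 2 + 45 * θ ^ 3 - 28 * θ ^ 4 + 4 * θ ^ 5)) * hg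
      + (2 - 3 * θ + 2 * θ ^ 2) ^ 2 * hr
  have e2 : (40 * x ^ 3 - 384 * x ^ 2 + 256 * x - 80) * (21 - 44 * θ - 20 * θ ^ 2) =
     6472 * x ^ 3 - 5664 * x ^ 2 + 3776 * x - 12944 := by
    linear_combination (-800 - 5632 * x + (5632 - 1760 * x) * θ + (2560 - 800 * x) * θ ^ 2) * hb
     + (11264 + 1600 * x - 1600 * x ^ 2 + (5120 - 1600 * x) * θ) * hg
  have e3 : (X : ZMod p) = x * Z ^ 2 := by rw [hx]; field_simp
  refine ⟨r * (2 - 3 * θ + 2 * θ ^ 2) * (40 * x ^ 3 - 384 * x ^ 2 + 256 * x - 80) * Z ^ 6, ?_⟩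
  push_cast
  rw [e3]
  linear_combination (-(40 * x ^ 3 - 384 * x ^ 2 + 256 * x - 80) * Z ^ 12) * e2
    + ((40 * x ^ 3 - 384 * x ^ 2 + 256 * x - 80) ^ 2 * Z ^ 12) * e1

end

end Q13


namespace Q13

/-- the order of `G` modulo `p` divides `ord` -/
def chkO (p ord : ℕ) : Bool :=
  Nat.ble 3 ord && run p 0 1 (fun _ _ _ => true) (ord - 3) 2 1 (p - 1) 1

theorem IF.dvd_p {p ord : ℕ} (ho : chkO p ord = true) (hp : p.Prime) (h2 : 2 < p) {c X Z Y : ℤ} (h : IF c X Z Y)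
    (hc : (ord : ℤ) ∣ c) : (p : ℤ) ∣ Z := by
  haveI : Fact p.Prime := ⟨hp⟩
  haveI := nz2 hp h2
  unfold chkO at ho
  simp only [Bool.and_eq_true, Nat.ble_eq] at ho
  obtain ⟨h1, h7⟩ := ho
  have := (run_sound (by omega) (by omega) _ (by simpa using isPt_G) _ 2 1 (p - 1) 1 (by simp)
    (by rw [cast_sub' (by omega)]; simpa using isPt_2Gp) h7).1
  rw [show 2 + (ord - 3) + 1 = ord by omega] at this
  have h0 : c • (G : (E (ZMod p)).Point) = 0 := by
    obtain ⟨d, rfl⟩ := hc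
    rw [mul_comm, mul_zsmul, natCast_zsmul, this, zsmul_zero]
  exact (ZMod.intCast_zmod_eq_zero_iff_dvd _ _).mp (h.red_zero h0)

/-- double-and-add with given slopes -/
def lad (p N h1 h2 : ℕ) : List (Bool × ℕ) → ℕ → ℕ → ℕ → Bool
  | [], n, x, y => Nat.beq n N && Nat.beq x h1 && Nat.beq y h2
  | (false, s) :: l, n, x, y =>
    Nat.ble x p && Nat.ble y p && !(Nat.beq (2 * y % p) 0) && Nat.beq ((s * (2 * y)) % p) ((3 * x ^ 2 + 2 * (p - x)) % p) &&
      lad p N h1 h2 l (2 * n) ((s ^ 2 + 1 + 2 * (p - x)) % p)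
        ((s * (x + (p - (s ^ 2 + 1 + 2 * (p - x)) % p)) + (p - y)) % p)
  | (true, s) :: l, n, x, y =>
    Nat.ble x p && Nat.ble y p && !(Nat.beq (x % p) 0) && Nat.beq ((s * x + 1) % p) (y % p) &&
      lad p N h1 h2 l (n + 1) ((s ^ 2 + 1 + (p - x)) % p)
        ((s * (p - (s ^ 2 + 1 + (p - x)) % p) + (p - 1)) % p)

section
variable {p : ℕ} [Fact p.Prime]

theorem beq_mod2 {a b : ℕ} (h : Nat.beq (a % p) (b % p) = true) : (a : ZMod p) = b := by
  rw [Nat.beq_eq] at h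
  rw [← cast_mod a, h, cast_mod]

theorem lad_sound [NeZero (2 : ZMod p)] {N h1 h2 : ℕ} (l : List (Bool × ℕ)) : ∀ (n x y : ℕ),
    lad p N h1 h2 l n x y = true → IsPt (n • (G : (E (ZMod p)).Point)) x y →
    IsPt (N • (G : (E (ZMod p)).Point)) h1 h2 := by
  have hp1 : 1 ≤ p := (Fact.out : p.Prime).one_lt.le
  induction l with
  | nil =>
    intro n x y h hP
    unfold lad at h
    simp only [Bool.and_eq_true, Nat.beq_eq] at h
    obtain ⟨⟨rfl, rfl⟩, rfl⟩ := h
    exact hP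
  | cons a l ih =>
    intro n x y h hP
    obtain ⟨b, s⟩ := a
    cases b with
    | false =>
      unfold lad at h
      simp only [Bool.and_eq_true, Nat.ble_eq] at h
      obtain ⟨⟨⟨⟨a1, a2⟩, a3⟩, a4⟩, a5⟩ := h
      set x' := (s ^ 2 + 1 + 2 * (p - x)) % p with hx'
      have hxp : x' ≤ p := (Nat.mod_lt _ (by omega)).le
      have cx : (x' : ZMod p) = s ^ 2 + 1 - 2 * x := by
        rw [hx', cast_mod]; push_cast; rw [cast_sub' a1]; ring
      have b4 := beq_mod2 a4
      push_cast at b4; rw [cast_sub' a1] at b4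
      refine ih _ _ _ a5 ?_
      rw [two_mul, add_nsmul]
      refine hP.dbl ?_ (s := s) (by linear_combination b4) cx ?_
      · intro h0
        have : Nat.beq (2 * y % p) 0 = true := beq_mod.mpr (by push_cast; exact h0)
        rw [this] at a3; simp at a3
      · rw [cast_mod]; push_cast; rw [cast_sub' a2, cast_sub' hxp]; ring
    | true =>
      unfold lad at h
      simp only [Bool.and_eq_true, Nat.ble_eq] at h
      obtain ⟨⟨⟨⟨a1, a2⟩, a3⟩, a4⟩, a5⟩ := h
      set x' := (s ^ 2 + 1 + (p - x)) % p with hx'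
      have hxp : x' ≤ p := (Nat.mod_lt _ (by omega)).le
      have cx : (x' : ZMod p) = s ^ 2 + 1 - 0 - x := by
        rw [hx', cast_mod]; push_cast; rw [cast_sub' a1]; ring
      have b4 := beq_mod2 a4
      push_cast at b4
      refine ih _ _ _ a5 ?_
      rw [succ_nsmul, add_comm]
      refine isPt_G.add hP ?_ (s := s) (by linear_combination -b4) cx ?_
      · intro h0
        have : Nat.beq (x % p) 0 = true := beq_mod.mpr h0.symm
        rw [this] at a3; simp at a3
      · rw [cast_mod]; push_cast; rw [cast_sub' hxp, cast_sub' hp1]; push_cast; ring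

end

/-- Euler's criterion in two steps -/
def eul (p k1 k2 v : ℕ) : ℕ := ((v % p) ^ k1 % p) ^ k2 % p

/-- the test of the values of a binary quadratic form -/
def tt (p k1 k2 A B C mN mP n X Z : ℕ) : Bool :=
  (!(mN.testBit n) || Nat.beq (eul p k1 k2 (A * X ^ 2 + B * (X * Z) + C * Z ^ 2)) (p - 1)) &&
  (!(mP.testBit n) || Nat.beq (eul p k1 k2 (A * X ^ 2 + B * (X * Z) + C * Z ^ 2)) 1)

section
variable {p : ℕ} [Fact p.Prime]

theorem eul_pow {k1 k2 v : ℕ} (hk : k1 * k2 = p / 2) : (eul p k1 k2 v : ZMod p) = (v : ZMod p) ^ (p / 2) := by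
  unfold eul
  rw [cast_mod]; push_cast; rw [cast_mod]; push_cast; rw [cast_mod, ← pow_mul, hk]

theorem tt_sound {k1 k2 A B C mN mP n X Z : ℕ} (h2 : 2 < p) (hk : k1 * k2 = p / 2)
    (ht : tt p k1 k2 A B C mN mP n X Z = true) (hZ : (Z : ZMod p) ≠ 0) {x z : ℤ} (hz : (z : ZMod p) ≠ 0)
    (hx : (X : ZMod p) / Z = x / z ^ 2) {a b c : ℤ} (ha : (a : ZMod p) = A) (hb : (b : ZMod p) = B) (hc : (c : ZMod p) = C) :
    (mN.testBit n = true → Ks (a * x ^ 2 + b * x * z ^ 2 + c * z ^ 4) p = -1) ∧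
    (mP.testBit n = true → Ks (a * x ^ 2 + b * x * z ^ 2 + c * z ^ 4) p = 1) := by
  unfold tt at ht
  set v := A * X ^ 2 + B * (X * Z) + C * Z ^ 2 with hv
  have hv1 : (v : ZMod p) * (z ^ 2 / Z) ^ 2 = ((a * x ^ 2 + b * x * z ^ 2 + c * z ^ 4 : ℤ) : ZMod p) := by
    have hX : (X : ZMod p) = x / z ^ 2 * Z := by rw [← hx]; field_simp
    rw [hv]; push_cast; rw [hX, ha, hb, hc]; field_simp
  have hr : ((z : ZMod p) ^ 2 / Z) ≠ 0 := div_ne_zero (pow_ne_zero _ hz) hZ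
  generalize (z : ZMod p) ^ 2 / Z = r at hv1 hr
  generalize (a * x ^ 2 + b * x * z ^ 2 + c * z ^ 4 : ℤ) = w at hv1 ⊢
  haveI : Fact (2 < p) := ⟨h2⟩
  have hJ : Ks w p = legendreSym p w := by
    unfold Ks; rw [Int.natAbs_natCast, jacobiSym.legendreSym.to_jacobiSym]
  rw [hJ]
  simp only [Bool.and_eq_true, Bool.or_eq_true, Bool.not_eq_true', Nat.beq_eq] at ht
  obtain ⟨t1, t2⟩ := ht
  constructor
  · intro hm
    rw [hm] at t1
    replace t1 := t1.resolve_left (by simp)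
    have e1 := eul_pow (v := v) hk
    rw [t1, cast_sub' (by omega)] at e1
    push_cast at e1
    rw [legendreSym.eq_neg_one_iff]
    intro hs
    have hv0 : (v : ZMod p) ≠ 0 := by
      intro h0; rw [h0, zero_pow (by omega)] at e1
      have : (1 : ZMod p) = 0 := by linear_combination -e1
      exact one_ne_zero this
    have hs2 : IsSquare (v : ZMod p) := by
      obtain ⟨y, hy⟩ := hs
      rw [hy] at hv1
      refine ⟨y / r, ?_⟩
      field_simp; linear_combination hv1
    rw [ZMod.euler_criterion p hv0] at hs2
    rw [hs2] at e1
    exact ZMod.neg_one_ne_one e1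
  · intro hm
    rw [hm] at t2
    replace t2 := t2.resolve_left (by simp)
    have e1 := eul_pow (v := v) hk
    rw [t2] at e1
    push_cast at e1
    have hv0 : (v : ZMod p) ≠ 0 := by
      intro h0; rw [h0, zero_pow (by omega)] at e1
      exact one_ne_zero e1
    have hw0 : (w : ZMod p) ≠ 0 := by rw [← hv1]; exact mul_ne_zero hv0 (pow_ne_zero _ hr)
    rw [legendreSym.eq_one_iff p hw0]
    obtain ⟨y, hy⟩ := (ZMod.euler_criterion p hv0).mpr e1.symm
    exact ⟨y * r, by rw [← hv1, hy]; ring⟩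

/-- all data of a table -/
def tchk (p k1 k2 A B C mN mP q h1 h2 g1 g2 : ℕ) : Bool :=
  Nat.ble 3 p && Nat.ble 3 q && Nat.beq (k1 * k2) (p / 2) && Nat.blt h1 p && Nat.blt h2 p &&
  tt p k1 k2 A B C mN mP 1 h1 1 && tt p k1 k2 A B C mN mP 2 g1 1 &&
  run p h1 h2 (tt p k1 k2 A B C mN mP) (q - 3) 2 g1 g2 1

theorem tab [NeZero (2 : ZMod p)] {k1 k2 A B C mN mP q h1 h2 g1 g2 N : ℕ}
    (h : tchk p k1 k2 A B C mN mP q h1 h2 g1 g2 = true)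
    (hH : IsPt (N • (G : (E (ZMod p)).Point)) h1 h2) (hH2 : IsPt ((2 * N) • (G : (E (ZMod p)).Point)) g1 g2)
    {a b c : ℤ} (ha : (a : ZMod p) = A) (hb : (b : ZMod p) = B) (hc : (c : ZMod p) = C)
    {m X Z Y : ℤ} (hI : IF (N * m) X Z Y) :
    (m % q ≠ 0 → (Z : ZMod p) ≠ 0 ∧
    (mN.testBit (m % q).toNat = true → Ks (a * X ^ 2 + b * X * Z ^ 2 + c * Z ^ 4) p = -1) ∧
    (mP.testBit (m % q).toNat = true → Ks (a * X ^ 2 + b * X * Z ^ 2 + c * Z ^ 4) p = 1)) ∧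
    (m % q = 0 → (Z : ZMod p) = 0) := by
  unfold tchk at h
  simp only [Bool.and_eq_true, Nat.ble_eq, Nat.beq_eq, Nat.blt_eq] at h
  obtain ⟨⟨⟨⟨⟨⟨⟨h3, hq⟩, hk⟩, r1⟩, r2⟩, t1⟩, t2⟩, r3⟩ := h
  have h2H : IsPt (2 • (N • (G : (E (ZMod p)).Point))) ((g1 : ZMod p) / (1 : ℕ)) (g2 / (1 : ℕ)) := by
    rw [← mul_nsmul']; simpa using hH2
  obtain ⟨w1, w2⟩ := run_sound r1 r2 _ hH _ 2 g1 g2 1 (by simp) h2H r3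
  rw [show 2 + (q - 3) + 1 = q by omega] at w1
  have ho : (0 : ℤ) < q := by omega
  set j := (m % q).toNat with hj
  have hj1 : (j : ℤ) = m % q := Int.toNat_of_nonneg (Int.emod_nonneg _ ho.ne')
  have hj2 : (j : ℤ) < q := by rw [hj1]; exact Int.emod_lt_of_pos _ ho
  have hmj : (N * m) • (G : (E (ZMod p)).Point) = j • (N • G) := by
    have : (N : ℤ) * m = j * N + (m / q) * (q * N) := by rw [hj1]; have := Int.emod_add_mul_ediv m q; linear_combination -N * this
    rw [this, add_zsmul, mul_zsmul, mul_zsmul, mul_zsmul, natCast_zsmul, natCast_zsmul, natCast_zsmul, w1]; simp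
  constructor
  · intro hm0
    have key : ∃ X' Z' : ℕ, (Z' : ZMod p) ≠ 0 ∧ (∃ y, IsPt (j • (N • (G : (E (ZMod p)).Point))) (X' / Z') y) ∧
        tt p k1 k2 A B C mN mP j X' Z' = true := by
      by_cases j1 : j = 1
      · rw [j1]; exact ⟨h1, 1, by simp, ⟨h2, by simpa using hH⟩, t1⟩
      by_cases j2 : j = 2
      · rw [j2]; exact ⟨g1, 1, by simp, ⟨_, h2H⟩, t2⟩
      exact w2 j (by omega) (by omega)
    obtain ⟨X', Z', hZ', ⟨y, hP⟩, ht⟩ := key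
    rw [← hmj] at hP
    have he : (Z : ZMod p) ≠ 0 := by
      intro he
      rcases hI.red (p := p) with ⟨-, h0⟩ | ⟨h0, -⟩
      · exact hP.ne_zero h0
      · exact h0 he
    have hx := (hP.inj (hI.red_ne he)).1
    exact ⟨he, tt_sound (by omega) hk ht hZ' he hx ha hb hc⟩
  · intro hm0
    have : j = 0 := by omega
    rw [this, zero_nsmul] at hmj
    exact hI.red_zero hmj

end

end Q13


namespace Q13

theorem ord3 : chkO 3 5 = true := by decide +kernel
theorem ord5 : chkO 5 10 = true := by decide +kernel
theorem ord11 : chkO 11 16 = true := by decide +kernel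
theorem ord17 : chkO 17 20 = true := by decide +kernel
theorem ord19 : chkO 19 7 = true := by decide +kernel
theorem ord23 : chkO 23 22 = true := by decide +kernel
theorem ord37 : chkO 37 42 = true := by decide +kernel
theorem ord59 : chkO 59 32 = true := by decide +kernel
theorem ord109 : chkO 109 55 = true := by decide +kernel
theorem ord173 : chkO 173 88 = true := by decide +kernel
theorem ord809 : chkO 809 416 = true := by decide +kernel
theorem ord1151 : chkO 1151 560 = true := by decide +kernel

instance fact773 : Fact (Nat.Prime 773) := ⟨by norm_num⟩

instance neZero773 : NeZero (2 : ZMod 773) := nz2 (by norm_num) (by norm_num)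

theorem pta773 : IsPt ((3 : ℕ) • (G : (E (ZMod 773)).Point)) ((4 : ℕ) : ZMod 773) ((7 : ℕ) : ZMod 773) :=
  lad_sound [(true, 771)] 2 1 772
    (by decide +kernel) (by rw [show ((772 : ℕ) : ZMod 773) = -1 by decide]; simpa using isPt_2Gp)

theorem ptb773 : IsPt ((2 * 3 : ℕ) • (G : (E (ZMod 773)).Point)) ((364 : ℕ) : ZMod 773) ((400 : ℕ) : ZMod 773) :=
  lad_sound [(true, 771), (false, 555)] 2 1 772
    (by decide +kernel) (by rw [show ((772 : ℕ) : ZMod 773) = -1 by decide]; simpa using isPt_2Gp)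

def maskN773 : ℕ := 0xae426bee7f87775c30ebbb87f9df5909d4

def maskP773 : ℕ := 0x151bd9411807888a3cf1444780620a6f62a

theorem tch773 : tchk 773 386 1 72 44 372 maskN773 maskP773 137 4 7 364 400 = true := by decide +kernel

theorem tbl773 {m X Z Y : ℤ} (hI : IF (3 * m) X Z Y) :
    (m % 137 ≠ 0 → (Z : ZMod 773) ≠ 0 ∧
    (maskN773.testBit (m % 137).toNat = true → Ks ((42587) * X ^ 2 + (-6140) * X * Z ^ 2 + (-135676) * Z ^ 4) 773 = -1) ∧
    (maskP773.testBit (m % 137).toNat = true → Ks ((42587) * X ^ 2 + (-6140) * X * Z ^ 2 + (-135676) * Z ^ 4) 773 = 1)) ∧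
    (m % 137 = 0 → (Z : ZMod 773) = 0) :=
  tab (N := 3) tch773 pta773 ptb773 (by decide +kernel) (by decide +kernel) (by decide +kernel) hI

instance fact169181 : Fact (Nat.Prime 169181) := ⟨by norm_num⟩

instance neZero169181 : NeZero (2 : ZMod 169181) := nz2 (by norm_num) (by norm_num)

theorem pta169181 : IsPt ((24 : ℕ) • (G : (E (ZMod 169181)).Point)) ((26508 : ℕ) : ZMod 169181) ((112425 : ℕ) : ZMod 169181) :=
  lad_sound [(true, 169179), (false, 72509), (false, 66672), (false, 4179)] 2 1 169180
    (by decide +kernel) (by rw [show ((169180 : ℕ) : ZMod 169181) = -1 by decide]; simpa using isPt_2Gp)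

theorem ptb169181 : IsPt ((2 * 24 : ℕ) • (G : (E (ZMod 169181)).Point)) ((162659 : ℕ) : ZMod 169181) ((102787 : ℕ) : ZMod 169181) :=
  lad_sound [(true, 169179), (false, 72509), (false, 66672), (false, 4179), (false, 129840)] 2 1 169180
    (by decide +kernel) (by rw [show ((169180 : ℕ) : ZMod 169181) = -1 by decide]; simpa using isPt_2Gp)

def maskN169181 : ℕ := 0x71dce81b003e54f79c08b7e2e17a48799188401dd1e5e9baf1abb8ee9e1247a78e0fc81846902785467942b604d29011683b4a82ba660665d4152dc1688094b206d429e62a1e409621813f071e5e24879771dd58f5d97a78bb80211899e125e8747ed1039ef2a7c00d8173b8e00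

def maskP169181 : ℕ := 0x7f8e2317e4ffc1ab0863f7481d1e85b7866e77bfe22e1a16450e54471161edb85871f037e7b96fd87ab986bd49fb2d6fee97c4b57d4599f99a2bead23e977f6b4df92bd619d5e1bf69de7ec0f8e1a1db78688e22a70a268587447fdee7661eda178b812efc610d583ff27e8c471fe

theorem tch169181 : tchk 169181 110 769 19043 101189 160666 maskN169181 maskP169181 883 26508 112425 162659 102787 = true := by decide +kernel

theorem tbl169181 {m X Z Y : ℤ} (hI : IF (24 * m) X Z Y) :
    (m % 883 ≠ 0 → (Z : ZMod 169181) ≠ 0 ∧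
    (maskN169181.testBit (m % 883).toNat = true → Ks ((188224) * X ^ 2 + (-67992) * X * Z ^ 2 + (-177696) * Z ^ 4) 169181 = -1) ∧
    (maskP169181.testBit (m % 883).toNat = true → Ks ((188224) * X ^ 2 + (-67992) * X * Z ^ 2 + (-177696) * Z ^ 4) 169181 = 1)) ∧
    (m % 883 = 0 → (Z : ZMod 169181) = 0) :=
  tab (N := 24) tch169181 pta169181 ptb169181 (by decide +kernel) (by decide +kernel) (by decide +kernel) hI

instance fact31469 : Fact (Nat.Prime 31469) := ⟨by norm_num⟩

instance neZero31469 : NeZero (2 : ZMod 31469) := nz2 (by norm_num) (by norm_num)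

theorem pta31469 : IsPt ((468 : ℕ) • (G : (E (ZMod 31469)).Point)) ((16679 : ℕ) : ZMod 31469) ((20518 : ℕ) : ZMod 31469) :=
  lad_sound [(true, 31467), (false, 8994), (true, 29103), (false, 8335), (false, 1891), (true, 24849), (false, 22592), (false, 24694), (true, 14677), (false, 5140), (false, 8908)] 2 1 31468
    (by decide +kernel) (by rw [show ((31468 : ℕ) : ZMod 31469) = -1 by decide]; simpa using isPt_2Gp)

theorem ptb31469 : IsPt ((2 * 468 : ℕ) • (G : (E (ZMod 31469)).Point)) ((2289 : ℕ) : ZMod 31469) ((25453 : ℕ) : ZMod 31469) :=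
  lad_sound [(true, 31467), (false, 8994), (true, 29103), (false, 8335), (false, 1891), (true, 24849), (false, 22592), (false, 24694), (true, 14677), (false, 5140), (false, 8908), (false, 6063)] 2 1 31468
    (by decide +kernel) (by rw [show ((31468 : ℕ) : ZMod 31469) = -1 by decide]; simpa using isPt_2Gp)

def maskN31469 : ℕ := 0x4b1cff1f0f8ff38d2

def maskP31469 : ℕ := 0x34e300e0f0700c72c

theorem tch31469 : tchk 31469 15734 1 0 26748 27067 maskN31469 maskP31469 67 16679 20518 2289 25453 = true := by decide +kernel

theorem tbl31469 {m X Z Y : ℤ} (hI : IF (468 * m) X Z Y) :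
    (m % 67 ≠ 0 → (Z : ZMod 31469) ≠ 0 ∧
    (maskN31469.testBit (m % 67).toNat = true → Ks ((0) * X ^ 2 + (435845) * X * Z ^ 2 + (184412) * Z ^ 4) 31469 = -1) ∧
    (maskP31469.testBit (m % 67).toNat = true → Ks ((0) * X ^ 2 + (435845) * X * Z ^ 2 + (184412) * Z ^ 4) 31469 = 1)) ∧
    (m % 67 = 0 → (Z : ZMod 31469) = 0) :=
  tab (N := 468) tch31469 pta31469 ptb31469 (by decide +kernel) (by decide +kernel) (by decide +kernel) hI

instance fact613 : Fact (Nat.Prime 613) := ⟨by norm_num⟩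

instance neZero613 : NeZero (2 : ZMod 613) := nz2 (by norm_num) (by norm_num)

theorem pta613 : IsPt ((160 : ℕ) • (G : (E (ZMod 613)).Point)) ((357 : ℕ) : ZMod 613) ((227 : ℕ) : ZMod 613) :=
  lad_sound [(false, 306), (true, 512), (false, 76), (false, 305), (false, 268), (false, 267), (false, 470)] 2 1 612
    (by decide +kernel) (by rw [show ((612 : ℕ) : ZMod 613) = -1 by decide]; simpa using isPt_2Gp)

theorem ptb613 : IsPt ((2 * 160 : ℕ) • (G : (E (ZMod 613)).Point)) ((113 : ℕ) : ZMod 613) ((0 : ℕ) : ZMod 613) :=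
  lad_sound [(false, 306), (true, 512), (false, 76), (false, 305), (false, 268), (false, 267), (false, 470), (false, 526)] 2 1 612
    (by decide +kernel) (by rw [show ((612 : ℕ) : ZMod 613) = -1 by decide]; simpa using isPt_2Gp)

def maskN613 : ℕ := 0x4

def maskP613 : ℕ := 0x0

theorem tch613 : tchk 613 306 1 0 2 512 maskN613 maskP613 4 357 227 113 0 = true := by decide +kernel

theorem tbl613 {m X Z Y : ℤ} (hI : IF (160 * m) X Z Y) :
    (m % 4 ≠ 0 → (Z : ZMod 613) ≠ 0 ∧
    (maskN613.testBit (m % 4).toNat = true → Ks ((0) * X ^ 2 + (435845) * X * Z ^ 2 + (184412) * Z ^ 4) 613 = -1) ∧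
    (maskP613.testBit (m % 4).toNat = true → Ks ((0) * X ^ 2 + (435845) * X * Z ^ 2 + (184412) * Z ^ 4) 613 = 1)) ∧
    (m % 4 = 0 → (Z : ZMod 613) = 0) :=
  tab (N := 160) tch613 pta613 ptb613 (by decide +kernel) (by decide +kernel) (by decide +kernel) hI

/-- every nonzero class has a multiplier landing in the mask -/
def cov (q mask : ℕ) (us : List ℕ) : Bool :=
  (List.range q).all fun j => Nat.beq j 0 || us.any fun u => mask.testBit (u * j % q)

theorem cov_sound {q mask : ℕ} {us : List ℕ} (h : cov q mask us = true) (hq : 0 < q) {C : ℤ} (hC : C % q ≠ 0) :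
    ∃ u ∈ us, mask.testBit ((C * u) % q).toNat = true := by
  unfold cov at h
  rw [List.all_eq_true] at h
  have ho : (0 : ℤ) < q := by omega
  have hj1 : ((C % q).toNat : ℤ) = C % q := Int.toNat_of_nonneg (Int.emod_nonneg _ ho.ne')
  have hj2 : C % q < q := Int.emod_lt_of_pos _ ho
  have h1 := h (C % q).toNat (by rw [List.mem_range]; omega)
  rw [Bool.or_eq_true, Nat.beq_eq] at h1
  have h2 := h1.resolve_left (by omega)
  rw [List.any_eq_true] at h2
  obtain ⟨u, hu, h3⟩ := h2
  refine ⟨u, hu, ?_⟩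
  have e : (C * u) % q = ((u * (C % q).toNat % q : ℕ) : ℤ) := by
    push_cast
    rw [hj1, mul_comm (u : ℤ)]; exact ((Int.mod_modEq C q).mul_right u).symm
  rw [e, Int.toNat_natCast]; exact h3

theorem cov773 : cov 137 maskP773 [1, 3, 5, 9, 15, 45] = true := by decide +kernel

theorem cov169181 : cov 883 maskP169181 [1, 3, 5, 9, 11, 15, 33, 45, 55, 99, 165, 495] = true := by decide +kernel

theorem cov31469n : cov 67 maskN31469 [1, 3, 7, 11, 21, 33, 77, 231] = true := by decide +kernel

theorem cov31469p : cov 67 maskP31469 [1, 3, 7, 11, 21, 33, 77, 231] = true := by decide +kernel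

end Q13


namespace Q13

theorem sq8 {a : ℤ} (h : Odd a) : a ^ 2 % 8 = 1 := by
  obtain ⟨k, rfl⟩ := h
  obtain ⟨t, ht⟩ := Int.even_mul_succ_self k
  have : (2 * k + 1) ^ 2 = 8 * t + 1 := by linear_combination 4 * ht
  omega

theorem IF.X8 {c X Z Y : ℤ} (h : IF c X Z Y) (h4 : 4 ∣ Z) : X % 8 = 1 := by
  obtain ⟨z, rfl⟩ := h4
  have hodd : Odd X := odd_of_cop h.cop ⟨2 * z, by ring⟩
  have hE := h.eq
  have hY : Odd Y := by
    rw [← Int.not_even_iff_odd]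
    intro hY
    have h1 : Even (X ^ 3) := by
      have : X ^ 3 = Y ^ 2 + 2 * (8 * X ^ 2 * z ^ 2 - 2048 * z ^ 6) := by linear_combination -hE
      rw [this]
      exact (hY.pow_of_ne_zero (by norm_num)).add (even_two_mul _)
    exact (Int.not_even_iff_odd.mpr (hodd.pow)) h1
  have hX2 := sq8 hodd
  have hY2 := sq8 hY
  have e : X - 1 = 8 * (Y ^ 2 / 8 - X * (X ^ 2 / 8) + 2 * X ^ 2 * z ^ 2 - 512 * z ^ 6) := by
    have h1 := Int.emod_add_mul_ediv (X ^ 2) 8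
    have h2 := Int.emod_add_mul_ediv (Y ^ 2) 8
    rw [hX2] at h1
    rw [hY2] at h2
    linear_combination -hE - h2 + X * h1
  omega

theorem cop_add {k : ℕ} {X S b w : ℤ} (h : IsCoprime X S) (hb : b = X ^ k + S * w) : IsCoprime b S := by
  rw [hb]; exact (h.pow_left (m := k)).add_mul_left_left w

theorem mod_add {k : ℕ} {X S b w : ℤ} (h8 : X % 8 = 1) (hS : 8 ∣ S) (hb : b = X ^ k + S * w) : b % 8 = 1 := by
  obtain ⟨T, rfl⟩ := hS
  have : X ^ k % 8 = 1 := by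
    have h : X ≡ 1 [ZMOD 8] := h8
    have := h.pow k
    rw [one_pow] at this; exact this
  rw [hb, mul_assoc]
  omega

theorem K_pow_two (a : ℕ) {b : ℤ} (hb : b % 8 = 1) : Ks (2 ^ a) b = 1 := by
  induction a with
  | zero => simpa using K_one b
  | succ a ih => rw [pow_succ, K_mul, ih, K_two hb]; rfl

theorem Kg {c X Z Y S b w n : ℤ} {k : ℕ} (a : ℕ) (h : IF c X Z Y) (hX : X % 8 = 1) (hn : Odd n) (hn0 : 0 < n)
    (nZ : n ∣ Z) (nS : n ∣ S) (h8 : 8 ∣ S) (hb : b = X ^ k + S * w) : Ks (2 ^ a * n) b = 1 := by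
  have hb8 := mod_add hX h8 hb
  rw [K_mul, K_pow_two a hb8, one_mul]
  refine K_odd (X := X) (s := Y) (k := k) hn hn0 ?_ (h.cop.of_isCoprime_of_dvd_right nZ) (by omega) ?_
  · obtain ⟨t, rfl⟩ := nZ
    exact ⟨X ^ 2 * n * t ^ 2 - n ^ 5 * t ^ 6, by linear_combination -h.eq⟩
  · rw [hb]; simpa using nS.mul_right w

/-- coprimality through a linear relation -/
theorem cop_lin {a b x y z : ℤ} (h : a * x + b * y = z) (hz : IsCoprime z y) : IsCoprime x y := by
  obtain ⟨r, s, hrs⟩ := hz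
  exact ⟨r * a, r * b + s, by linear_combination hrs + r * h⟩

theorem sgn_M {x : ℚ} (h : x ^ 6 - 2 * x ^ 5 + 20 * x ^ 3 - 20 * x ^ 2 + 8 * x - 8 < 0) : x < 11 / 10 := by
  by_contra hc
  obtain ⟨t, ht, rfl⟩ : ∃ t : ℚ, 0 ≤ t ∧ x = 11 / 10 + t := ⟨x - 11 / 10, by linarith, by ring⟩
  have : (0 : ℚ) < (11 / 10 + t) ^ 6 - 2 * (11 / 10 + t) ^ 5 + 20 * (11 / 10 + t) ^ 3 - 20 * (11 / 10 + t) ^ 2 + 8 * (11 / 10 + t) - 8 := by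
    have e : (11 / 10 + t) ^ 6 - 2 * (11 / 10 + t) ^ 5 + 20 * (11 / 10 + t) ^ 3 - 20 * (11 / 10 + t) ^ 2 + 8 * (11 / 10 + t) - 8
      = t ^ 6 + 23/5*t^5 + 143/20*t^4 + 1121/50 * t ^ 3 + 82683/2000 * t ^ 2 + 1581103/50000 * t + 1770541/1000000 := by ring
    rw [e]; positivity
  linarith

theorem cubic_pos {x : ℚ} (h : 0 < x ^ 3 - x ^ 2 + 1) : -1 < x := by
  by_contra hc
  have : x ≤ -1 := by linarith
  nlinarith [sq_nonneg x]

end Q13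


namespace Q13

theorem core1 {c X Z Y S : ℤ} (hI : IF c X Z Y) (h4 : 4 ∣ Z) (hS : Z ^ 2 = 3026232220 * S) (hZS : Z ∣ 2 * S)
    (hDZ : 45520585053240 ∣ Z) (hDS : 45520585053240 ∣ S) :
    ∃ g w : ℤ, 42587 * g = (42587) * X ^ 2 + (-6140) * X ^ 1 * (Z ^ 2) ^ 1 + (-135676) * (Z ^ 2) ^ 2 ∧ g = X ^ 2 + S * w ∧
     Ks (((44) * X ^ 3 + (-246) * X ^ 2 * (Z ^ 2) ^ 1 + (164) * X ^ 1 * (Z ^ 2) ^ 2 + (-88) * (Z ^ 2) ^ 3) *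
         ((3230) * X ^ 3 + (-6444) * X ^ 2 * (Z ^ 2) ^ 1 + (4296) * X ^ 1 * (Z ^ 2) ^ 2 + (-6460) * (Z ^ 2) ^ 3)) (Mf X (Z ^ 2)) = Ks 84257 g := by
  have hX := hI.X8 h4
  have h8 : 8 ∣ S := dvd_trans (by norm_num) hDS
  have hcS : IsCoprime X S := by
    have h1 : IsCoprime X (Z ^ 2) := hI.cop.pow_right
    exact h1.of_isCoprime_of_dvd_right ⟨3026232220, by rw [hS]; ring⟩
  have hZS2 : Z ∣ S ^ 2 := by
    obtain ⟨s, hs⟩ := h8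
    refine hZS.trans ⟨4 * s, ?_⟩
    rw [hs]; ring
  obtain ⟨l1, e1⟩ : ∃ l1, l1 = X ^ 3 + S * ((-16919389230) * X ^ 2 + (34134667220364660400) * X ^ 1 * S ^ 1 + (-55428962310912152681474096000) * S ^ 2) := ⟨_, rfl⟩
  obtain ⟨l0, e0⟩ : ∃ l0, l0 = X ^ 3 + S * ((-6037473816) * X ^ 2 + (12180531859590367680) * X ^ 1 * S ^ 1 + (-55428962310912152681474096000) * S ^ 2) := ⟨_, rfl⟩
  obtain ⟨γ, eγ⟩ : ∃ γ, γ = X ^ 1 + S * ((-5639796410)) := ⟨_, rfl⟩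
  obtain ⟨g, eg⟩ : ∃ g, g = X ^ 2 + S * ((-436308400) * X ^ 1 + (-29176318095291963200) * S ^ 1) := ⟨_, rfl⟩
  have eM : Mf X (Z ^ 2) = X ^ 6 + S * ((-6052464440) * X ^ 5 + (0) * X ^ 4 * S ^ 1 + (554289623109121526814740960000) * X ^ 3 * S ^ 2 + (-1677409116664480140342363064105731200000) * X ^ 2 * S ^ 3 + (2030491805988715492101672374213875697639705600000) * X ^ 1 * S ^ 4 + (-6144739725729039778611236454729927807272255038034432000000) * S ^ 5) := by
    rw [hS]; unfold Mf; ring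
  have q1 : 44 * l1 = (44) * X ^ 3 + (-246) * X ^ 2 * (3026232220 * S) ^ 1 + (164) * X ^ 1 * (3026232220 * S) ^ 2 + (-88) * (3026232220 * S) ^ 3 := by rw [e1]; ring
  have q0 : 3230 * l0 = (3230) * X ^ 3 + (-6444) * X ^ 2 * (3026232220 * S) ^ 1 + (4296) * X ^ 1 * (3026232220 * S) ^ 2 + (-6460) * (3026232220 * S) ^ 3 := by rw [e0]; ring
  have qγ : 44 * γ = (44) * X ^ 1 + (-82) * (3026232220 * S) ^ 1 := by rw [eγ]; ring
  have qg : 42587 * g = (42587) * X ^ 2 + (-6140) * X ^ 1 * (3026232220 * S) ^ 1 + (-135676) * (3026232220 * S) ^ 2 := by rw [eg]; ring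
  refine ⟨g, _, by rw [hS]; exact qg, eg, ?_⟩
  -- coprimality with everything supported on Z
  have cS : ∀ b n : ℤ, IsCoprime b S → ∀ k : ℕ, n ∣ Z ^ k → IsCoprime n b := by
    intro b n hb k hn
    have h1 : IsCoprime (Z ^ k) b :=
      ((hb.pow_right (n := 2)).of_isCoprime_of_dvd_right hZS2).symm.pow_left
    exact h1.of_isCoprime_of_dvd_left hn
  have d1 := cop_add hcS e1
  have d0 := cop_add hcS e0
  have dγ := cop_add hcS eγ
  have dg := cop_add hcS eg
  have hN2 : (3026232220 : ℤ) ∣ Z ^ 2 := ⟨S, hS⟩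
  have hD2 : (45520585053240 ^ 2 : ℤ) ∣ Z ^ 2 := pow_dvd_pow_of_dvd hDZ 2
  have hSZ : S ∣ Z ^ 2 := ⟨3026232220, by rw [hS]; ring⟩
  have hWp : 0 < Z ^ 2 := by have := hI.e0; positivity
  have hSp : 0 < S := by rw [hS] at hWp; linarith
  set Γ : ℤ := (-18) * X + (-3838) * (3026232220 * S) with hΓ
  set V : ℤ := 71060 * S with hV
  have p6 : IsCoprime Γ γ := by
    refine cop_lin (a := 44) (b := (18) * 44) (z := (-170348) * (3026232220 * S)) ?_ ?_
    · rw [hΓ]; linear_combination (18) * qγ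
    · refine cS _ _ dγ 6 ?_
      rw [show Z ^ 6 = Z ^ 4 * Z ^ 2 by ring]
      exact mul_dvd_mul (dvd_trans (b := (45520585053240) ^ 4) (by norm_num) (pow_dvd_pow_of_dvd hDZ 4)) ⟨1, by rw [hS]; ring⟩
  have pgγ : IsCoprime g γ := by
    refine cop_lin (a := 1936 * 42587) (b := -(44 * ((1873828) * X + (3221974) * (3026232220 * S)))) (z := (1533132) * (3026232220 * S) ^ 2) ?_ ?_
    · linear_combination 1936 * qg - ((1873828) * X + (3221974) * (3026232220 * S)) * qγ
    · refine cS _ _ dγ 16 ?_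
      rw [show Z ^ 16 = Z ^ 12 * Z ^ 4 by ring]
      refine mul_dvd_mul (dvd_trans (b := ((45520585053240) ^ 2) ^ 6) (by norm_num) ?_) ⟨1, by linear_combination (Z ^ 2 + 3026232220 * S) * hS⟩
      rw [show Z ^ 12 = (Z ^ 2) ^ 6 by ring]; exact pow_dvd_pow_of_dvd hD2 6
  have H2 : 44 * l1 = -V * Γ ^ 2 + γ * (44 * g - (-73) * V * Γ * 44 - (3438) * V * 44 ^ 2 * γ) := by
    rw [e1, hV, hΓ, eγ, eg]; ring
  have H3 : -(3230 * l0) = 84257 * V * (44 * γ) ^ 2 + g * (Γ + (-73) * 44 * γ) := by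
    rw [e0, hV, hΓ, eγ, eg]; ring
  have p3 : IsCoprime l0 l1 := by
    refine cop_lin (a := -(((-44) * X ^ 2 + (48) * X ^ 1 * (3026232220 * S) ^ 1 + (811) * (3026232220 * S) ^ 2) * 3230)) (b := ((-3230) * X ^ 2 + (-8091) * X ^ 1 * (3026232220 * S) ^ 1 + (15012) * (3026232220 * S) ^ 2) * 44) (z := 3918004 * (3026232220 * S) ^ 5) ?_ ?_
    · linear_combination -((-44) * X ^ 2 + (48) * X ^ 1 * (3026232220 * S) ^ 1 + (811) * (3026232220 * S) ^ 2) * q0 + ((-3230) * X ^ 2 + (-8091) * X ^ 1 * (3026232220 * S) ^ 1 + (15012) * (3026232220 * S) ^ 2) * q1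
    · refine cS _ _ d1 16 ?_
      rw [show Z ^ 16 = Z ^ 6 * Z ^ 10 by ring]
      refine mul_dvd_mul (dvd_trans (b := ((45520585053240) ^ 2) ^ 3) (by norm_num) ?_) ⟨1, by rw [show Z ^ 10 = (Z ^ 2) ^ 5 by ring, hS]; ring⟩
      rw [show Z ^ 6 = (Z ^ 2) ^ 3 by ring]; exact pow_dvd_pow_of_dvd hD2 3
  have hVc : ∀ b : ℤ, IsCoprime b S → IsCoprime b V := by
    intro b hb
    refine (cS _ _ hb 2 ⟨42587, ?_⟩).symm
    rw [hS, hV]; ring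
  have p2 : IsCoprime γ l1 := by
    have h1 : IsCoprime (44 * l1) γ := by
      rw [H2]
      refine IsCoprime.add_mul_left_left ?_ _
      exact ((hVc _ dγ).symm.neg_left).mul_left p6.pow_left
    exact (IsCoprime.of_mul_left_right h1).symm
  have p8 : IsCoprime γ l0 := by
    have h1 : IsCoprime (-(3230 * l0)) γ := by
      rw [H3, show 84257 * V * (44 * γ) ^ 2 + g * (Γ + (-73) * 44 * γ) = g * Γ + γ * (84257 * V * 44 ^ 2 * γ + g * (-73) * 44) by ring]
      exact (pgγ.mul_left p6).add_mul_left_left _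
    exact (IsCoprime.of_mul_left_right (IsCoprime.neg_left_iff _ _ |>.mp h1)).symm
  have kt44 : ∀ {b w : ℤ} {k : ℕ}, b = X ^ k + S * w → Ks 44 b = 1 := by
    intro b w k hb
    have := Kg (n := 11) 2 hI hX (by decide) (by norm_num) (dvd_trans (by norm_num) hDZ) (dvd_trans (by norm_num) hDS) h8 hb
    norm_num at this; exact this
  have kt3230 : ∀ {b w : ℤ} {k : ℕ}, b = X ^ k + S * w → Ks 3230 b = 1 := by
    intro b w k hb
    have := Kg (n := 1615) 1 hI hX (by decide) (by norm_num) (dvd_trans (by norm_num) hDZ) (dvd_trans (by norm_num) hDS) h8 hb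
    norm_num at this; exact this
  have kt42587 : ∀ {b w : ℤ} {k : ℕ}, b = X ^ k + S * w → Ks 42587 b = 1 := by
    intro b w k hb
    have := Kg (n := 42587) 0 hI hX (by decide) (by norm_num) (dvd_trans (by norm_num) hDZ) (dvd_trans (by norm_num) hDS) h8 hb
    norm_num at this; exact this
  -- signs
  obtain ⟨x, hx⟩ : ∃ x : ℚ, x = X / (3026232220 * S) := ⟨_, rfl⟩
  have hSq : (0 : ℚ) < 3026232220 * S := by
    have : (0 : ℚ) < S := by exact_mod_cast hSp
    positivity
  have hXx : (X : ℚ) = x * (3026232220 * S) := by rw [hx]; field_simp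
  have hE : 0 < x ^ 3 - x ^ 2 + 1 := by
    have h1 : ((Y : ℚ)) ^ 2 = X ^ 3 - X ^ 2 * (Z ^ 2 : ℤ) + (Z ^ 2 : ℤ) ^ 3 := by
      have := hI.eq
      push_cast
      exact_mod_cast (by linear_combination this : Y ^ 2 = X ^ 3 - X ^ 2 * (Z ^ 2) + (Z ^ 2) ^ 3)
    rw [hS, hXx] at h1
    push_cast at h1
    have h2 : (0 : ℚ) < (Y : ℚ) ^ 2 := by
      have := hI.u0
      have : (Y : ℚ) ≠ 0 := by exact_mod_cast this
      positivity
    have h3 : (Y : ℚ) ^ 2 = (3026232220 * S) ^ 3 * (x ^ 3 - x ^ 2 + 1) := by rw [h1]; ring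
    rw [h3] at h2
    exact (pos_iff_pos_of_mul_pos h2).mp (by positivity)
  have hxm := cubic_pos hE
  have r1 : (44 : ℚ) * l1 = (3026232220 * S) ^ 3 * ((44) * x ^ 3 + (-246) * x ^ 2 + (164) * x ^ 1 + (-88)) := by
    have : ((44 * l1 : ℤ) : ℚ) = _ := congrArg Int.cast q1
    push_cast at this; rw [hXx] at this; rw [this]; ring
  have r0 : (3230 : ℚ) * l0 = (3026232220 * S) ^ 3 * ((3230) * x ^ 3 + (-6444) * x ^ 2 + (4296) * x ^ 1 + (-6460)) := by
    have : ((3230 * l0 : ℤ) : ℚ) = _ := congrArg Int.cast q0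
    push_cast at this; rw [hXx] at this; rw [this]; ring
  have rγ : (44 : ℚ) * γ = (3026232220 * S) * ((44) * x ^ 1 + (-82)) := by
    have : ((44 * γ : ℤ) : ℚ) = _ := congrArg Int.cast qγ
    push_cast at this; rw [hXx] at this; rw [this]; ring
  have rg : (42587 : ℚ) * g = (3026232220 * S) ^ 2 * ((42587) * x ^ 2 + (-6140) * x ^ 1 + (-135676)) := by
    have : ((42587 * g : ℤ) : ℚ) = _ := congrArg Int.cast qg
    push_cast at this; rw [hXx] at this; rw [this]; ring
  have rM : ((Mf X (Z ^ 2) : ℤ) : ℚ) = (3026232220 * S) ^ 6 * (x ^ 6 - 2 * x ^ 5 + 20 * x ^ 3 - 20 * x ^ 2 + 8 * x - 8) := by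
    rw [hS]; unfold Mf; push_cast; rw [hXx]; ring
  -- sign transfer
  have tr : ∀ (k : ℚ) (l : ℤ) (n : ℕ) (v : ℚ), 0 < k → k * l = (3026232220 * S) ^ n * v → ((0 < l ↔ 0 < v) ∧ (l < 0 ↔ v < 0)) := by
    intro k l n v hk h
    have hp : (0 : ℚ) < (3026232220 * S) ^ n := by positivity
    constructor
    · rw [← Int.cast_pos (R := ℚ), ← mul_pos_iff_of_pos_left hk, h, mul_pos_iff_of_pos_left hp]
    · have h' : k * ((-l : ℤ) : ℚ) = (3026232220 * S) ^ n * (-v) := by push_cast; linear_combination -h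
      rw [← neg_pos, ← neg_pos (a := v), ← Int.cast_pos (R := ℚ), ← mul_pos_iff_of_pos_left hk, h', mul_pos_iff_of_pos_left hp]
  have t1 := tr 44 l1 3 _ (by norm_num) r1
  have t0 := tr 3230 l0 3 _ (by norm_num) r0
  have tγ := tr 44 γ 1 _ (by norm_num) (by rw [pow_one]; exact rγ)
  have tg := tr 42587 g 2 _ (by norm_num) rg
  have tM := tr 1 (Mf X (Z ^ 2)) 6 _ (by norm_num) (by rw [one_mul]; exact rM)
  clear tr r1 r0 rγ rg rM
  have u1 : x ≤ 82 / 44 → (44) * x ^ 3 + (-246) * x ^ 2 + (164) * x ^ 1 + (-88) < 0 := by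
    intro h
    nlinarith [sq_nonneg x, sq_nonneg (x - 1 / 2), mul_nonneg (sq_nonneg x) (sub_nonneg.mpr h)]
  have u0 : x ≤ 11 / 10 → (3230) * x ^ 3 + (-6444) * x ^ 2 + (4296) * x ^ 1 + (-6460) < 0 := by
    intro h
    nlinarith [sq_nonneg x, sq_nonneg (x - 1 / 2), mul_nonneg (sq_nonneg x) (sub_nonneg.mpr h)]
  have s1 : 0 < l1 → 0 < γ := by
    intro h
    rw [tγ.1]
    rw [t1.1] at h
    by_contra hc
    have := u1 (by linarith)
    linarith
  have s4 : Mf X (Z ^ 2) < 0 → l1 < 0 := by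
    intro h
    rw [tM.2] at h
    rw [t1.2]
    have := sgn_M h
    exact u1 (by linarith)
  have s3 : Mf X (Z ^ 2) < 0 → l0 < 0 := by
    intro h
    rw [tM.2] at h
    rw [t0.2]
    have := sgn_M h
    exact u0 (by linarith)
  have s2 : 0 < l0 → 0 < g := by
    intro h
    rw [t0.1] at h
    rw [tg.1]
    by_contra hc
    have hx1 : 11 / 10 < x := by
      by_contra h2
      have := u0 (by linarith)
      linarith
    have e : 42587 * ((3230) * x ^ 3 + (-6444) * x ^ 2 + (4296) * x ^ 1 + (-6460)) = -84257 * ((44) * x ^ 1 + (-82)) ^ 2 - ((42587) * x ^ 2 + (-6140) * x ^ 1 + (-135676)) * (-3230 * x + (2148)) := by ring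
    nlinarith [sq_nonneg ((44) * x ^ 1 + (-82)), mul_nonneg (sub_nonneg.mpr hx1.le) (neg_nonneg.mpr (not_lt.mp hc))]
  have key := chain12 (M := Mf X (Z ^ 2)) (g := g) (l1 := l1) (l0 := l0) (γ := γ) (Γ := Γ) (V := V) (Z := Z) (k1 := 44) (k0 := 3230)
    (I := 42587) (f := 84257) (by rw [hS, hV]; ring) (by rw [eM, e1, e0, hV, hΓ, eγ, eg]; ring) H2 H3
    (mod_add hX h8 eM) (mod_add hX h8 eg) (mod_add hX h8 e1) (mod_add hX h8 e0) (mod_add hX h8 eγ)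
    (kt44 eM) (kt3230 eM) (kt44 e1) (kt42587 e1) (kt44 eγ) (kt42587 eγ) (kt3230 eg) (kt42587 eg)
    (cS _ _ d1 2 (dvd_trans (by norm_num) hN2)) p2 p3 (cS _ _ d1 2 (dvd_trans (by norm_num) hN2))
    (cS _ _ d1 1 (by simp)) (cS _ _ dγ 1 (by simp)) p6 (cS _ _ d0 2 (dvd_trans (by norm_num) hN2)) p8
    (cS _ _ dg 1 (by simp)) pgγ.symm (cS _ _ dg 2 (dvd_trans (by norm_num) hN2)) s1 s2 s3 s4
  rw [← key, hS]
  congr 1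
  linear_combination -((44) * X ^ 3 + (-246) * X ^ 2 * (3026232220 * S) ^ 1 + (164) * X ^ 1 * (3026232220 * S) ^ 2 + (-88) * (3026232220 * S) ^ 3) * q0 - 3230 * l0 * q1

end Q13


namespace Q13

theorem core2 {c X Z Y S : ℤ} (hI : IF c X Z Y) (h4 : 4 ∣ Z) (hS : Z ^ 2 = 761366080 * S) (hZS : Z ∣ 2 * S)
    (hDZ : 890893484360 ∣ Z) (hDS : 890893484360 ∣ S) :
    ∃ g w : ℤ, 188224 * g = (188224) * X ^ 2 + (-67992) * X ^ 1 * (Z ^ 2) ^ 1 + (-177696) * (Z ^ 2) ^ 2 ∧ g = X ^ 2 + S * w ∧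
     Ks (((40) * X ^ 3 + (-384) * X ^ 2 * (Z ^ 2) ^ 1 + (256) * X ^ 1 * (Z ^ 2) ^ 2 + (-80) * (Z ^ 2) ^ 3) *
         ((6472) * X ^ 3 + (-5664) * X ^ 2 * (Z ^ 2) ^ 1 + (3776) * X ^ 1 * (Z ^ 2) ^ 2 + (-12944) * (Z ^ 2) ^ 3)) (Mf X (Z ^ 2)) = Ks 169181 g := by
  have hX := hI.X8 h4
  have h8 : 8 ∣ S := dvd_trans (by norm_num) hDS
  have hcS : IsCoprime X S := by
    have h1 : IsCoprime X (Z ^ 2) := hI.cop.pow_right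
    exact h1.of_isCoprime_of_dvd_right ⟨761366080, by rw [hS]; ring⟩
  have hZS2 : Z ∣ S ^ 2 := by
    obtain ⟨s, hs⟩ := h8
    refine hZS.trans ⟨4 * s, ?_⟩
    rw [hs]; ring
  obtain ⟨l1, e1⟩ : ∃ l1, l1 = X ^ 3 + S * ((-7309114368) * X ^ 2 + (3709941169757224960) * X ^ 1 * S ^ 1 + (-882694801702710287335424000) * S ^ 2) := ⟨_, rfl⟩
  obtain ⟨l0, e0⟩ : ∃ l0, l0 = X ^ 3 + S * ((-666312960) * X ^ 2 + (338205390938931200) * X ^ 1 * S ^ 1 + (-882694801702710287335424000) * S ^ 2) := ⟨_, rfl⟩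
  obtain ⟨γ, eγ⟩ : ∃ γ, γ = X ^ 1 + S * ((-2436371456)) := ⟨_, rfl⟩
  obtain ⟨g, eg⟩ : ∃ g, g = X ^ 2 + S * ((-275027640) * X ^ 1 + (-547254954619545600) * S ^ 1) := ⟨_, rfl⟩
  have eM : Mf X (Z ^ 2) = X ^ 6 + S * ((-1522732160) * X ^ 5 + (0) * X ^ 4 * S ^ 1 + (8826948017027102873354240000) * X ^ 3 * S ^ 2 + (-6720538810087698568442454160179200000) * X ^ 2 * S ^ 3 + (2046716115729734206110657211806131840614400000) * X ^ 1 * S ^ 4 + (-1558300225905974071948383127576564319451770519552000000) * S ^ 5) := by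
    rw [hS]; unfold Mf; ring
  have q1 : 40 * l1 = (40) * X ^ 3 + (-384) * X ^ 2 * (761366080 * S) ^ 1 + (256) * X ^ 1 * (761366080 * S) ^ 2 + (-80) * (761366080 * S) ^ 3 := by rw [e1]; ring
  have q0 : 6472 * l0 = (6472) * X ^ 3 + (-5664) * X ^ 2 * (761366080 * S) ^ 1 + (3776) * X ^ 1 * (761366080 * S) ^ 2 + (-12944) * (761366080 * S) ^ 3 := by rw [e0]; ring
  have qγ : 40 * γ = (40) * X ^ 1 + (-128) * (761366080 * S) ^ 1 := by rw [eγ]; ring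
  have qg : 188224 * g = (188224) * X ^ 2 + (-67992) * X ^ 1 * (761366080 * S) ^ 1 + (-177696) * (761366080 * S) ^ 2 := by rw [eg]; ring
  refine ⟨g, _, by rw [hS]; exact qg, eg, ?_⟩
  -- coprimality with everything supported on Z
  have cS : ∀ b n : ℤ, IsCoprime b S → ∀ k : ℕ, n ∣ Z ^ k → IsCoprime n b := by
    intro b n hb k hn
    have h1 : IsCoprime (Z ^ k) b :=
      ((hb.pow_right (n := 2)).of_isCoprime_of_dvd_right hZS2).symm.pow_left
    exact h1.of_isCoprime_of_dvd_left hn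
  have d1 := cop_add hcS e1
  have d0 := cop_add hcS e0
  have dγ := cop_add hcS eγ
  have dg := cop_add hcS eg
  have hN2 : (761366080 : ℤ) ∣ Z ^ 2 := ⟨S, hS⟩
  have hD2 : (890893484360 ^ 2 : ℤ) ∣ Z ^ 2 := pow_dvd_pow_of_dvd hDZ 2
  have hSZ : S ∣ Z ^ 2 := ⟨761366080, by rw [hS]; ring⟩
  have hWp : 0 < Z ^ 2 := by have := hI.e0; positivity
  have hSp : 0 < S := by rw [hS] at hWp; linarith
  set Γ : ℤ := (-6512) * X + (2016) * (761366080 * S) with hΓ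
  set V : ℤ := 4045 * S with hV
  have p6 : IsCoprime Γ γ := by
    refine cop_lin (a := 40) (b := (6512) * 40) (z := (-752896) * (761366080 * S)) ?_ ?_
    · rw [hΓ]; linear_combination (6512) * qγ
    · refine cS _ _ dγ 6 ?_
      rw [show Z ^ 6 = Z ^ 4 * Z ^ 2 by ring]
      exact mul_dvd_mul (dvd_trans (b := (890893484360) ^ 4) (by norm_num) (pow_dvd_pow_of_dvd hDZ 4)) ⟨1, by rw [hS]; ring⟩
  have pgγ : IsCoprime g γ := by
    refine cop_lin (a := 1600 * 188224) (b := -(40 * ((7528960) * X + (21372992) * (761366080 * S)))) (z := (2451429376) * (761366080 * S) ^ 2) ?_ ?_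
    · linear_combination 1600 * qg - ((7528960) * X + (21372992) * (761366080 * S)) * qγ
    · refine cS _ _ dγ 16 ?_
      rw [show Z ^ 16 = Z ^ 12 * Z ^ 4 by ring]
      refine mul_dvd_mul (dvd_trans (b := ((890893484360) ^ 2) ^ 6) (by norm_num) ?_) ⟨1, by linear_combination (Z ^ 2 + 761366080 * S) * hS⟩
      rw [show Z ^ 12 = (Z ^ 2) ^ 6 by ring]; exact pow_dvd_pow_of_dvd hD2 6
  have H2 : 40 * l1 = -V * Γ ^ 2 + γ * (40 * g - (1) * V * Γ * 40 - (2075) * V * 40 ^ 2 * γ) := by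
    rw [e1, hV, hΓ, eγ, eg]; ring
  have H3 : -(6472 * l0) = 169181 * V * (40 * γ) ^ 2 + g * (Γ + (1) * 40 * γ) := by
    rw [e0, hV, hΓ, eγ, eg]; ring
  have p3 : IsCoprime l0 l1 := by
    refine cop_lin (a := -(((-10) * X ^ 2 + (51) * X ^ 1 * (761366080 * S) ^ 1 + (338) * (761366080 * S) ^ 2) * 6472)) (b := ((-1618) * X ^ 2 + (-5865) * X ^ 1 * (761366080 * S) ^ 1 + (574) * (761366080 * S) ^ 2) * 40) (z := 4329152 * (761366080 * S) ^ 5) ?_ ?_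
    · linear_combination -((-10) * X ^ 2 + (51) * X ^ 1 * (761366080 * S) ^ 1 + (338) * (761366080 * S) ^ 2) * q0 + ((-1618) * X ^ 2 + (-5865) * X ^ 1 * (761366080 * S) ^ 1 + (574) * (761366080 * S) ^ 2) * q1
    · refine cS _ _ d1 16 ?_
      rw [show Z ^ 16 = Z ^ 6 * Z ^ 10 by ring]
      refine mul_dvd_mul (dvd_trans (b := ((890893484360) ^ 2) ^ 3) (by norm_num) ?_) ⟨1, by rw [show Z ^ 10 = (Z ^ 2) ^ 5 by ring, hS]; ring⟩
      rw [show Z ^ 6 = (Z ^ 2) ^ 3 by ring]; exact pow_dvd_pow_of_dvd hD2 3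
  have hVc : ∀ b : ℤ, IsCoprime b S → IsCoprime b V := by
    intro b hb
    refine (cS _ _ hb 2 ⟨188224, ?_⟩).symm
    rw [hS, hV]; ring
  have p2 : IsCoprime γ l1 := by
    have h1 : IsCoprime (40 * l1) γ := by
      rw [H2]
      refine IsCoprime.add_mul_left_left ?_ _
      exact ((hVc _ dγ).symm.neg_left).mul_left p6.pow_left
    exact (IsCoprime.of_mul_left_right h1).symm
  have p8 : IsCoprime γ l0 := by
    have h1 : IsCoprime (-(6472 * l0)) γ := by
      rw [H3, show 169181 * V * (40 * γ) ^ 2 + g * (Γ + (1) * 40 * γ) = g * Γ + γ * (169181 * V * 40 ^ 2 * γ + g * (1) * 40) by ring]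
      exact (pgγ.mul_left p6).add_mul_left_left _
    exact (IsCoprime.of_mul_left_right (IsCoprime.neg_left_iff _ _ |>.mp h1)).symm
  have kt40 : ∀ {b w : ℤ} {k : ℕ}, b = X ^ k + S * w → Ks 40 b = 1 := by
    intro b w k hb
    have := Kg (n := 5) 3 hI hX (by decide) (by norm_num) (dvd_trans (by norm_num) hDZ) (dvd_trans (by norm_num) hDS) h8 hb
    norm_num at this; exact this
  have kt6472 : ∀ {b w : ℤ} {k : ℕ}, b = X ^ k + S * w → Ks 6472 b = 1 := by
    intro b w k hb
    have := Kg (n := 809) 3 hI hX (by decide) (by norm_num) (dvd_trans (by norm_num) hDZ) (dvd_trans (by norm_num) hDS) h8 hb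
    norm_num at this; exact this
  have kt188224 : ∀ {b w : ℤ} {k : ℕ}, b = X ^ k + S * w → Ks 188224 b = 1 := by
    intro b w k hb
    have := Kg (n := 2941) 6 hI hX (by decide) (by norm_num) (dvd_trans (by norm_num) hDZ) (dvd_trans (by norm_num) hDS) h8 hb
    norm_num at this; exact this
  -- signs
  obtain ⟨x, hx⟩ : ∃ x : ℚ, x = X / (761366080 * S) := ⟨_, rfl⟩
  have hSq : (0 : ℚ) < 761366080 * S := by
    have : (0 : ℚ) < S := by exact_mod_cast hSp
    positivity
  have hXx : (X : ℚ) = x * (761366080 * S) := by rw [hx]; field_simp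
  have hE : 0 < x ^ 3 - x ^ 2 + 1 := by
    have h1 : ((Y : ℚ)) ^ 2 = X ^ 3 - X ^ 2 * (Z ^ 2 : ℤ) + (Z ^ 2 : ℤ) ^ 3 := by
      have := hI.eq
      push_cast
      exact_mod_cast (by linear_combination this : Y ^ 2 = X ^ 3 - X ^ 2 * (Z ^ 2) + (Z ^ 2) ^ 3)
    rw [hS, hXx] at h1
    push_cast at h1
    have h2 : (0 : ℚ) < (Y : ℚ) ^ 2 := by
      have := hI.u0
      have : (Y : ℚ) ≠ 0 := by exact_mod_cast this
      positivity
    have h3 : (Y : ℚ) ^ 2 = (761366080 * S) ^ 3 * (x ^ 3 - x ^ 2 + 1) := by rw [h1]; ring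
    rw [h3] at h2
    exact (pos_iff_pos_of_mul_pos h2).mp (by positivity)
  have hxm := cubic_pos hE
  have r1 : (40 : ℚ) * l1 = (761366080 * S) ^ 3 * ((40) * x ^ 3 + (-384) * x ^ 2 + (256) * x ^ 1 + (-80)) := by
    have : ((40 * l1 : ℤ) : ℚ) = _ := congrArg Int.cast q1
    push_cast at this; rw [hXx] at this; rw [this]; ring
  have r0 : (6472 : ℚ) * l0 = (761366080 * S) ^ 3 * ((6472) * x ^ 3 + (-5664) * x ^ 2 + (3776) * x ^ 1 + (-12944)) := by
    have : ((6472 * l0 : ℤ) : ℚ) = _ := congrArg Int.cast q0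
    push_cast at this; rw [hXx] at this; rw [this]; ring
  have rγ : (40 : ℚ) * γ = (761366080 * S) * ((40) * x ^ 1 + (-128)) := by
    have : ((40 * γ : ℤ) : ℚ) = _ := congrArg Int.cast qγ
    push_cast at this; rw [hXx] at this; rw [this]; ring
  have rg : (188224 : ℚ) * g = (761366080 * S) ^ 2 * ((188224) * x ^ 2 + (-67992) * x ^ 1 + (-177696)) := by
    have : ((188224 * g : ℤ) : ℚ) = _ := congrArg Int.cast qg
    push_cast at this; rw [hXx] at this; rw [this]; ring
  have rM : ((Mf X (Z ^ 2) : ℤ) : ℚ) = (761366080 * S) ^ 6 * (x ^ 6 - 2 * x ^ 5 + 20 * x ^ 3 - 20 * x ^ 2 + 8 * x - 8) := by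
    rw [hS]; unfold Mf; push_cast; rw [hXx]; ring
  -- sign transfer
  have tr : ∀ (k : ℚ) (l : ℤ) (n : ℕ) (v : ℚ), 0 < k → k * l = (761366080 * S) ^ n * v → ((0 < l ↔ 0 < v) ∧ (l < 0 ↔ v < 0)) := by
    intro k l n v hk h
    have hp : (0 : ℚ) < (761366080 * S) ^ n := by positivity
    constructor
    · rw [← Int.cast_pos (R := ℚ), ← mul_pos_iff_of_pos_left hk, h, mul_pos_iff_of_pos_left hp]
    · have h' : k * ((-l : ℤ) : ℚ) = (761366080 * S) ^ n * (-v) := by push_cast; linear_combination -h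
      rw [← neg_pos, ← neg_pos (a := v), ← Int.cast_pos (R := ℚ), ← mul_pos_iff_of_pos_left hk, h', mul_pos_iff_of_pos_left hp]
  have t1 := tr 40 l1 3 _ (by norm_num) r1
  have t0 := tr 6472 l0 3 _ (by norm_num) r0
  have tγ := tr 40 γ 1 _ (by norm_num) (by rw [pow_one]; exact rγ)
  have tg := tr 188224 g 2 _ (by norm_num) rg
  have tM := tr 1 (Mf X (Z ^ 2)) 6 _ (by norm_num) (by rw [one_mul]; exact rM)
  clear tr r1 r0 rγ rg rM
  have u1 : x ≤ 128 / 40 → (40) * x ^ 3 + (-384) * x ^ 2 + (256) * x ^ 1 + (-80) < 0 := by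
    intro h
    nlinarith [sq_nonneg x, sq_nonneg (x - 1 / 2), mul_nonneg (sq_nonneg x) (sub_nonneg.mpr h)]
  have u0 : x ≤ 11 / 10 → (6472) * x ^ 3 + (-5664) * x ^ 2 + (3776) * x ^ 1 + (-12944) < 0 := by
    intro h
    nlinarith [sq_nonneg x, sq_nonneg (x - 1 / 2), mul_nonneg (sq_nonneg x) (sub_nonneg.mpr h)]
  have s1 : 0 < l1 → 0 < γ := by
    intro h
    rw [tγ.1]
    rw [t1.1] at h
    by_contra hc
    have := u1 (by linarith)
    linarith
  have s4 : Mf X (Z ^ 2) < 0 → l1 < 0 := by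
    intro h
    rw [tM.2] at h
    rw [t1.2]
    have := sgn_M h
    exact u1 (by linarith)
  have s3 : Mf X (Z ^ 2) < 0 → l0 < 0 := by
    intro h
    rw [tM.2] at h
    rw [t0.2]
    have := sgn_M h
    exact u0 (by linarith)
  have s2 : 0 < l0 → 0 < g := by
    intro h
    rw [t0.1] at h
    rw [tg.1]
    have hx1 : 6 / 5 < x := by
      by_contra h2
      nlinarith [mul_nonneg (sq_nonneg x) (sub_nonneg.mpr (not_lt.mp h2)), mul_nonneg (sub_nonneg.mpr (not_lt.mp h2)) (by linarith : (0:ℚ) ≤ x + 1)]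
    nlinarith
  have key := chain12 (M := Mf X (Z ^ 2)) (g := g) (l1 := l1) (l0 := l0) (γ := γ) (Γ := Γ) (V := V) (Z := Z) (k1 := 40) (k0 := 6472)
    (I := 188224) (f := 169181) (by rw [hS, hV]; ring) (by rw [eM, e1, e0, hV, hΓ, eγ, eg]; ring) H2 H3
    (mod_add hX h8 eM) (mod_add hX h8 eg) (mod_add hX h8 e1) (mod_add hX h8 e0) (mod_add hX h8 eγ)
    (kt40 eM) (kt6472 eM) (kt40 e1) (kt188224 e1) (kt40 eγ) (kt188224 eγ) (kt6472 eg) (kt188224 eg)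
    (cS _ _ d1 2 (dvd_trans (by norm_num) hN2)) p2 p3 (cS _ _ d1 2 (dvd_trans (by norm_num) hN2))
    (cS _ _ d1 1 (by simp)) (cS _ _ dγ 1 (by simp)) p6 (cS _ _ d0 2 (dvd_trans (by norm_num) hN2)) p8
    (cS _ _ dg 1 (by simp)) pgγ.symm (cS _ _ dg 2 (dvd_trans (by norm_num) hN2)) s1 s2 s3 s4
  rw [← key, hS]
  congr 1
  linear_combination -((40) * X ^ 3 + (-384) * X ^ 2 * (761366080 * S) ^ 1 + (256) * X ^ 1 * (761366080 * S) ^ 2 + (-80) * (761366080 * S) ^ 3) * q0 - 6472 * l0 * q1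

end Q13


namespace Q13

theorem chk9281 : chk 9281 256 0xfffffffefffffffffffffffefffffffffffffffefffffffffffffffeffffffff = true := by decide +kernel

theorem sieve0 {m : ℤ} (hm : Good m) (h : 237837600 ∣ m) : 475675200 ∣ m := by
  have h1 := @chk_good 9281 _ _ ⟨by norm_num⟩ chk9281 _ hm
  by_contra hc
  obtain ⟨k, hk⟩ := h
  have hk1 : k % 2 = 1 := by
    rcases Int.emod_two_eq_zero_or_one k with h | h
    · exact absurd ⟨k / 2, by omega⟩ hc
    · exact h
  have h3 : m % 64 = 32 := by clear h1 hc; omega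
  have h2 : (m % 256).toNat = 32 ∨ (m % 256).toNat = 96 ∨ (m % 256).toNat = 160 ∨ (m % 256).toNat = 224 := by
    clear h1 hc hk; omega
  push_cast at h1
  rcases h2 with h2 | h2 | h2 | h2 <;> rw [h2] at h1 <;> revert h1 <;> decide +kernel

theorem pull {q : ℤ} (hq : Prime q) {k : ℤ} (hk : k ≠ 0) : ∃ (a : ℕ) (C : ℤ), k = q ^ a * C ∧ ¬ q ∣ C := by
  have := FiniteMultiplicity.exists_eq_pow_mul_and_not_dvd (Int.finiteMultiplicity_iff.mpr ⟨fun h => hq.not_isUnit (Int.isUnit_iff_natAbs_eq.mpr h), hk⟩)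
  exact ⟨_, this⟩

/-- an odd number in the shape `2 t + 1` -/
theorem odd_shape {q v : ℤ} (a : ℕ) (hq : Odd q) (hv : Odd v) : ∃ t, v * q ^ a = 2 * t + 1 := hv.mul hq.pow

theorem M_ne_two {p : ℕ} (hp : p.Prime) {M : ℤ} (hM : M % 8 = 1) (h : (p : ℤ) ∣ M) : 2 < p := by
  rcases hp.two_le.lt_or_eq with h1 | h1
  · exact h1
  · rw [← h1] at h; push_cast at h; omega

theorem M_mod {X Z : ℤ} (hX : X % 8 = 1) (h4 : 4 ∣ Z) : Mf X (Z ^ 2) % 8 = 1 := by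
  obtain ⟨z, rfl⟩ := h4
  refine mod_add (k := 6) (S := 8) (w := 2 * z ^ 2 * (- 2 * X ^ 5 + 20 * X ^ 3 * ((4 * z) ^ 2) ^ 2 - 20 * X ^ 2 * ((4 * z) ^ 2) ^ 3 + 8 * X * ((4 * z) ^ 2) ^ 4 - 8 * ((4 * z) ^ 2) ^ 5)) hX (by norm_num) ?_
  unfold Mf; ring

theorem fin_one {C0 u : ℤ} {X Z Y : ℤ}
    (hI : IF (5285280 * C0 * u) X Z Y) (hm : maskP773.testBit ((1761760 * C0 * u) % 137).toNat = true)
    (h0 : (1761760 * C0 * u) % 137 ≠ 0) : 23 ∣ Z ∧ 4 ∣ Z ∧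
     Ks ((44 * X ^ 3 - 246 * X ^ 2 * Z ^ 2 + 164 * X * Z ^ 4 - 88 * Z ^ 6) *
      (3230 * X ^ 3 - 6444 * X ^ 2 * Z ^ 2 + 4296 * X * Z ^ 4 - 6460 * Z ^ 6)) (Mf X (Z ^ 2)) = -1 := by
  have hd : ∀ n : ℤ, n ∣ 5285280 → n ∣ 5285280 * C0 * u := fun n hn => (hn.mul_right _).mul_right _
  have h8 : (8 : ℤ) ∣ Z := by
    have := hI.dvd_two 2 (hd _ (by norm_num)); norm_num at this; exact this
  have h3 := hI.dvd_p ord3 (by norm_num) (by norm_num) (hd _ (by norm_num))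
  have h5 := hI.dvd_p ord5 (by norm_num) (by norm_num) (hd _ (by norm_num))
  have h11 := hI.dvd_p ord11 (by norm_num) (by norm_num) (hd _ (by norm_num))
  have h17 := hI.dvd_p ord17 (by norm_num) (by norm_num) (hd _ (by norm_num))
  have h19 := hI.dvd_p ord19 (by norm_num) (by norm_num) (hd _ (by norm_num))
  have h37 := hI.dvd_p ord37 (by norm_num) (by norm_num) (hd _ (by norm_num))
  have h1151 := hI.dvd_p ord1151 (by norm_num) (by norm_num) (hd _ (by norm_num))
  have h23 := hI.dvd_p ord23 (by norm_num) (by norm_num) (hd _ (by norm_num))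
  have h109 := hI.dvd_p ord109 (by norm_num) (by norm_num) (hd _ (by norm_num))
  push_cast at h3 h5 h11 h17 h19 h37 h1151 h23 h109
  have hD : (45520585053240 : ℤ) ∣ Z := by
    have := (IsCoprime.mul_dvd (by norm_num) (IsCoprime.mul_dvd (by norm_num) (IsCoprime.mul_dvd (by norm_num) (IsCoprime.mul_dvd (by norm_num) (IsCoprime.mul_dvd (by norm_num) (IsCoprime.mul_dvd (by norm_num) (IsCoprime.mul_dvd (by norm_num) (IsCoprime.mul_dvd (by norm_num) (IsCoprime.mul_dvd (by norm_num) h8 h3) h5) h11) h17) h19) h37) h1151) h23) h109)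
    norm_num at this; exact this
  have h4 : (4 : ℤ) ∣ Z := dvd_trans (by norm_num) h8
  have hX := hI.X8 h4
  refine ⟨h23, h4, ?_⟩
  obtain ⟨r, hr⟩ : (3026232220 : ℤ) ∣ Z := dvd_trans (by norm_num) hD
  obtain ⟨g, w, g1, g2, g3⟩ := core1 (S := Z * r) hI h4 (by rw [hr]; ring) (Dvd.intro (2 * r) (by ring)) hD (hD.mul_right r)
  have hS8 : 8 ∣ Z * r := h8.mul_right r
  have e : ((44 * X ^ 3 - 246 * X ^ 2 * Z ^ 2 + 164 * X * Z ^ 4 - 88 * Z ^ 6) *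
      (3230 * X ^ 3 - 6444 * X ^ 2 * Z ^ 2 + 4296 * X * Z ^ 4 - 6460 * Z ^ 6)) = (((44) * X ^ 3 + (-246) * X ^ 2 * (Z ^ 2) ^ 1 + (164) * X ^ 1 * (Z ^ 2) ^ 2 + (-88) * (Z ^ 2) ^ 3) *
         ((3230) * X ^ 3 + (-6444) * X ^ 2 * (Z ^ 2) ^ 1 + (4296) * X ^ 1 * (Z ^ 2) ^ 2 + (-6460) * (Z ^ 2) ^ 3)) := by ring
  rw [e, g3]
  have ht := ((tbl773 (m := 1761760 * C0 * u) (by convert hI using 1; ring)).1 h0).2.2 hm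
  rw [show 42587 * X ^ 2 + -6140 * X * Z ^ 2 + -135676 * Z ^ 4 = 42587 * g by rw [g1]; ring, K_mul] at ht
  have hc : Ks 42587 773 = -1 := by unfold Ks; norm_num
  have hg : Ks g 773 = -1 := by rw [hc] at ht; linarith
  have hg8 := mod_add hX hS8 g2
  rw [show (84257 : ℤ) = 2 ^ 0 * 109 * 773 by norm_num, K_mul,
    Kg 0 hI hX (by decide) (by norm_num) h109 (h109.mul_right r) hS8 g2, one_mul,
    K_rec (by norm_num) (by rw [Int.odd_iff]; clear * - hg8; omega) (by norm_num), hg]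

theorem fin_two {C0 u : ℤ} {X Z Y : ℤ} 
    (hI : IF (960960 * C0 * u) X Z Y) (hm : maskP169181.testBit ((40040 * C0 * u) % 883).toNat = true)
    (h0 : (40040 * C0 * u) % 883 ≠ 0) : 23 ∣ Z ∧ 4 ∣ Z ∧
     Ks ((40 * X ^ 3 - 384 * X ^ 2 * Z ^ 2 + 256 * X * Z ^ 4 - 80 * Z ^ 6) *
      (6472 * X ^ 3 - 5664 * X ^ 2 * Z ^ 2 + 3776 * X * Z ^ 4 - 12944 * Z ^ 6)) (Mf X (Z ^ 2)) = -1 := by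
  have hd : ∀ n : ℤ, n ∣ 960960 → n ∣ 960960 * C0 * u := fun n hn => (hn.mul_right _).mul_right _
  have h32 : (32 : ℤ) ∣ Z := by
    have := hI.dvd_two 4 (hd _ (by norm_num)); norm_num at this; exact this
  have h5 := hI.dvd_p ord5 (by norm_num) (by norm_num) (hd _ (by norm_num))
  have h11 := hI.dvd_p ord11 (by norm_num) (by norm_num) (hd _ (by norm_num))
  have h17 := hI.dvd_p ord17 (by norm_num) (by norm_num) (hd _ (by norm_num))
  have h37 := hI.dvd_p ord37 (by norm_num) (by norm_num) (hd _ (by norm_num))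
  have h173 := hI.dvd_p ord173 (by norm_num) (by norm_num) (hd _ (by norm_num))
  have h23 := hI.dvd_p ord23 (by norm_num) (by norm_num) (hd _ (by norm_num))
  have h809 := hI.dvd_p ord809 (by norm_num) (by norm_num) (hd _ (by norm_num))
  push_cast at h5 h11 h17 h37 h173 h23 h809
  have hD : (4 * 890893484360 : ℤ) ∣ Z := by
    have := (IsCoprime.mul_dvd (by norm_num) (IsCoprime.mul_dvd (by norm_num) (IsCoprime.mul_dvd (by norm_num) (IsCoprime.mul_dvd (by norm_num) (IsCoprime.mul_dvd (by norm_num) (IsCoprime.mul_dvd (by norm_num) (IsCoprime.mul_dvd (by norm_num) h32 h5) h11) h17) h37) h173) h809) h23)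
    norm_num at this ⊢; exact this
  have hD' : (890893484360 : ℤ) ∣ Z := dvd_trans (by norm_num) hD
  have h4 : (4 : ℤ) ∣ Z := dvd_trans (by norm_num) h32
  have hX := hI.X8 h4
  refine ⟨h23, h4, ?_⟩
  obtain ⟨r, hr⟩ : (380683040 : ℤ) ∣ Z := dvd_trans (by norm_num) hD
  obtain ⟨r2, hr2⟩ := hD
  obtain ⟨S, hS⟩ : (2 : ℤ) ∣ Z * r := (dvd_trans (by norm_num) h4 : (2:ℤ) ∣ Z).mul_right r
  have hDS : (890893484360 : ℤ) ∣ S := by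
    refine ⟨2 * r2 * r, ?_⟩
    have : 2 * S = 4 * 890893484360 * r2 * r := by rw [← hS, hr2]
    linarith
  have hS8 : 8 ∣ S := dvd_trans (by norm_num) hDS
  obtain ⟨g, w, g1, g2, g3⟩ := core2 (S := S) hI h4 (by
    rw [show 761366080 * S = 380683040 * (2 * S) by ring, ← hS]; rw [hr]; ring) ⟨r, hS.symm⟩ hD' hDS
  have e : ((40 * X ^ 3 - 384 * X ^ 2 * Z ^ 2 + 256 * X * Z ^ 4 - 80 * Z ^ 6) *
      (6472 * X ^ 3 - 5664 * X ^ 2 * Z ^ 2 + 3776 * X * Z ^ 4 - 12944 * Z ^ 6)) = (((40) * X ^ 3 + (-384) * X ^ 2 * (Z ^ 2) ^ 1 + (256) * X ^ 1 * (Z ^ 2) ^ 2 + (-80) * (Z ^ 2) ^ 3) *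
         ((6472) * X ^ 3 + (-5664) * X ^ 2 * (Z ^ 2) ^ 1 + (3776) * X ^ 1 * (Z ^ 2) ^ 2 + (-12944) * (Z ^ 2) ^ 3)) := by ring
  rw [e, g3]
  have ht := ((tbl169181 (m := 40040 * C0 * u) (by convert hI using 1; ring)).1 h0).2.2 hm
  rw [show 188224 * X ^ 2 + -67992 * X * Z ^ 2 + -177696 * Z ^ 4 = 188224 * g by rw [g1]; ring, K_mul] at ht
  have hc : Ks 188224 169181 = -1 := by unfold Ks; norm_num
  have hg : Ks g 169181 = -1 := by rw [hc] at ht; linarith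
  have hg8 := mod_add hX hS8 g2
  rw [K_rec (by norm_num) (by rw [Int.odd_iff]; clear * - hg8; omega) (by norm_num), hg]

theorem final1 {m a e u s : ℤ} (hI : IF m a e u)
    (hs : s ^ 2 = 4 * a ^ 4 - 7 * a ^ 3 * e ^ 2 + 7 * a ^ 2 * e ^ 4 - 4 * a * e ^ 6 + e ^ 8)
    (hd : 475675200 ∣ m - 1) : m = 1 := by
  by_contra hm1
  obtain ⟨k, hk⟩ := hd
  have hk0 : k ≠ 0 := by rintro rfl; omega
  obtain ⟨n, C0, hC, hq⟩ := pull (q := 137) (Int.prime_iff_natAbs_prime.mpr (by norm_num)) hk0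
  have h0 : (1761760 * C0) % (137 : ℕ) ≠ 0 := by push_cast; omega
  obtain ⟨v, hv, ht⟩ := cov_sound cov773 (by norm_num) h0
  have hv45 : ∃ w : ℤ, Odd w ∧ (v : ℤ) * w = 45 := by
    simp only [List.mem_cons, List.not_mem_nil, or_false] at hv
    rcases hv with rfl | rfl | rfl | rfl | rfl | rfl
    exacts [⟨45, by decide, by norm_num⟩, ⟨15, by decide, by norm_num⟩, ⟨9, by decide, by norm_num⟩, ⟨5, by decide, by norm_num⟩, ⟨3, by decide, by norm_num⟩, ⟨1, by decide, by norm_num⟩]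
  obtain ⟨w, hw, hvw⟩ := hv45
  have hq' : Prime (137 : ℤ) := Int.prime_iff_natAbs_prime.mpr (by norm_num)
  have h0' : (1761760 * C0 * v) % 137 ≠ 0 := by
    intro h
    rcases hq'.dvd_or_dvd (Int.dvd_of_emod_eq_zero h) with h | h
    · push_cast at h0; omega
    · have := h.mul_right w; rw [hvw] at this; omega
  have hc0 : 5285280 * C0 * v ≠ 0 := by
    have h1 : C0 ≠ 0 := by rintro rfl; simp at hq
    have h2 : (v : ℤ) ≠ 0 := by intro h; rw [h] at hvw; omega
    positivity
  obtain ⟨X, Z, Y, hIX, -⟩ := exists_IF' hc0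
  obtain ⟨h23, h4, hK⟩ := fin_one hIX ht h0'
  obtain ⟨t, ht2⟩ := odd_shape n (by decide : Odd (137 : ℤ)) hw
  refine K_ne_of_sq (fun p hp hpd => ?_) hK
  have : Fact p.Prime := ⟨hp⟩
  have := nz2 hp (M_ne_two hp (M_mod (hIX.X8 h4) h4) hpd)
  refine case1 (t := t) hIX h23 hpd hI hs ?_
  rw [← ht2]
  have : m = 1 + 475675200 * k := by linarith
  rw [this, hC]
  linear_combination (-10570560 * C0 * 137 ^ n) * hvw

theorem final2 {m a e u s : ℤ} (hI : IF m a e u)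
    (hs : s ^ 2 = 4 * a ^ 4 - 7 * a ^ 3 * e ^ 2 + 7 * a ^ 2 * e ^ 4 - 4 * a * e ^ 6 + e ^ 8)
    (hd : 951350400 ∣ m - 2) : m = 2 := by
  by_contra hm1
  obtain ⟨k, hk⟩ := hd
  have hk0 : k ≠ 0 := by rintro rfl; omega
  obtain ⟨n, C0, hC, hq⟩ := pull (q := 883) (Int.prime_iff_natAbs_prime.mpr (by norm_num)) hk0
  have h0 : (40040 * C0) % (883 : ℕ) ≠ 0 := by push_cast; omega
  obtain ⟨v, hv, ht⟩ := cov_sound cov169181 (by norm_num) h0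
  have hv45 : ∃ w : ℤ, Odd w ∧ (v : ℤ) * w = 495 := by
    simp only [List.mem_cons, List.not_mem_nil, or_false] at hv
    rcases hv with rfl | rfl | rfl | rfl | rfl | rfl | rfl | rfl | rfl | rfl | rfl | rfl
    exacts [⟨495, by decide, by norm_num⟩, ⟨165, by decide, by norm_num⟩, ⟨99, by decide, by norm_num⟩, ⟨55, by decide, by norm_num⟩, ⟨45, by decide, by norm_num⟩, ⟨33, by decide, by norm_num⟩,
      ⟨15, by decide, by norm_num⟩, ⟨11, by decide, by norm_num⟩, ⟨9, by decide, by norm_num⟩, ⟨5, by decide, by norm_num⟩, ⟨3, by decide, by norm_num⟩, ⟨1, by decide, by norm_num⟩]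
  obtain ⟨w, hw, hvw⟩ := hv45
  have hq' : Prime (883 : ℤ) := Int.prime_iff_natAbs_prime.mpr (by norm_num)
  have h0' : (40040 * C0 * v) % 883 ≠ 0 := by
    intro h
    rcases hq'.dvd_or_dvd (Int.dvd_of_emod_eq_zero h) with h | h
    · push_cast at h0; omega
    · have := h.mul_right w; rw [hvw] at this; omega
  have hc0 : 960960 * C0 * v ≠ 0 := by
    have h1 : C0 ≠ 0 := by rintro rfl; simp at hq
    have h2 : (v : ℤ) ≠ 0 := by intro h; rw [h] at hvw; omega
    positivity
  obtain ⟨X, Z, Y, hIX, -⟩ := exists_IF' hc0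
  obtain ⟨h23, h4, hK⟩ := fin_two hIX ht h0'
  obtain ⟨t, ht2⟩ := odd_shape n (by decide : Odd (883 : ℤ)) hw
  refine K_ne_of_sq (fun p hp hpd => ?_) hK
  have : Fact p.Prime := ⟨hp⟩
  have := nz2 hp (M_ne_two hp (M_mod (hIX.X8 h4) h4) hpd)
  refine case2 (t := t) hIX h23 hpd hI hs ?_
  rw [← ht2]
  have : m = 2 + 951350400 * k := by linarith
  rw [this, hC]
  linear_combination (-1921920 * C0 * 883 ^ n) * hvw

end Q13


namespace Q13

theorem K_two5 {b : ℤ} (hb : b % 8 = 5) : Ks 2 b = -1 := by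
  unfold Ks
  have hodd : Odd b.natAbs := by rw [Int.natAbs_odd, Int.odd_iff]; omega
  rw [show (2 : ℤ) = ((2 : ℕ) : ℤ) by norm_num]
  have := jacobiSym.at_two hodd
  push_cast
  rw [this, ZMod.χ₈_nat_eq_if_mod_eight]
  have h8 : b.natAbs % 8 = 5 ∨ b.natAbs % 8 = 3 := by omega
  have h2 : b.natAbs % 2 = 1 := by omega
  rcases h8 with h | h <;> simp [h, h2]

/-- the chain of reciprocities for the trivial class -/
theorem core0 {c X Z Y r : ℤ} (hI : IF c X Z Y) (hr : Z = 7788 * r) (h8 : 8 ∣ r) :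
    ∃ Q' w : ℤ, Q' = X ^ 2 + (Z * r) * w ∧ 0 < Q' ∧ 3894 * Q' = 3894 * X ^ 2 - 2161 * X * Z ^ 2 + 3008 * Z ^ 4 ∧
      Ks (4 * X ^ 4 - 7 * X ^ 3 * Z ^ 2 + 7 * X ^ 2 * Z ^ 4 - 4 * X * Z ^ 6 + Z ^ 8) (Mf X (Z ^ 2)) =
      Ks Q' (435845 * X + 184412 * Z ^ 2) := by
  have h4 : 4 ∣ Z := by rw [hr]; exact Dvd.dvd.mul_right (by norm_num) _
  have hX := hI.X8 h4
  obtain ⟨S, hSd⟩ : ∃ S, S = Z * r := ⟨_, rfl⟩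
  have hS : Z ^ 2 = 7788 * S := by rw [hSd]; linear_combination Z * hr
  rw [← hSd]
  have hS8 : 8 ∣ S := by rw [hSd]; exact h8.mul_left Z
  have hZS : Z ∣ S := ⟨r, hSd⟩
  have hNZ : (7788 : ℤ) ∣ Z := ⟨r, hr⟩
  have hNS : (7788 : ℤ) ∣ S := hNZ.trans hZS
  have hcS : IsCoprime X S := by
    have h1 : IsCoprime X (Z ^ 2) := hI.cop.pow_right
    exact h1.of_isCoprime_of_dvd_right ⟨7788, by rw [hS]; ring⟩
  have hZ0 := hI.e0
  obtain ⟨q, eq⟩ : ∃ q, q = X ^ 4 + S * ((-13629) * X ^ 3 + (106142652) * X ^ 2 * S ^ 1 + (-472365127872) * X ^ 1 * S ^ 2 + (919694903966784) * S ^ 3) := ⟨_, rfl⟩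
  obtain ⟨C, eC⟩ : ∃ C, C = X ^ 3 + S * ((-32450) * X ^ 2 + (170165204) * X ^ 1 * S ^ 1 + (-1312125355200) * S ^ 2) := ⟨_, rfl⟩
  obtain ⟨Q, eQ⟩ : ∃ Q, Q = X ^ 2 + S * ((-4322) * X ^ 1 + (46852608) * S ^ 1) := ⟨_, rfl⟩
  have eM : Mf X (Z ^ 2) = X ^ 6 + S * ((-15576) * X ^ 5 + (0) * X ^ 4 * S ^ 1 + (9447302557440) * X ^ 3 * S ^ 2 + (-73575592317342720) * X ^ 2 * S ^ 3 + (229202685186986041344) * X ^ 1 * S ^ 4 + (-1785030512236247289987072) * S ^ 5) := by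
    rw [hS]; unfold Mf; ring
  have q1 : 4 * q = 4 * X ^ 4 - 7 * X ^ 3 * Z ^ 2 + 7 * X ^ 2 * (Z ^ 2) ^ 2 - 4 * X * (Z ^ 2) ^ 3 + (Z ^ 2) ^ 4 := by
    rw [hS, eq]; ring
  have C1 : 36 * C = 36 * X ^ 3 - 150 * X ^ 2 * Z ^ 2 + 101 * X * (Z ^ 2) ^ 2 - 100 * (Z ^ 2) ^ 3 := by
    rw [hS, eC]; ring
  have Q1 : 3894 * Q = 3894 * X ^ 2 - 2161 * X * Z ^ 2 + 3008 * (Z ^ 2) ^ 2 := by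
    rw [hS, eQ]; ring
  have hq0 : 0 < q := by
    have : 0 < 615 * 400 * (4 * q) := by
      rw [q1, show 615 * 400 * (4 * X ^ 4 - 7 * X ^ 3 * Z ^ 2 + 7 * X ^ 2 * (Z ^ 2) ^ 2 - 4 * X * (Z ^ 2) ^ 3 + (Z ^ 2) ^ 4)
       = 615 * (40 * X ^ 2 - 35 * X * Z ^ 2 + 12 * (Z ^ 2) ^ 2) ^ 2 + (Z ^ 2) ^ 2 * ((615 * X - 380 * Z ^ 2) ^ 2 + 13040 * (Z ^ 2) ^ 2) by ring]
      positivity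
    linarith
  have hQ0 : 0 < Q := by
    have : 0 < 4 * 3894 * (3894 * Q) := by
      rw [Q1, show 4 * 3894 * (3894 * X ^ 2 - 2161 * X * Z ^ 2 + 3008 * (Z ^ 2) ^ 2)
       = (2 * 3894 * X - 2161 * Z ^ 2) ^ 2 + 42182687 * (Z ^ 2) ^ 2 by ring]
      positivity
    linarith
  refine ⟨Q, _, eQ, hQ0, by rw [Q1]; ring, ?_⟩
  have dq := cop_add hcS eq
  have dC := cop_add hcS eC
  have dQ := cop_add hcS eQ
  have mq := mod_add hX hS8 eq
  have mC := mod_add hX hS8 eC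
  have mQ := mod_add hX hS8 eQ
  have mM := mod_add hX hS8 eM
  have od : ∀ {b : ℤ}, b % 8 = 1 → Odd b := fun h => by rw [Int.odd_iff]; omega
  have m4 : ∀ {b : ℤ}, b % 8 = 1 → b % 4 = 1 := fun h => by omega
  have cS : ∀ b n : ℤ, IsCoprime b S → ∀ k : ℕ, n ∣ Z ^ k → IsCoprime n b := by
    intro b n hb k hn
    have h1 : IsCoprime (Z ^ k) b := (hb.of_isCoprime_of_dvd_right hZS).symm.pow_left
    exact h1.of_isCoprime_of_dvd_left hn
  have c6 : ∀ b : ℤ, IsCoprime b S → IsCoprime 6 b := fun b hb => cS b 6 hb 1 (by rw [pow_one]; exact dvd_trans (by norm_num) hNZ)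
  have c3894 : ∀ b : ℤ, IsCoprime b S → IsCoprime 3894 b := fun b hb => cS b _ hb 1 (by rw [pow_one]; exact dvd_trans (by norm_num) hNZ)
  have cZ : ∀ b : ℤ, IsCoprime b S → ∀ k, IsCoprime (Z ^ k) b := fun b hb k => cS b _ hb k dvd_rfl
  -- first step
  have s1 : Ks (4 * X ^ 4 - 7 * X ^ 3 * Z ^ 2 + 7 * X ^ 2 * Z ^ 4 - 4 * X * Z ^ 6 + Z ^ 8) (Mf X (Z ^ 2)) = Ks (Mf X (Z ^ 2)) q := by
    rw [show 4 * X ^ 4 - 7 * X ^ 3 * Z ^ 2 + 7 * X ^ 2 * Z ^ 4 - 4 * X * Z ^ 6 + Z ^ 8 = 2 ^ 2 * q by linear_combination -q1,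
      K_sq_mul _ (by
        have h2 : Odd (Mf X (Z ^ 2)) := od mM
        exact (Int.isCoprime_iff_gcd_eq_one.mpr (by
          have := Int.isCoprime_iff_gcd_eq_one.mp (Int.isCoprime_two_left.mpr h2); exact this))),
      K_rec (m4 mq) (od mM) (Or.inl hq0)]
  have cA : IsCoprime (4 * X ^ 2 - 3 * X * Z ^ 2 + 4 * (Z ^ 2) ^ 2) q := by
    refine cop_lin (a := X * Z ^ 2 - X ^ 2) (b := 4) (z := Z ^ 8) ?_ (cZ _ dq 8)
    linear_combination q1
  have s2 : Ks (Mf X (Z ^ 2)) q = Ks C q := by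
    rw [← K_sq_mul (Mf X (Z ^ 2)) cA, ← K_sq_mul C ((c6 _ dq).mul_left (cZ _ dq 7))]
    refine K_mod ⟨4 * (4 * X ^ 6 - 7 * X ^ 5 * Z ^ 2 + 3 * X ^ 4 * (Z ^ 2) ^ 2 + 75 * X ^ 3 * (Z ^ 2) ^ 3 - 66 * X ^ 2 * (Z ^ 2) ^ 4 + 107 * X * (Z ^ 2) ^ 5 - 28 * (Z ^ 2) ^ 6), ?_⟩
    unfold Mf
    linear_combination -(Z ^ 14) * C1 - (4 * X ^ 6 - 7 * X ^ 5 * Z ^ 2 + 3 * X ^ 4 * (Z ^ 2) ^ 2 + 75 * X ^ 3 * (Z ^ 2) ^ 3 - 66 * X ^ 2 * (Z ^ 2) ^ 4 + 107 * X * (Z ^ 2) ^ 5 - 28 * (Z ^ 2) ^ 6) * q1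
  have s3 : Ks C q = Ks q C := (K_rec (m4 mq) (od mC) (Or.inl hq0)).symm
  have k1298 : Ks 1298 C = 1 := by
    have := Kg (n := 649) 1 hI hX (by decide) (by norm_num) (dvd_trans (by norm_num) hNZ) (dvd_trans (by norm_num) hNS) hS8 eC
    norm_num at this; exact this
  have s4 : Ks q C = Ks Q C := by
    have h1 : Ks q C = Ks ((6 * Z ^ 2) ^ 2 * (1298 * Q)) C := by
      have c2 : IsCoprime (72 : ℤ) C := by
        have := (c6 _ dC).mul_left ((c6 _ dC).mul_left ((Int.isCoprime_two_left.mpr (od mC))))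
        norm_num at this; exact this
      rw [← K_sq_mul q c2]
      refine K_mod ⟨36 * (144 * X + 348 * Z ^ 2), ?_⟩
      linear_combination 1296 * q1 - (144 * X + 348 * Z ^ 2) * C1 - 12 * Z ^ 4 * Q1
    rw [h1, K_sq_mul _ ((c6 _ dC).mul_left (cZ _ dC 2)), K_mul, k1298, one_mul]
  have s5 : Ks Q C = Ks C Q := K_rec (m4 mQ) (od mC) (Or.inl hQ0)
  have s6 : Ks C Q = Ks (435845 * X + 184412 * Z ^ 2) Q := by
    rw [← K_sq_mul C ((c3894 _ dQ).mul_left (c6 _ dQ)), ← K_sq_mul (435845 * X + 184412 * Z ^ 2) ((c6 _ dQ).mul_left (cZ _ dQ 2))]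
    refine K_mod ⟨3894 * (140184 * X - 506304 * Z ^ 2), ?_⟩
    linear_combination 3894 ^ 2 * C1 - (140184 * X - 506304 * Z ^ 2) * Q1
  rw [s1, s2, s3, s4, s5, s6]
  obtain ⟨z, hz⟩ := h4
  have hL : (435845 * X + 184412 * Z ^ 2) % 4 = 1 := by
    rw [hz]; ring_nf; omega
  exact K_rec hL (od mQ) (Or.inr hQ0)

theorem lin0 {X Z Q S w : ℤ} (hc : IsCoprime X Z) (hQ : Q = X ^ 2 + S * w) (hZS : Z ∣ S) (hX : X % 8 = 1) (h8 : 3894 ∣ Z)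
    (h4 : 4 ∣ Z) (e : 3894 * Q = 3894 * X ^ 2 - 2161 * X * Z ^ 2 + 3008 * Z ^ 4) :
    Ks Q (435845 * X + 184412 * Z ^ 2) = Ks 25039065106 (435845 * X + 184412 * Z ^ 2) := by
  obtain ⟨d, A, z, hd0, hA, hz, hcz⟩ : ∃ d A z : ℤ, d ≠ 0 ∧ 435845 = d * A ∧ Z = d * z ∧ IsCoprime A z := by
    have h0 : Int.gcd 435845 Z ≠ 0 := by
      intro h; rw [Int.gcd_eq_zero_iff] at h; omega
    obtain ⟨g1, g2⟩ := And.intro (Int.gcd_dvd_left (435845 : ℤ) Z) (Int.gcd_dvd_right (435845 : ℤ) Z)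
    obtain ⟨A, hA⟩ := g1
    obtain ⟨z, hz⟩ := g2
    refine ⟨_, A, z, by exact_mod_cast h0, hA, hz, ?_⟩
    rw [Int.isCoprime_iff_gcd_eq_one]
    have h1 : Int.gcd 435845 Z = Int.gcd 435845 Z * Int.gcd A z := by
      conv_lhs => rw [hA]
      conv_lhs => arg 2; rw [hz]
      rw [Int.gcd_mul_left]; simp
    exact Nat.eq_of_mul_eq_mul_left (Nat.pos_of_ne_zero h0) (by rw [← h1, mul_one])
  -- `435845` is squarefree
  have hAd : IsCoprime A d := by
    have hsf : Squarefree (435845 : ℤ) := by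
      have h1 : Squarefree (5 * 61 * 1429 : ℕ) := by
        rw [Nat.squarefree_mul (by norm_num), Nat.squarefree_mul (by norm_num)]
        exact ⟨⟨(Nat.prime_iff.mp (by norm_num)).squarefree, (Nat.prime_iff.mp (by norm_num)).squarefree⟩,
          (Nat.prime_iff.mp (by norm_num)).squarefree⟩
      rw [← Int.squarefree_natAbs]
      exact h1
    rw [hA] at hsf
    exact ((squarefree_mul_iff.mp hsf).1).isCoprime.symm
  have hdZ : d ∣ Z := ⟨z, hz⟩
  have hzZ : z ∣ Z := ⟨d, by rw [hz]; ring⟩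
  have hd' : d ∣ 435845 := ⟨A, hA⟩
  have hA' : A ∣ 435845 := ⟨d, by rw [hA]; ring⟩
  have eL : 435845 * X + 184412 * Z ^ 2 = d * (A * X + 184412 * d * z ^ 2) := by
    rw [hA, hz]; ring
  have hL : (435845 * X + 184412 * Z ^ 2) % 4 = 1 := by
    obtain ⟨z, hz⟩ := h4
    rw [hz]; ring_nf; omega
  have hL0 : A * X + 184412 * d * z ^ 2 ≠ 0 := by
    intro h; rw [eL, h] at hL; simp at hL
  have cXd : IsCoprime X d := hc.of_isCoprime_of_dvd_right hdZ
  have cXz : IsCoprime X z := hc.of_isCoprime_of_dvd_right hzZ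
  have cf : ∀ k : ℤ, IsCoprime k 435845 → IsCoprime k d ∧ IsCoprime k A := fun k hk =>
    ⟨hk.of_isCoprime_of_dvd_right hd', hk.of_isCoprime_of_dvd_right hA'⟩
  have b1 := cf 184412 (by norm_num)
  have b2 := cf 3894 (by norm_num)
  have b3 := cf 63376 (by norm_num)
  have b4 := cf 11682 (by norm_num)
  have h3894z : (3894 : ℤ) ∣ z := b2.1.dvd_of_dvd_mul_left (by rw [← hz]; exact h8)
  have c1 : IsCoprime A (A * X + 184412 * d * z ^ 2) := by
    rw [add_comm]
    exact (((b1.2.mul_left hAd.symm).mul_left (hcz.symm.pow_left)).symm).add_mul_left_right X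
  have c2 : ∀ k : ℤ, k ∣ 184412 * d * z ^ 2 → IsCoprime k A → IsCoprime X k → IsCoprime k (A * X + 184412 * d * z ^ 2) := by
    rintro k ⟨t, ht⟩ h1 h2
    rw [ht]
    exact (h1.mul_right h2.symm).add_mul_left_right t
  have c3 : IsCoprime (d * z ^ 2) (A * X + 184412 * d * z ^ 2) :=
    c2 _ ⟨184412, by ring⟩ (hAd.symm.mul_left hcz.symm.pow_left) (cXd.mul_right cXz.pow_right)
  have c4 : IsCoprime 3894 (A * X + 184412 * d * z ^ 2) :=
    c2 _ (h3894z.trans ⟨184412 * d * z, by ring⟩) b2.2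
      (hc.of_isCoprime_of_dvd_right h8)
  have c5 : IsCoprime 3 (A * X + 184412 * d * z ^ 2) := c4.of_isCoprime_of_dvd_left (by norm_num)
  rw [eL, K_mul_right _ hd0 hL0, K_mul_right _ hd0 hL0]
  have k1 : Ks Q d = 1 := by
    rw [K_mod (a' := X ^ 2) (b := d), K_sq_one cXd]
    rw [hQ]
    obtain ⟨t, ht⟩ := hdZ.trans hZS
    exact ⟨t * w, by rw [ht]; ring⟩
  have k2 : Ks 25039065106 d = 1 := by
    rw [K_mod (a' := 63376 ^ 2) (b := d), K_sq_one b3.1]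
    exact hd'.trans (by norm_num)
  have k3 : Ks Q (A * X + 184412 * d * z ^ 2) = Ks 25039065106 (A * X + 184412 * d * z ^ 2) := by
    rw [← K_sq_mul Q (c4.mul_left c1), ← K_sq_mul 25039065106 ((c4.mul_left c5).mul_left c3)]
    refine K_mod ⟨3894 * (3894 * (A * X - 184412 * d * z ^ 2) - 2161 * A * Z ^ 2), ?_⟩
    rw [hz] at e ⊢
    linear_combination 3894 * A ^ 2 * e - 3894 * d ^ 2 * z ^ 4 * (2161 * 184412 + 3008 * (d * A + 435845)) * hA
  rw [k1, k2, k3]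


end Q13


namespace Q13

theorem KL {c X Z Y n : ℤ} (h : IF c X Z Y) (hX : X % 8 = 1) (hn : Odd n) (hn0 : 0 < n) (nZ : n ∣ Z) :
    Ks (435845 * X + 184412 * Z ^ 2) n = Ks 435845 n := by
  have h1 := Kg (S := 8 * n) (w := 0) (b := X) (k := 1) 0 h hX hn hn0 nZ ⟨8, by ring⟩ ⟨n, rfl⟩ (by ring)
  rw [pow_zero, one_mul] at h1
  rw [K_mod (a' := 435845 * X), K_mul, K_rec (a := X) (by omega) hn (Or.inr hn0), h1, mul_one]
  obtain ⟨t, rfl⟩ := nZ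
  exact ⟨184412 * n * t ^ 2, by ring⟩

theorem KLm {X Z : ℤ} {p : ℕ} (hp : p.Prime) (hZ : (Z : ZMod p) ≠ 0)
    (h : Ks ((0) * X ^ 2 + (435845) * X * Z ^ 2 + (184412) * Z ^ 4) p = -1) :
    Ks (435845 * X + 184412 * Z ^ 2) p = -1 := by
  rw [← K_sq_mul (a := Z) (435845 * X + 184412 * Z ^ 2), ← h]
  · congr 1; ring
  · rw [Ne, ZMod.intCast_zmod_eq_zero_iff_dvd ] at hZ
    exact ((Nat.prime_iff_prime_int.mp hp).coprime_iff_not_dvd.mpr hZ).symm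

theorem fin_zero {C0 u : ℤ} {X Z Y : ℤ}
    (hI : IF (2059200 * C0 * u) X Z Y) (hm : maskN31469.testBit ((4400 * C0 * u) % 67).toNat = true)
    (h0 : (4400 * C0 * u) % 67 ≠ 0) : 23 ∣ Z ∧ 4 ∣ Z ∧
     Ks (4 * X ^ 4 - 7 * X ^ 3 * Z ^ 2 + 7 * X ^ 2 * Z ^ 4 - 4 * X * Z ^ 6 + Z ^ 8) (Mf X (Z ^ 2)) = -1 := by
  have hd : ∀ n : ℤ, n ∣ 2059200 → n ∣ 2059200 * C0 * u := fun n hn => (hn.mul_right _).mul_right _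
  have h32 : (32 : ℤ) ∣ Z := by
    have := hI.dvd_two 4 (hd _ (by norm_num)); norm_num at this; exact this
  have h3 := hI.dvd_p ord3 (by norm_num) (by norm_num) (hd _ (by norm_num))
  have h11 := hI.dvd_p ord11 (by norm_num) (by norm_num) (hd _ (by norm_num))
  have h59 := hI.dvd_p ord59 (by norm_num) (by norm_num) (hd _ (by norm_num))
  have h23 := hI.dvd_p ord23 (by norm_num) (by norm_num) (hd _ (by norm_num))
  push_cast at h3 h11 h59 h23
  have hD : (7788 * 8 : ℤ) ∣ Z := by
    have := (IsCoprime.mul_dvd (by norm_num) (IsCoprime.mul_dvd (by norm_num) (IsCoprime.mul_dvd (by norm_num) h32 h3) h11) h59)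
    norm_num at this ⊢; exact this
  have h4 : (4 : ℤ) ∣ Z := dvd_trans (by norm_num) h32
  have hX := hI.X8 h4
  refine ⟨h23, h4, ?_⟩
  obtain ⟨r0, hr0⟩ := hD
  obtain ⟨Q, w, q1, -, q3, q4⟩ := core0 (r := 8 * r0) hI (by rw [hr0]; ring) ⟨r0, rfl⟩
  rw [q4, lin0 hI.cop q1 ⟨8 * r0, rfl⟩ hX ⟨16 * r0, by rw [hr0]; ring⟩ h4 q3]
  have hL : (435845 * X + 184412 * Z ^ 2) % 8 = 5 := by
    obtain ⟨z, hz⟩ := h4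
    rw [hz]; ring_nf; clear * - hX; omega
  have hr : ∀ n : ℤ, Odd n → 0 < n → Ks n (435845 * X + 184412 * Z ^ 2) = Ks (435845 * X + 184412 * Z ^ 2) n :=
    fun n hn h0 => (K_rec (by clear * - hL; omega) hn (Or.inr h0)).symm
  have k11 : Ks (435845 * X + 184412 * Z ^ 2) 11 = 1 := by
    rw [KL hI hX (by decide) (by norm_num) h11]; unfold Ks; norm_num
  have k59 : Ks (435845 * X + 184412 * Z ^ 2) 59 = 1 := by
    rw [KL hI hX (by decide) (by norm_num) h59]; unfold Ks; norm_num
  have kq : Ks (435845 * X + 184412 * Z ^ 2) 31469 = -1 := by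
    have := (tbl31469 (m := 4400 * C0 * u) (by convert hI using 1; ring)).1 h0
    exact_mod_cast KLm (by norm_num) this.1 (this.2.1 hm)
  have k613 : Ks (435845 * X + 184412 * Z ^ 2) 613 = -1 := by
    have hT := tbl613 (m := 2 * (6435 * C0 * u)) (by convert hI using 1; ring)
    rcases Int.emod_two_eq_zero_or_one (6435 * C0 * u) with h | h
    · have := hT.2 (by clear * - h; omega)
      rw [ZMod.intCast_zmod_eq_zero_iff_dvd] at this
      rw [KL hI hX (by decide) (by norm_num) (by exact_mod_cast this)]; unfold Ks; norm_num
    · have h2 : (2 * (6435 * C0 * u)) % 4 = 2 := by clear * - h; omega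
      have := hT.1 (by rw [h2]; norm_num)
      exact_mod_cast KLm (by norm_num) this.1 (this.2.1 (by rw [h2]; decide))
  rw [show (25039065106 : ℤ) = 2 * (11 * (59 * (613 * 31469))) by norm_num, K_mul, K_mul, K_mul, K_mul, K_two5 hL,
    hr 11 (by decide) (by norm_num), hr 59 (by decide) (by norm_num), hr 613 (by decide) (by norm_num),
    hr 31469 (by rw [Int.odd_iff]; norm_num) (by norm_num), k11, k59, k613, kq]
  norm_num

theorem final0 {m a e u s : ℤ} (hI : IF m a e u)
    (hs : s ^ 2 = 4 * a ^ 4 - 7 * a ^ 3 * e ^ 2 + 7 * a ^ 2 * e ^ 4 - 4 * a * e ^ 6 + e ^ 8)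
    (hd : 475675200 ∣ m) : False := by
  obtain ⟨k, hk⟩ := hd
  have hk0 : k ≠ 0 := by
    rintro rfl
    have h1 := hI.pt.ne_zero
    rw [hk] at h1
    simp at h1
  have hq' : Prime (67 : ℤ) := Int.prime_iff_natAbs_prime.mpr (by norm_num)
  obtain ⟨n, C0, hC, hq⟩ := pull hq' hk0
  have h0 : (4400 * C0) % (67 : ℕ) ≠ 0 := by push_cast; omega
  obtain ⟨v, hv, ht⟩ := cov_sound cov31469n (by norm_num) h0
  have hv45 : ∃ w : ℤ, Odd w ∧ (v : ℤ) * w = 231 := by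
    simp only [List.mem_cons, List.not_mem_nil, or_false] at hv
    rcases hv with rfl | rfl | rfl | rfl | rfl | rfl | rfl | rfl
    exacts [⟨231, by decide, by norm_num⟩, ⟨77, by decide, by norm_num⟩, ⟨33, by decide, by norm_num⟩, ⟨21, by decide, by norm_num⟩,
      ⟨11, by decide, by norm_num⟩, ⟨7, by decide, by norm_num⟩, ⟨3, by decide, by norm_num⟩, ⟨1, by decide, by norm_num⟩]
  obtain ⟨w, hw, hvw⟩ := hv45
  have h0' : (4400 * C0 * v) % 67 ≠ 0 := by
    intro h
    rcases hq'.dvd_or_dvd (Int.dvd_of_emod_eq_zero h) with h | h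
    · push_cast at h0; omega
    · have := h.mul_right w; rw [hvw] at this; omega
  have hc0 : 2059200 * C0 * v ≠ 0 := by
    have h1 : C0 ≠ 0 := by rintro rfl; simp at hq
    have h2 : (v : ℤ) ≠ 0 := by intro h; rw [h] at hvw; omega
    positivity
  obtain ⟨X, Z, Y, hIX, -⟩ := exists_IF' hc0
  obtain ⟨h23, h4, hK⟩ := fin_zero hIX ht h0'
  obtain ⟨t, ht2⟩ := odd_shape n (by decide : Odd (67 : ℤ)) hw
  refine K_ne_of_sq (fun p hp hpd => ?_) hK
  have : Fact p.Prime := ⟨hp⟩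
  have := nz2 hp (M_ne_two hp (M_mod (hIX.X8 h4) h4) hpd)
  refine case0 (t := t) hIX h23 hpd hI hs ?_
  rw [← ht2, hk, hC]
  linear_combination (-2059200 * C0 * 67 ^ n) * hvw

theorem IF.neg {m a e u : ℤ} (h : IF m a e u) : IF (-m) a e (-u) := by
  refine ⟨h.e0, h.cop, by rw [neg_sq]; exact h.eq, ?_⟩
  have := h.pt.neg
  rw [neg_smul]; convert this using 1; push_cast; ring

theorem part1 {x u v : ℚ} (h1 : u ^ 2 = x ^ 3 - x ^ 2 + 1)
    (h2 : v ^ 2 = 4 * x ^ 4 - 7 * x ^ 3 + 7 * x ^ 2 - 4 * x + 1) : x = 0 ∨ x = 1 := by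
  obtain ⟨m, hm⟩ := gen h1
  obtain ⟨a, e, w, hI, he, hx, hy⟩ := exists_IF hm
  have he' : (e : ℚ) ≠ 0 := by exact_mod_cast he.ne'
  obtain ⟨s, hs⟩ : ∃ s : ℤ, s ^ 2 = 4 * a ^ 4 - 7 * a ^ 3 * e ^ 2 + 7 * a ^ 2 * e ^ 4 - 4 * a * e ^ 6 + e ^ 8 := by
    have h3 : (v * e ^ 4) ^ 2 = ((4 * a ^ 4 - 7 * a ^ 3 * e ^ 2 + 7 * a ^ 2 * e ^ 4 - 4 * a * e ^ 6 + e ^ 8 : ℤ) : ℚ) := by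
      rw [mul_pow, h2, hx]; push_cast; field_simp
    have h4 : IsSquare ((4 * a ^ 4 - 7 * a ^ 3 * e ^ 2 + 7 * a ^ 2 * e ^ 4 - 4 * a * e ^ 6 + e ^ 8 : ℤ) : ℚ) :=
      ⟨v * e ^ 4, by rw [← h3]; ring⟩
    rw [Rat.isSquare_intCast_iff] at h4
    obtain ⟨s, hs⟩ := h4
    exact ⟨s, by rw [hs]; ring⟩
  have hG : Good m := Or.inr ⟨a, e, w, s, hI, hs⟩
  rcases sieve hG with h | h | h | h | h
  · exact (final0 hI hs (sieve0 hG h)).elim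
  · obtain rfl := final2 hI hs h
    exact Or.inr (hm.inj (by rw [two_smul, ← two_nsmul]; exact isPt_2G)).1
  · have := final2 hI.neg hs (by rw [← dvd_neg, show -(-m - 2) = m + 2 by ring]; exact h)
    have hm' := hm.neg
    rw [← neg_smul, this] at hm'
    exact Or.inr (hm'.inj (by rw [two_smul, ← two_nsmul]; exact isPt_2G)).1
  · obtain rfl := final1 hI hs h
    exact Or.inl (hm.inj (by rw [one_smul]; exact isPt_G)).1
  · have := final1 hI.neg hs (by rw [← dvd_neg, show -(-m - 1) = m + 1 by ring]; exact h)
    have hm' := hm.neg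
    rw [← neg_smul, this] at hm'
    exact Or.inl (hm'.inj (by rw [one_smul]; exact isPt_G)).1

end Q13

theorem stmt_13 :
    {p : ℚ × ℚ |
        p.2 ^ 2 = 4 * p.1 ^ 7 - 11 * p.1 ^ 6 + 14 * p.1 ^ 5 - 7 * p.1 ^ 4 -
          2 * p.1 ^ 3 + 6 * p.1 ^ 2 - 4 * p.1 + 1} =
      ({(0, 1), (0, -1), (1, 1), (1, -1)} : Set (ℚ × ℚ)) := by
  ext ⟨x, y⟩
  simp only [Set.mem_ofPred_eq, Set.mem_insert_iff, Set.mem_singleton_iff, Prod.mk.injEq]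
  constructor
  · intro h
    obtain ⟨u, v, h1, h2⟩ := Q13.part0 x y h
    rcases Q13.part1 h1 h2 with rfl | rfl
    · have : y ^ 2 = 1 := by rw [h]; norm_num
      rcases (sq_eq_sq_iff_eq_or_eq_neg.mp (this.trans (one_pow 2).symm)) with h | h <;> simp [h]
    · have : y ^ 2 = 1 := by rw [h]; norm_num
      rcases (sq_eq_sq_iff_eq_or_eq_neg.mp (this.trans (one_pow 2).symm)) with h | h <;> simp [h]
  · rintro (⟨rfl, rfl⟩ | ⟨rfl, rfl⟩ | ⟨rfl, rfl⟩ | ⟨rfl, rfl⟩) <;> norm_num
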